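/- arXiv:1911.08643 — 3 statements merged into one kernel-verified Lean document; each statement's English description precedes it below -/
import Mathlib

section
/- Let a ∈ (0,∞), a ≠ 1, and let μ be a finite Borel measure with compact support contained in B(0,1) ⊂ ℝ. Suppose either γ ∈ (0,1] and s ∈ (0,1/2), or γ > 1 and s ∈ [1/4, 1/2), and suppose I_{1-2s}(μ) < ∞. Then for all f ∈ H^s(ℝ): ∫ sup_{0<t<1} |P^t_{a,γ} f(x)| dμ(x) ≲ I_{1-2s}(μ)^{1/2} ‖f‖_{H^s(ℝ)}. -/
open MeasureTheory

/-- Fourier transform with the normalization `f(x) = ∫ f̂(ξ) e^{ixξ} dξ`. -/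
noncomputable def ftransform (f : ℝ → ℂ) (ξ : ℝ) : ℂ :=
  (1 / (2 * Real.pi)) * ∫ x : ℝ, f x * Complex.exp (-Complex.I * ((x * ξ : ℝ) : ℂ))

/-- The fractional Schrödinger evolution with complex time `g(t) = t + i t^γ`,
applied to a function with Fourier transform `fhat`. -/
noncomputable def Pop (a γ : ℝ) (fhat : ℝ → ℂ) (t x : ℝ) : ℂ :=
  ∫ ξ : ℝ, fhat ξ *
    Complex.exp (Complex.I * ((t * |ξ| ^ a : ℝ) : ℂ) - ((t ^ γ * |ξ| ^ a : ℝ) : ℂ)) *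
    Complex.exp (Complex.I * ((x * ξ : ℝ) : ℂ))

/-- The maximal operator `P*_{a,γ} f(x) = sup_{0<t<1} |P^t_{a,γ} f(x)|`. -/
noncomputable def Pstar (a γ : ℝ) (fhat : ℝ → ℂ) (x : ℝ) : ℝ :=
  ⨆ t : Set.Ioo (0 : ℝ) 1, ‖Pop a γ fhat t x‖

/-- The σ-energy of a Borel measure μ on ℝ. -/
noncomputable def energy (σ : ℝ) (μ : Measure ℝ) : ENNReal :=
  ∫⁻ x : ℝ, ∫⁻ y : ℝ, (ENNReal.ofReal |x - y|) ^ (-σ) ∂μ ∂μ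




/-- First-derivative van der Corput test with decreasing amplitude. -/
lemma vdc_first {φ φ' φ'' g g' : ℝ → ℝ} {α β lam : ℝ} (hab : α ≤ β) (hl : 0 < lam)
    (h1 : ∀ x ∈ Set.Icc α β, HasDerivAt φ (φ' x) x)
    (h2 : ∀ x ∈ Set.Icc α β, HasDerivAt φ' (φ'' x) x)
    (h3 : ∀ x ∈ Set.Icc α β, HasDerivAt g (g' x) x)
    (hsign : (∀ x ∈ Set.Icc α β, 0 ≤ φ'' x) ∨ (∀ x ∈ Set.Icc α β, φ'' x ≤ 0))
    (hlam : ∀ x ∈ Set.Icc α β, lam ≤ |φ' x|)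
    (hg : ∀ x ∈ Set.Icc α β, 0 ≤ g x) (hg' : ∀ x ∈ Set.Icc α β, g' x ≤ 0) :
    ‖∫ x in α..β, Complex.exp (Complex.I * (φ x : ℂ)) * (g x : ℂ)‖ ≤ 5 * g α / lam := by
  -- sign
  obtain ⟨ε, hε, hεs⟩ : ∃ ε : ℝ, |ε| = 1 ∧ ∀ x ∈ Set.Icc α β, |φ'' x| = ε * φ'' x := by
    rcases hsign with h | h
    · exact ⟨1, by simp, fun x hx => by rw [abs_of_nonneg (h x hx), one_mul]⟩
    · exact ⟨-1, by simp, fun x hx => by rw [abs_of_nonpos (h x hx)]; ring⟩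
  have hne : ∀ x ∈ Set.Icc α β, φ' x ≠ 0 := fun x hx h => by
    have := hlam x hx; rw [h, abs_zero] at this; linarith
  have hgmono : ∀ x ∈ Set.Icc α β, g x ≤ g α := by
    intro x hx
    have : AntitoneOn g (Set.Icc α β) := by
      apply antitoneOn_of_hasDerivWithinAt_nonpos (f' := g') (convex_Icc α β)
      · exact fun y hy => (h3 y hy).continuousAt.continuousWithinAt
      · intro y hy
        exact (h3 y (interior_subset hy)).hasDerivWithinAt
      · intro y hy; exact hg' y (interior_subset hy)
    exact this (Set.left_mem_Icc.2 hab) hx hx.1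
  set u : ℝ → ℂ := fun x => Complex.exp (Complex.I * (φ x : ℂ)) * (g x : ℂ) with hu
  set v : ℝ → ℂ := fun x => Complex.exp (Complex.I * (φ x : ℂ)) *
    ((g x * (φ' x)⁻¹ : ℝ) : ℂ) * (-Complex.I) with hv
  set w : ℝ → ℝ := fun x => g' x * (φ' x)⁻¹ + g x * (-φ'' x / φ' x ^ 2) with hw
  have hvd : ∀ x ∈ Set.Icc α β, HasDerivAt v
      (u x + Complex.exp (Complex.I * (φ x : ℂ)) * (w x : ℂ) * (-Complex.I)) x := by
    intro x hx
    have e1 : HasDerivAt (fun x => Complex.exp (Complex.I * (φ x : ℂ)))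
        (Complex.exp (Complex.I * (φ x : ℂ)) * (Complex.I * (φ' x : ℂ))) x :=
      (((h1 x hx).ofReal_comp).const_mul Complex.I).cexp
    have e2 : HasDerivAt (fun x => ((g x * (φ' x)⁻¹ : ℝ) : ℂ)) ((w x : ℝ) : ℂ) x :=
      ((h3 x hx).mul ((h2 x hx).inv (hne x hx))).ofReal_comp
    have e3 := (e1.mul e2).mul_const (-Complex.I)
    refine e3.congr_deriv ?_
    have hc : (φ' x : ℂ) ≠ 0 := by exact_mod_cast hne x hx
    simp only [hu]
    push_cast
    field_simp
    ring_nf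
    simp [Complex.I_sq]
    try ring
  have hcont : ContinuousOn u (Set.Icc α β) := by
    intro x hx
    have c1 : ContinuousAt (fun x => (φ x : ℂ)) x :=
      (h1 x hx).ofReal_comp.continuousAt
    have c2 : ContinuousAt (fun x => (g x : ℂ)) x :=
      (h3 x hx).ofReal_comp.continuousAt
    have : ContinuousAt u x := by
      apply ContinuousAt.mul _ c2
      exact Complex.continuous_exp.continuousAt.comp (continuousAt_const.mul c1)
    exact this.continuousWithinAt
  -- the bound through the mean value inequality
  set G : ℝ → ℝ := fun x => -g x / lam + ε * g α * (-(φ' x)⁻¹) with hG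
  have hGd : ∀ x ∈ Set.Icc α β, HasDerivAt G (-g' x / lam + ε * g α * (-(-φ'' x / φ' x ^ 2))) x := by
    intro x hx
    exact ((h3 x hx).neg.div_const lam).add (((h2 x hx).inv (hne x hx)).neg.const_mul _)
  have hbound : ∀ x ∈ Set.Icc α β, ‖Complex.exp (Complex.I * (φ x : ℂ)) * (w x : ℂ) * (-Complex.I)‖
      ≤ -g' x / lam + ε * g α * (-(-φ'' x / φ' x ^ 2)) := by
    intro x hx
    rw [norm_mul, norm_mul, mul_comm Complex.I, Complex.norm_exp_ofReal_mul_I, norm_neg,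
      Complex.norm_I, one_mul, mul_one, Complex.norm_real, Real.norm_eq_abs]
    refine (abs_add_le _ _).trans ?_
    apply add_le_add
    · rw [abs_mul, abs_of_nonpos (hg' x hx), abs_inv, ← div_eq_mul_inv]
      have := hg' x hx
      have := hlam x hx
      gcongr
      linarith
    · rw [abs_mul, abs_div, abs_neg, hεs x hx, abs_of_nonneg (hg x hx), abs_of_nonneg (sq_nonneg (φ' x))]
      have h0 : 0 ≤ ε * φ'' x := by rw [← hεs x hx]; positivity
      have : ε * g α * (-(-φ'' x / φ' x ^ 2)) = g α * (ε * φ'' x / φ' x ^ 2) := by ring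
      rw [this]
      have := hgmono x hx
      gcongr
  set H : ℝ → ℂ := fun y => (v y - v α) - ∫ x in α..y, u x with hH
  have key : ‖H β‖ ≤ G β - G α := by
    have hHd : ∀ x ∈ Set.Ico α β, HasDerivWithinAt H
        (Complex.exp (Complex.I * (φ x : ℂ)) * (w x : ℂ) * (-Complex.I)) (Set.Ici x) x := by
      intro x hx
      have hxI : x ∈ Set.Icc α β := Set.Ico_subset_Icc_self hx
      have d1 := ((hvd x hxI).sub_const (v α)).hasDerivWithinAt (s := Set.Ici x)
      have hii : IntervalIntegrable u volume α x := by
        apply ContinuousOn.intervalIntegrable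
        rw [Set.uIcc_of_le hx.1]
        exact hcont.mono (Set.Icc_subset_Icc_right hx.2.le)
      have d2 : HasDerivWithinAt (fun y => ∫ t in α..y, u t) (u x) (Set.Ici x) x := by
        have hcx : ContinuousWithinAt u (Set.Ioi x) x := by
          refine (hcont x hxI).mono_of_mem_nhdsWithin ?_
          exact Filter.mem_of_superset (Ioo_mem_nhdsGT hx.2) 
            (fun y hy => ⟨hx.1.trans hy.1.le, hy.2.le⟩)
        apply intervalIntegral.integral_hasDerivWithinAt_right hii (t := Set.Ioi x) _ hcx
        refine ⟨Set.Ioo x β, Ioo_mem_nhdsGT hx.2, ?_⟩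
        exact (hcont.mono (fun y hy => ⟨hx.1.trans hy.1.le, hy.2.le⟩)).aestronglyMeasurable
          measurableSet_Ioo
      refine (d1.sub d2).congr_deriv ?_
      ring
    have hHc : ContinuousOn H (Set.Icc α β) := by
      apply ContinuousOn.sub
      · exact fun x hx => ((hvd x hx).sub_const (v α)).continuousAt.continuousWithinAt
      · have := intervalIntegral.continuousOn_primitive_interval (μ := volume) (f := u) (a := α) (b := β)
          (by rw [Set.uIcc_of_le hab]; exact hcont.integrableOn_Icc)
        rwa [Set.uIcc_of_le hab] at this
    have := image_norm_le_of_norm_deriv_right_le_deriv_boundary' (f := H) (a := α) (b := β)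
      (f' := fun x => Complex.exp (Complex.I * (φ x : ℂ)) * (w x : ℂ) * (-Complex.I))
      (B := fun x => G x - G α) (B' := fun x => -g' x / lam + ε * g α * (-(-φ'' x / φ' x ^ 2)))
      hHc hHd (by simp [hH]) 
      (fun x hx => ((hGd x hx).sub_const _).continuousAt.continuousWithinAt)
      (fun x hx => ((hGd x (Set.Ico_subset_Icc_self hx)).sub_const _).hasDerivWithinAt)
      (fun x hx => hbound x (Set.Ico_subset_Icc_self hx))
      (Set.right_mem_Icc.2 hab)
    exact this
  have ha : α ∈ Set.Icc α β := Set.left_mem_Icc.2 hab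
  have hb : β ∈ Set.Icc α β := Set.right_mem_Icc.2 hab
  have hinv : ∀ x ∈ Set.Icc α β, |(φ' x)⁻¹| ≤ 1 / lam := by
    intro x hx; rw [abs_inv, ← one_div]; exact one_div_le_one_div_of_le hl (hlam x hx)
  have hvn : ∀ x ∈ Set.Icc α β, ‖v x‖ ≤ g α / lam := by
    intro x hx
    simp only [hv]
    rw [norm_mul, norm_mul, mul_comm Complex.I, Complex.norm_exp_ofReal_mul_I, norm_neg,
      Complex.norm_I, one_mul, mul_one, Complex.norm_real, Real.norm_eq_abs, abs_mul,
      abs_of_nonneg (hg x hx)]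
    calc g x * |(φ' x)⁻¹| ≤ g α * (1 / lam) := by
          have := hgmono x hx; have := hinv x hx; have := hg α ha; gcongr
      _ = _ := by ring
  have hGb : G β - G α ≤ 3 * (g α / lam) := by
    have e : ∀ x ∈ Set.Icc α β, |ε * g α * (-(φ' x)⁻¹)| ≤ g α / lam := by
      intro x hx
      rw [abs_mul, abs_mul, hε, abs_neg, abs_of_nonneg (hg α ha), one_mul]
      calc g α * |(φ' x)⁻¹| ≤ g α * (1 / lam) := by
            have := hinv x hx; have := hg α ha; gcongr
        _ = _ := by ring
    have q1 := abs_le.1 (e β hb)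
    have q2 := abs_le.1 (e α ha)
    have q3 : 0 ≤ g β / lam := div_nonneg (hg β hb) hl.le
    simp only [hG]
    rw [neg_div, neg_div]
    linarith [q1.2, q2.1]
  have : (∫ x in α..β, u x) = (v β - v α) - H β := by simp [hH]
  rw [this]
  calc ‖v β - v α - H β‖ ≤ ‖v β‖ + ‖v α‖ + ‖H β‖ :=
        (norm_sub_le _ _).trans (by gcongr; exact norm_sub_le _ _)
    _ ≤ g α / lam + g α / lam + 3 * (g α / lam) := by
        have := hvn β hb; have := hvn α ha; linarith
    _ = _ := by ring

lemma one_sub_exp_lower (u : ℝ) : min |u| 1 / 2 ≤ |1 - Real.exp u| := by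
  have hpos : ∀ v : ℝ, 0 ≤ v → min v 1 / 2 ≤ 1 - Real.exp (-v) := by
    intro v hv
    have h1 : Real.exp (-v) ≤ 1 / (1 + v) := by
      rw [Real.exp_neg, ← one_div]
      exact one_div_le_one_div_of_le (by linarith) (by linarith [Real.add_one_le_exp v])
    have h2 : min v 1 / 2 ≤ 1 - 1 / (1 + v) := by
      have : 1 - 1 / (1 + v) = v / (1 + v) := by field_simp; ring
      rw [this, le_div_iff₀ (by linarith)]
      rcases le_total v 1 with h | h
      · rw [min_eq_left h]; nlinarith
      · rw [min_eq_right h]; nlinarith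
    linarith
  rcases le_total 0 u with h | h
  · have h1 := hpos u h
    rw [abs_of_nonneg h, abs_of_nonpos (by linarith [Real.add_one_le_exp u])]
    have : 2 ≤ Real.exp u + Real.exp (-u) := by
      have := Real.one_le_cosh u
      rw [Real.cosh_eq] at this; linarith
    linarith
  · have h1 := hpos (-u) (by linarith)
    rw [neg_neg] at h1
    rw [abs_of_nonpos h]
    exact h1.trans (le_abs_self _)

lemma log_lower (r : ℝ) (hr : 0 < r) : min |r - 1| 1 / 2 ≤ |Real.log r| := by
  rcases le_total r 1 with h | h
  · have h1 := Real.log_le_sub_one_of_pos hr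
    rw [abs_of_nonpos (by linarith : r - 1 ≤ 0), abs_of_nonpos (by linarith : Real.log r ≤ 0)]
    have := min_le_left (-(r-1)) 1
    linarith
  · have h1 := Real.one_sub_inv_le_log_of_pos hr
    rw [abs_of_nonneg (by linarith : 0 ≤ r - 1)]
    refine le_trans ?_ (h1.trans (le_abs_self _))
    have : 1 - r⁻¹ = (r - 1) / r := by field_simp
    rw [this, le_div_iff₀ hr]
    rcases le_total (r-1) 1 with h | h
    · rw [min_eq_left h]; nlinarith
    · rw [min_eq_right h]; nlinarith

lemma rpow_lower (b : ℝ) (hb : b ≠ 0) :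
    ∃ c : ℝ, 0 < c ∧ c ≤ 1 ∧ ∀ r : ℝ, 0 < r → c * min |r - 1| 1 ≤ |1 - r ^ b| := by
  have hb' : 0 < |b| := abs_pos.2 hb
  refine ⟨min (|b| / 2) 1 / 2, by positivity, ?_, ?_⟩
  · have := min_le_right (|b| / 2) 1
    linarith
  intro r hr
  rw [Real.rpow_def_of_pos hr]
  refine le_trans ?_ (one_sub_exp_lower _)
  rw [abs_mul]
  have h1 := log_lower r hr
  set m := min |r - 1| 1 with hm
  have hm0 : 0 ≤ m := by positivity
  have hm1 : m ≤ 1 := min_le_right _ _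
  have : min (|b| / 2) 1 * m ≤ min (|Real.log r| * |b|) 1 := by
    apply le_min
    · calc min (|b| / 2) 1 * m ≤ (|b| / 2) * m := by gcongr; exact min_le_left _ _
        _ = (m / 2) * |b| := by ring
        _ ≤ _ := by gcongr
    · calc min (|b| / 2) 1 * m ≤ 1 * 1 := by gcongr; exact min_le_right _ _
        _ = 1 := by ring
  linarith


/-- amplitude -/
noncomputable def amp (a s B x η : ℝ) : ℝ := Real.exp (-(B * η ^ a)) * (x ^ 2 + η ^ 2) ^ (-s)

/-- oscillating integrand -/
noncomputable def oscI (a s A B x η : ℝ) : ℂ :=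
  Complex.exp (Complex.I * ((A * η ^ a + η : ℝ) : ℂ)) * ((amp a s B x η : ℝ) : ℂ)

lemma amp_nonneg (a s B x η : ℝ) : 0 ≤ amp a s B x η := by
  unfold amp; positivity

lemma norm_oscI (a s A B x η : ℝ) : ‖oscI a s A B x η‖ = amp a s B x η := by
  unfold oscI
  rw [norm_mul, mul_comm Complex.I, Complex.norm_exp_ofReal_mul_I, one_mul, Complex.norm_real,
    Real.norm_eq_abs, abs_of_nonneg (amp_nonneg _ _ _ _ _)]

lemma amp_le_exp {a s B x η : ℝ} (hs : 0 < s) (hη : 1 ≤ η) :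
    amp a s B x η ≤ Real.exp (-(B * η ^ a)) := by
  unfold amp
  have : (x ^ 2 + η ^ 2) ^ (-s) ≤ 1 :=
    Real.rpow_le_one_of_one_le_of_nonpos (by nlinarith) (by linarith)
  exact mul_le_of_le_one_right (Real.exp_pos _).le this

lemma amp_le_rpow {a s B x η : ℝ} (hB : 0 ≤ B) (hs : 0 < s) (hη : 0 < η) :
    amp a s B x η ≤ η ^ (-(2 * s)) := by
  unfold amp
  have h1 : Real.exp (-(B * η ^ a)) ≤ 1 := by
    rw [Real.exp_le_one_iff]; have : 0 ≤ B * η ^ a := by positivity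
    linarith
  have h2 : (x ^ 2 + η ^ 2) ^ (-s) ≤ (η ^ 2) ^ (-s) :=
    Real.rpow_le_rpow_of_nonpos (by positivity) (by nlinarith) (by linarith)
  have h3 : (η ^ 2) ^ (-s) = η ^ (-(2 * s)) := by
    rw [← Real.rpow_natCast, ← Real.rpow_mul hη.le]; congr 1; push_cast; ring
  rw [← h3]
  calc _ ≤ 1 * (x ^ 2 + η ^ 2) ^ (-s) := by gcongr
    _ ≤ _ := by rw [one_mul]; exact h2

lemma amp_le_one {a s B x η : ℝ} (hB : 0 ≤ B) (hs : 0 < s) (hη : 1 ≤ η) :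
    amp a s B x η ≤ 1 :=
  (amp_le_rpow hB hs (by linarith)).trans
    (Real.rpow_le_one_of_one_le_of_nonpos hη (by linarith))

lemma oscI_continuousOn (a s A B x : ℝ) : ContinuousOn (oscI a s A B x) (Set.Ioi 0) := by
  unfold oscI amp
  intro η hη
  have hη : 0 < η := hη
  apply ContinuousAt.continuousWithinAt
  have h1 : ContinuousAt (fun y : ℝ => y ^ a) η := Real.continuousAt_rpow_const _ _ (Or.inl hη.ne')
  have h2 : ContinuousAt (fun y : ℝ => (x ^ 2 + y ^ 2) ^ (-s)) η := by
    apply ContinuousAt.rpow_const (by fun_prop)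
    left; positivity
  have h3 : ContinuousAt (fun y : ℝ => A * y ^ a + y) η := (h1.const_mul A).add continuousAt_id
  have h4 : ContinuousAt (fun y : ℝ => Real.exp (-(B * y ^ a)) * (x ^ 2 + y ^ 2) ^ (-s)) η :=
    (Real.continuous_exp.continuousAt.comp (h1.const_mul B).neg).mul h2
  exact (Complex.continuous_exp.continuousAt.comp
    (continuousAt_const.mul (Complex.continuous_ofReal.continuousAt.comp h3))).mul
    (Complex.continuous_ofReal.continuousAt.comp h4)

lemma oscI_intervalIntegrable (a s A B x : ℝ) {α β : ℝ} (hα : 0 < α) (hab : α ≤ β) :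
    IntervalIntegrable (oscI a s A B x) volume α β := by
  apply ContinuousOn.intervalIntegrable
  rw [Set.uIcc_of_le hab]
  exact (oscI_continuousOn a s A B x).mono (fun y hy => lt_of_lt_of_le hα hy.1)

lemma core_vdc {a s A B x α β lam : ℝ} (ha : 0 < a) (hs : 0 < s) (hB : 0 ≤ B)
    (hα : 0 < α) (hab : α ≤ β) (hl : 0 < lam)
    (h : ∀ η ∈ Set.Icc α β, lam ≤ |1 + A * a * η ^ (a - 1)|) :
    ‖∫ η in α..β, oscI a s A B x η‖ ≤ 5 * amp a s B x α / lam := by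
  have hp : ∀ η ∈ Set.Icc α β, 0 < η := fun η hη => lt_of_lt_of_le hα hη.1
  refine vdc_first (φ := fun η => A * η ^ a + η) (φ' := fun η => 1 + A * a * η ^ (a - 1))
    (φ'' := fun η => A * a * ((a - 1) * η ^ (a - 1 - 1))) (g := amp a s B x)
    (g' := fun η => (Real.exp (-(B * η ^ a)) * (-(B * (a * η ^ (a - 1))))) * (x ^ 2 + η ^ 2) ^ (-s)
      + Real.exp (-(B * η ^ a)) * ((2 * η) * (-s) * (x ^ 2 + η ^ 2) ^ (-s - 1)))
    hab hl ?_ ?_ ?_ ?_ h (fun η _ => amp_nonneg _ _ _ _ _) ?_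
  · intro η hη
    have := ((Real.hasDerivAt_rpow_const (x := η) (p := a) (Or.inl (hp η hη).ne')).const_mul A).add
      (hasDerivAt_id η)
    refine this.congr_deriv ?_
    ring
  · intro η hη
    exact ((Real.hasDerivAt_rpow_const (x := η) (p := a - 1) (Or.inl (hp η hη).ne')).const_mul
      (A * a)).const_add 1
  · intro η hη
    have e1 := (((Real.hasDerivAt_rpow_const (x := η) (p := a)
      (Or.inl (hp η hη).ne')).const_mul B).neg).exp
    have e0 : HasDerivAt (fun y : ℝ => x ^ 2 + y ^ 2) (2 * η) η := by
      simpa using (hasDerivAt_pow 2 η).const_add (x ^ 2)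
    have e2 := e0.rpow_const (p := -s) (Or.inl (by have := hp η hη; positivity))
    exact e1.mul e2
  · have key : ∀ η ∈ Set.Icc α β, 0 ≤ η ^ (a - 1 - 1) := fun η hη =>
      Real.rpow_nonneg (hp η hη).le _
    rcases le_total 0 (A * a * (a - 1)) with h0 | h0
    · left; intro η hη
      have := mul_nonneg h0 (key η hη)
      linarith
    · right; intro η hη
      have := mul_nonneg_of_nonpos_of_nonpos h0 (neg_nonpos.2 (key η hη))
      linarith
  · intro η hη
    have := hp η hη
    have q1 : 0 ≤ Real.exp (-(B * η ^ a)) * ((B * (a * η ^ (a - 1)))) * (x ^ 2 + η ^ 2) ^ (-s) := by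
      positivity
    have q2 : 0 ≤ Real.exp (-(B * η ^ a)) * ((2 * η) * s * (x ^ 2 + η ^ 2) ^ (-s - 1)) := by
      positivity
    linarith

lemma core_trivial {a s A B x α β M : ℝ} (hab : α ≤ β)
    (h : ∀ η ∈ Set.Icc α β, amp a s B x η ≤ M) :
    ‖∫ η in α..β, oscI a s A B x η‖ ≤ M * (β - α) := by
  have := intervalIntegral.norm_integral_le_of_norm_le_const (a := α) (b := β)
    (f := oscI a s A B x) (C := M) (fun η hη => by
      rw [Set.uIoc_of_le hab] at hη
      rw [norm_oscI]; exact h η ⟨hη.1.le, hη.2⟩)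
  rwa [abs_of_nonneg (by linarith)] at this

/-- the tail bound -/
lemma core_tail (a s : ℝ) (ha : 0 < a) (hane : a ≠ 1) (hs : 0 < s) :
    ∃ C : ℝ, 0 < C ∧ ∀ A B x : ℝ, 0 ≤ B → (1 / 4 ≤ s ∨ |A| ≤ B) →
      ∃ R0 : ℝ, ∀ R ≥ R0, ‖∫ η in (1:ℝ)..R, oscI a s A B x η‖ ≤ C := by
  obtain ⟨c, hc, hc1, hcr⟩ := rpow_lower (a - 1) (sub_ne_zero.2 hane)
  set c2 : ℝ := 2 ^ (-|a - 1|) / (2 * a) with hc2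
  have hc2p : 0 < c2 := by positivity
  refine ⟨30 / c + 7 + 2 / c2, by positivity, ?_⟩
  intro A B x hB hcond
  have hq1 : 0 < 1 / c := by positivity
  have hq1' : 1 ≤ 1 / c := by rw [le_div_iff₀ hc]; linarith
  have hq2 : 0 < 1 / c2 := by positivity
  have e30 : 30 / c = 30 * (1 / c) := by ring
  have e2 : 2 / c2 = 2 * (1 / c2) := by ring
  rw [e30, e2]
  rcases le_or_gt 0 A with hA | hA
  · refine ⟨1, fun R hR => ?_⟩
    have := core_vdc (a := a) (s := s) (A := A) (B := B) (x := x) (lam := 1) ha hs hB one_pos hR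
      one_pos (fun η hη => by
        have : 0 < η := by linarith [hη.1]
        have : 0 ≤ A * a * η ^ (a - 1) := by positivity
        exact le_trans (by linarith) (le_abs_self _))
    have h1 := amp_le_one (a := a) (x := x) hB hs le_rfl
    rw [div_one] at this
    linarith
  -- A < 0
  obtain ⟨e0, he0, hD⟩ : ∃ e0 : ℝ, 0 < e0 ∧ ∀ η : ℝ, 0 < η →
      A * a * η ^ (a - 1) = - (η / e0) ^ (a - 1) := by
    have hD : 0 < -(A * a) := by nlinarith
    refine ⟨(-(A * a)) ^ (-(a - 1)⁻¹), by positivity, fun η hη => ?_⟩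
    rw [Real.div_rpow hη.le (by positivity), ← Real.rpow_mul hD.le]
    have : -(a - 1)⁻¹ * (a - 1) = -1 := by
      have := sub_ne_zero.2 hane
      field_simp
    rw [this, Real.rpow_neg_one]
    field_simp
  have hlow : ∀ η : ℝ, 0 < η → c * min |η / e0 - 1| 1 ≤ |1 + A * a * η ^ (a - 1)| := by
    intro η hη
    rw [hD η hη, ← sub_eq_add_neg]
    exact hcr _ (by positivity)
  have hint : ∀ p q : ℝ, 1 ≤ p → p ≤ q → IntervalIntegrable (oscI a s A B x) volume p q :=
    fun p q hp hpq => oscI_intervalIntegrable a s A B x (by linarith) hpq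
  rcases le_or_gt e0 4 with he4 | he4
  · refine ⟨8, fun R hR => ?_⟩
    rw [← intervalIntegral.integral_add_adjacent_intervals (hint 1 8 le_rfl (by norm_num))
      (hint 8 R (by norm_num) hR)]
    refine (norm_add_le _ _).trans ?_
    have t1 := core_trivial (a := a) (s := s) (A := A) (B := B) (x := x) (α := 1) (β := 8) (M := 1)
      (by norm_num) (fun η hη => amp_le_one hB hs hη.1)
    have t2 := core_vdc (a := a) (s := s) (A := A) (B := B) (x := x) (α := 8) (lam := c) ha hs hB
      (by norm_num) hR hc (fun η hη => by
        have hη8 := hη.1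
        refine le_trans ?_ (hlow η (by linarith))
        have : 2 ≤ η / e0 := by rw [le_div_iff₀ he0]; linarith
        rw [min_eq_right (by rw [abs_of_nonneg] <;> linarith), mul_one])
    have h1 := amp_le_one (a := a) (x := x) (η := 8) hB hs (by norm_num)
    have t3 : 5 * amp a s B x 8 / c ≤ 5 * (1 / c) := by
      rw [mul_div_assoc]; gcongr
    linarith
  -- e0 > 4
  have s1 : ‖∫ η in (1:ℝ)..(e0 / 2), oscI a s A B x η‖ ≤ 10 * (1 / c) := by
    have t := core_vdc (a := a) (s := s) (A := A) (B := B) (x := x) (α := 1) (β := e0 / 2)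
      (lam := c / 2) ha hs hB (by norm_num) (by linarith) (by positivity) (fun η hη => by
        have hη1 := hη.1
        have hη2 := hη.2
        refine le_trans ?_ (hlow η (by linarith))
        have : η / e0 ≤ 1 / 2 := by rw [div_le_iff₀ he0]; linarith
        have : 0 < η / e0 := by positivity
        rw [div_eq_mul_inv]
        apply mul_le_mul_of_nonneg_left _ hc.le
        apply le_min
        · rw [abs_of_nonpos] <;> norm_num <;> linarith
        · norm_num)
    have h1 := amp_le_one (a := a) (x := x) (η := 1) hB hs (by norm_num)
    refine t.trans ?_
    calc 5 * amp a s B x 1 / (c / 2) ≤ 5 * 1 / (c / 2) := by gcongr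
      _ = _ := by field_simp; norm_num
  rcases hcond with hs4 | hAB
  · -- second derivative regime
    set r := Real.sqrt e0 with hr
    have hr2 : r * r = e0 := Real.mul_self_sqrt he0.le
    have hrpos : 0 < r := Real.sqrt_pos.2 he0
    have hr2' : 2 < r := by nlinarith
    -- delta = 1 / r, delta * e0 = r
    have hamp : ∀ η : ℝ, e0 / 2 ≤ η → amp a s B x η ≤ 2 / r := by
      intro η hη
      have hη1 : 1 ≤ η := by linarith
      refine (amp_le_rpow hB hs (by linarith)).trans ?_
      calc η ^ (-(2 * s)) ≤ η ^ (-(1 / 2 : ℝ)) :=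
            Real.rpow_le_rpow_of_exponent_le hη1 (by linarith)
        _ ≤ (r / 2 * (r / 2)) ^ (-(1 / 2 : ℝ)) :=
            Real.rpow_le_rpow_of_nonpos (by positivity) (by nlinarith) (by norm_num)
        _ = 2 / r := by
            rw [Real.rpow_neg (by positivity), ← Real.sqrt_eq_rpow,
              Real.sqrt_mul_self (by positivity)]
            field_simp
    have bnd : ∀ η : ℝ, e0 / 2 ≤ η → 5 * amp a s B x η / (c * (1 / r)) ≤ 10 * (1 / c) := by
      intro η hη
      calc 5 * amp a s B x η / (c * (1 / r)) ≤ 5 * (2 / r) / (c * (1 / r)) := by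
            gcongr; exact hamp η hη
        _ = _ := by field_simp; norm_num
    have o1 : e0 / 2 ≤ e0 - r := by nlinarith
    refine ⟨e0 + r, fun R hR => ?_⟩
    have s2 : ‖∫ η in (e0 / 2)..(e0 - r), oscI a s A B x η‖ ≤ 10 * (1 / c) := by
      refine (core_vdc (a := a) (s := s) (A := A) (B := B) (x := x)
        (lam := c * (1 / r)) ha hs hB (by linarith) o1 (by positivity) (fun η hη => ?_)).trans
        (bnd _ le_rfl)
      have hη1 := hη.1
      have hη2 := hη.2
      refine le_trans ?_ (hlow η (by linarith))
      apply mul_le_mul_of_nonneg_left _ hc.le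
      have : η / e0 - 1 ≤ -(1 / r) := by
        have : η / e0 - 1 = (η - e0) / e0 := by field_simp
        rw [this, div_le_iff₀ he0, ← hr2]
        have : -(1 / r) * (r * r) = -r := by field_simp
        rw [this]; linarith
      apply le_min
      · exact le_abs.2 (Or.inr (by linarith))
      · rw [div_le_one hrpos]; linarith
    have s3 : ‖∫ η in (e0 - r)..(e0 + r), oscI a s A B x η‖ ≤ 4 := by
      refine (core_trivial (a := a) (s := s) (A := A) (B := B) (x := x) (M := 2 / r)
        (by linarith) (fun η hη => hamp η (by linarith [hη.1]))).trans ?_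
      have : 2 / r * (e0 + r - (e0 - r)) = 4 := by field_simp; ring
      rw [this]
    have s4 : ‖∫ η in (e0 + r)..R, oscI a s A B x η‖ ≤ 10 * (1 / c) := by
      refine (core_vdc (a := a) (s := s) (A := A) (B := B) (x := x)
        (lam := c * (1 / r)) ha hs hB (by linarith) hR (by positivity) (fun η hη => ?_)).trans
        (bnd _ (by linarith))
      have hη1 := hη.1
      refine le_trans ?_ (hlow η (by linarith))
      apply mul_le_mul_of_nonneg_left _ hc.le
      have : 1 / r ≤ η / e0 - 1 := by
        have : η / e0 - 1 = (η - e0) / e0 := by field_simp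
        rw [this, le_div_iff₀ he0, ← hr2]
        have : (1 / r) * (r * r) = r := by field_simp
        rw [this]; linarith
      apply le_min
      · exact le_abs.2 (Or.inl (by linarith))
      · rw [div_le_one hrpos]; linarith
    rw [← intervalIntegral.integral_add_adjacent_intervals
        (hint 1 (e0 / 2) le_rfl (by linarith)) (hint (e0 / 2) R (by linarith) (by linarith)),
      ← intervalIntegral.integral_add_adjacent_intervals
        (hint (e0 / 2) (e0 - r) (by linarith) (by linarith))
        (hint (e0 - r) R (by linarith) (by linarith)),
      ← intervalIntegral.integral_add_adjacent_intervals
        (hint (e0 - r) (e0 + r) (by linarith) (by linarith))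
        (hint (e0 + r) R (by linarith) (by linarith))]
    refine (norm_add_le _ _).trans ?_
    have n1 := norm_add_le (∫ η in (e0 / 2)..(e0 - r), oscI a s A B x η)
      ((∫ η in (e0 - r)..(e0 + r), oscI a s A B x η) + ∫ η in (e0 + r)..R, oscI a s A B x η)
    have n2 := norm_add_le (∫ η in (e0 - r)..(e0 + r), oscI a s A B x η)
      (∫ η in (e0 + r)..R, oscI a s A B x η)
    linarith
  · -- damping regime
    refine ⟨2 * e0, fun R hR => ?_⟩
    have s2 : ‖∫ η in (e0 / 2)..(2 * e0), oscI a s A B x η‖ ≤ 2 * (1 / c2) := by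
      have hM : ∀ η ∈ Set.Icc (e0 / 2) (2 * e0), amp a s B x η ≤ 1 / (c2 * e0) := by
        intro η hη
        have hη1 := hη.1
        have hη2 := hη.2
        have hηp : 0 < η := by linarith
        refine (amp_le_exp hs (by linarith)).trans ?_
        have hkey : c2 * e0 ≤ B * η ^ a := by
          have h1 : |A| * η ^ a ≤ B * η ^ a := by gcongr
          have h2 : |A| * η ^ a = (1 / a) * (η / e0) ^ (a - 1) * η := by
            have := hD η hηp
            have hηa : η ^ a = η ^ (a - 1) * η := by
              rw [Real.rpow_sub_one hηp.ne']; field_simp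
            rw [abs_of_neg hA, hηa]
            have h3 : (η / e0) ^ (a - 1) = -(A * a * η ^ (a - 1)) := by rw [this]; ring
            rw [h3]; field_simp
          have h3 : (2:ℝ) ^ (-|a - 1|) ≤ (η / e0) ^ (a - 1) := by
            have w1 : 1 / 2 ≤ η / e0 := by rw [le_div_iff₀ he0]; linarith
            have w2 : η / e0 ≤ 2 := by rw [div_le_iff₀ he0]; linarith
            rcases le_total 0 (a - 1) with h | h
            · rw [abs_of_nonneg h, Real.rpow_neg (by norm_num), ← Real.inv_rpow (by norm_num)]
              apply Real.rpow_le_rpow (by norm_num) _ h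
              linarith
            · rw [abs_of_nonpos h, neg_neg]
              exact Real.rpow_le_rpow_of_nonpos (by positivity) w2 h
          calc c2 * e0 = (1 / a) * (2:ℝ) ^ (-|a - 1|) * (e0 / 2) := by rw [hc2]; field_simp
            _ ≤ (1 / a) * (η / e0) ^ (a - 1) * η := by gcongr
            _ = |A| * η ^ a := h2.symm
            _ ≤ _ := h1
        have hp : 0 < c2 * e0 := by positivity
        rw [Real.exp_neg, ← one_div]
        apply one_div_le_one_div_of_le hp
        linarith [Real.add_one_le_exp (B * η ^ a)]
      refine (core_trivial (by linarith) hM).trans ?_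
      have : 1 / (c2 * e0) * (2 * e0 - e0 / 2) = 3 / 2 * (1 / c2) := by field_simp; ring
      rw [this]; linarith
    have s3 : ‖∫ η in (2 * e0)..R, oscI a s A B x η‖ ≤ 5 * (1 / c) := by
      have t2 := core_vdc (a := a) (s := s) (A := A) (B := B) (x := x) (α := 2 * e0) (lam := c)
        ha hs hB (by linarith) hR hc (fun η hη => by
          have hη8 := hη.1
          refine le_trans ?_ (hlow η (by linarith))
          have : 2 ≤ η / e0 := by rw [le_div_iff₀ he0]; linarith
          rw [min_eq_right (by rw [abs_of_nonneg] <;> linarith), mul_one])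
      have h1 := amp_le_one (a := a) (x := x) (η := 2 * e0) hB hs (by linarith)
      refine t2.trans ?_
      rw [mul_div_assoc]; gcongr
    rw [← intervalIntegral.integral_add_adjacent_intervals
        (hint 1 (e0 / 2) le_rfl (by linarith)) (hint (e0 / 2) R (by linarith) (by linarith)),
      ← intervalIntegral.integral_add_adjacent_intervals
        (hint (e0 / 2) (2 * e0) (by linarith) (by linarith))
        (hint (2 * e0) R (by linarith) (by linarith))]
    refine (norm_add_le _ _).trans ?_
    have n1 := norm_add_le (∫ η in (e0 / 2)..(2 * e0), oscI a s A B x η)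
      (∫ η in (2 * e0)..R, oscI a s A B x η)
    linarith


lemma integrable_exp_abs {a B : ℝ} (ha : 0 < a) (hB : 0 < B) :
    Integrable (fun ξ : ℝ => Real.exp (-(B * |ξ| ^ a))) volume := by
  have h0 : IntegrableOn (fun ξ : ℝ => Real.exp (-(B * |ξ| ^ a))) (Set.Ioi 0) := by
    refine (integrableOn_rpow_mul_exp_neg_mul_rpow (s := 0) (p := a) (b := B) (by norm_num) ha
      hB).congr_fun (fun ξ hξ => ?_) measurableSet_Ioi
    have : 0 < ξ := hξ
    simp [abs_of_pos this]
  have h1 : IntegrableOn (fun ξ : ℝ => Real.exp (-(B * |ξ| ^ a))) (Set.Iic 0) := by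
    rw [integrableOn_Iic_iff_integrableOn_Iio]
    have := h0.comp_neg
    simpa using this
  rw [← integrableOn_univ, ← Set.Iic_union_Ioi (a := (0:ℝ))]
  exact h1.union h0

lemma oscI_integrableOn {a s A B x : ℝ} (ha : 0 < a) (hs : 0 < s) (hB : 0 < B) (hx : 0 < x) :
    IntegrableOn (oscI a s A B x) (Set.Ioi 0) := by
  have h := ((integrable_exp_abs ha hB).const_mul ((x ^ 2) ^ (-s))).integrableOn (s := Set.Ioi 0)
  refine Integrable.mono' h ((oscI_continuousOn a s A B x).aestronglyMeasurable measurableSet_Ioi) ?_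
  filter_upwards [ae_restrict_mem measurableSet_Ioi] with η hη
  have hη : 0 < η := hη
  rw [norm_oscI, amp, abs_of_pos hη, mul_comm]
  have : (x ^ 2 + η ^ 2) ^ (-s) ≤ (x ^ 2) ^ (-s) :=
    Real.rpow_le_rpow_of_nonpos (by positivity) (by nlinarith) (by linarith)
  gcongr

lemma scaled_bound (a s : ℝ) (ha : 0 < a) (hane : a ≠ 1) (hs : 0 < s) (hs2 : s < 1 / 2) :
    ∃ C : ℝ, 0 < C ∧ ∀ A B x : ℝ, 0 < B → 0 < x → (1 / 4 ≤ s ∨ |A| ≤ B) →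
      ‖∫ η in Set.Ioi (0:ℝ), oscI a s A B x η‖ ≤ C := by
  obtain ⟨C, hC, h⟩ := core_tail a s ha hane hs
  have h12 : 0 < 1 - 2 * s := by linarith
  refine ⟨C + 1 / (1 - 2 * s), by positivity, fun A B x hB hx hcond => ?_⟩
  obtain ⟨R0, hR0⟩ := h A B x hB.le hcond
  have hI := oscI_integrableOn (A := A) ha hs hB hx
  have hI1 : IntegrableOn (oscI a s A B x) (Set.Ioi 1) := hI.mono_set (Set.Ioi_subset_Ioi zero_le_one)
  have hI0 : IntegrableOn (oscI a s A B x) (Set.Ioc 0 1) := hI.mono_set Set.Ioc_subset_Ioi_self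
  have t1 : ‖∫ η in Set.Ioi (1:ℝ), oscI a s A B x η‖ ≤ C := by
    have ht := (intervalIntegral_tendsto_integral_Ioi 1 hI1 Filter.tendsto_id).norm
    refine le_of_tendsto ht ?_
    filter_upwards [Filter.eventually_ge_atTop R0] with R hR
    exact hR0 R hR
  have t0 : ‖∫ η in Set.Ioc (0:ℝ) 1, oscI a s A B x η‖ ≤ 1 / (1 - 2 * s) := by
    rw [← intervalIntegral.integral_of_le zero_le_one]
    have hr : IntervalIntegrable (fun η : ℝ => η ^ (-(2 * s))) volume 0 1 :=
      intervalIntegral.intervalIntegrable_rpow' (by linarith)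
    have := intervalIntegral.norm_integral_le_of_norm_le (μ := volume) zero_le_one
      (f := oscI a s A B x) (g := fun η : ℝ => η ^ (-(2 * s)))
      (Filter.Eventually.of_forall (fun η hη => by
        rw [norm_oscI]; exact amp_le_rpow hB.le hs hη.1)) hr
    refine this.trans ?_
    rw [integral_rpow (Or.inl (by linarith))]
    rw [Real.one_rpow, Real.zero_rpow (by linarith)]
    rw [show -(2 * s) + 1 = 1 - 2 * s by ring, sub_zero]
  have hsplit : ∫ η in Set.Ioi (0:ℝ), oscI a s A B x η =
      (∫ η in Set.Ioc (0:ℝ) 1, oscI a s A B x η) + ∫ η in Set.Ioi (1:ℝ), oscI a s A B x η := by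
    rw [← setIntegral_union Set.Ioc_disjoint_Ioi_same measurableSet_Ioi hI0 hI1,
      Set.Ioc_union_Ioi_eq_Ioi zero_le_one]
  rw [hsplit]
  refine (norm_add_le _ _).trans (by linarith)

/-- kernel integrand -/
noncomputable def kerI (a s A B x ξ : ℝ) : ℂ :=
  Complex.exp (Complex.I * ((A * |ξ| ^ a + x * ξ : ℝ) : ℂ)) *
    ((Real.exp (-(B * |ξ| ^ a)) * (1 + ξ ^ 2) ^ (-s) : ℝ) : ℂ)

lemma kerI_continuous {a s A B x : ℝ} (ha : 0 < a) : Continuous (kerI a s A B x) := by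
  unfold kerI
  have h1 : Continuous (fun y : ℝ => |y| ^ a) :=
    continuous_abs.rpow_const (fun _ => Or.inr ha.le)
  have h2 : Continuous (fun y : ℝ => (1 + y ^ 2) ^ (-s)) :=
    Continuous.rpow_const (by fun_prop) (fun y => Or.inl (by positivity))
  fun_prop

lemma norm_kerI (a s A B x ξ : ℝ) :
    ‖kerI a s A B x ξ‖ = Real.exp (-(B * |ξ| ^ a)) * (1 + ξ ^ 2) ^ (-s) := by
  unfold kerI
  rw [norm_mul, mul_comm Complex.I, Complex.norm_exp_ofReal_mul_I, one_mul, Complex.norm_real,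
    Real.norm_eq_abs, abs_of_nonneg (by positivity)]

lemma kerI_integrable {a s A B x : ℝ} (ha : 0 < a) (hs : 0 < s) (hB : 0 < B) :
    Integrable (kerI a s A B x) volume := by
  refine (integrable_exp_abs ha hB).mono' (kerI_continuous ha).aestronglyMeasurable ?_
  refine Filter.Eventually.of_forall (fun ξ => ?_)
  rw [norm_kerI]
  apply mul_le_of_le_one_right (Real.exp_pos _).le
  exact Real.rpow_le_one_of_one_le_of_nonpos (by nlinarith) (by linarith)

lemma half_bound (a s : ℝ) (ha : 0 < a) (hane : a ≠ 1) (hs : 0 < s) (hs2 : s < 1 / 2) :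
    ∃ C : ℝ, 0 < C ∧ ∀ A B x : ℝ, 0 < B → 0 < x → (1 / 4 ≤ s ∨ |A| ≤ B) →
      ‖∫ ξ in Set.Ioi (0:ℝ), kerI a s A B x ξ‖ ≤ C * x ^ (-(1 - 2 * s)) := by
  obtain ⟨C, hC, h⟩ := scaled_bound a s ha hane hs hs2
  refine ⟨C, hC, fun A B x hB hx hcond => ?_⟩
  have hxa : 0 < x ^ (-a) := by positivity
  have key : ∀ ξ ∈ Set.Ioi (0:ℝ), kerI a s A B x ξ =
      (x ^ (2 * s) : ℝ) * oscI a s (A * x ^ (-a)) (B * x ^ (-a)) x (x * ξ) := by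
    intro ξ hξ
    have hξ : 0 < ξ := hξ
    unfold kerI oscI amp
    have e1 : x ^ (-a) * (x * ξ) ^ a = ξ ^ a := by
      rw [Real.mul_rpow hx.le hξ.le, ← mul_assoc, ← Real.rpow_add hx]; simp
    have e2 : (x ^ 2 + (x * ξ) ^ 2) ^ (-s) = x ^ (-(2 * s)) * (1 + ξ ^ 2) ^ (-s) := by
      rw [show x ^ 2 + (x * ξ) ^ 2 = x ^ 2 * (1 + ξ ^ 2) by ring,
        Real.mul_rpow (by positivity) (by positivity), ← Real.rpow_natCast, ← Real.rpow_mul hx.le]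
      congr 2; push_cast; ring
    have e3 : x ^ (2 * s) * x ^ (-(2 * s)) = 1 := by
      rw [← Real.rpow_add hx]; simp
    rw [mul_assoc A, mul_assoc B, e1, e2, abs_of_pos hξ]
    have e3' : ((x ^ (2 * s) : ℝ) : ℂ) * ((x ^ (-(2 * s)) : ℝ) : ℂ) = 1 := by
      rw [← Complex.ofReal_mul, e3, Complex.ofReal_one]
    push_cast at e3' ⊢
    linear_combination (-(Complex.exp (Complex.I * (A * ((ξ ^ a : ℝ) : ℂ) + x * ξ)) *
      (Complex.exp (-(B * ((ξ ^ a : ℝ) : ℂ))) * (((1 + ξ ^ 2) ^ (-s) : ℝ) : ℂ)))) * e3'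
  rw [setIntegral_congr_fun measurableSet_Ioi key, integral_const_mul,
    integral_comp_mul_left_Ioi (fun η => oscI a s (A * x ^ (-a)) (B * x ^ (-a)) x η) 0 hx, mul_zero]
  have hb := h (A * x ^ (-a)) (B * x ^ (-a)) x (by positivity) hx
    (hcond.imp id (fun h => by rw [abs_mul, abs_of_pos hxa]; gcongr))
  rw [norm_mul, norm_smul, Complex.norm_real, Real.norm_eq_abs, Real.norm_eq_abs,
    abs_of_pos (by positivity), abs_of_pos (by positivity)]
  calc x ^ (2 * s) * (x⁻¹ * _) ≤ x ^ (2 * s) * (x⁻¹ * C) := by gcongr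
    _ = C * (x ^ (2 * s) * x ^ (-1 : ℝ)) := by rw [Real.rpow_neg_one]; ring
    _ = _ := by rw [← Real.rpow_add hx]; congr 2; ring

lemma kerI_conj (a s A B x ξ : ℝ) :
    (starRingEnd ℂ) (kerI a s A B x ξ) = kerI a s (-A) B (-x) ξ := by
  unfold kerI
  rw [map_mul, ← Complex.exp_conj, map_mul, Complex.conj_ofReal, Complex.conj_ofReal, Complex.conj_I]
  congr 2
  push_cast; ring

lemma kernel_bound (a s : ℝ) (ha : 0 < a) (hane : a ≠ 1) (hs : 0 < s) (hs2 : s < 1 / 2) :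
    ∃ C : ℝ, 0 < C ∧ ∀ A B x : ℝ, 0 < B → x ≠ 0 → (1 / 4 ≤ s ∨ |A| ≤ B) →
      ‖∫ ξ : ℝ, kerI a s A B x ξ‖ ≤ C * |x| ^ (-(1 - 2 * s)) := by
  obtain ⟨C, hC, h⟩ := half_bound a s ha hane hs hs2
  refine ⟨2 * C, by positivity, ?_⟩
  have h' : ∀ A B x : ℝ, 0 < B → x ≠ 0 → (1 / 4 ≤ s ∨ |A| ≤ B) →
      ‖∫ ξ in Set.Ioi (0:ℝ), kerI a s A B x ξ‖ ≤ C * |x| ^ (-(1 - 2 * s)) := by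
    intro A B x hB hx hcond
    rcases lt_or_gt_of_ne hx with hx | hx
    · have := h (-A) B (-x) hB (by linarith) (by rwa [abs_neg])
      rw [abs_of_neg hx]
      refine le_trans (le_of_eq ?_) this
      rw [← RCLike.norm_conj, ← integral_conj]
      simp_rw [kerI_conj]
    · rw [abs_of_pos hx]; exact h A B x hB hx hcond
  intro A B x hB hx hcond
  have hI := kerI_integrable (A := A) (x := x) ha hs hB
  rw [← intervalIntegral.integral_Iic_add_Ioi (b := (0:ℝ)) hI.integrableOn hI.integrableOn]
  refine (norm_add_le _ _).trans ?_
  have e : ∫ ξ in Set.Iic (0:ℝ), kerI a s A B x ξ = ∫ ξ in Set.Ioi (0:ℝ), kerI a s A B (-x) ξ := by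
    have := integral_comp_neg_Iic (0:ℝ) (fun ξ => kerI a s A B (-x) ξ)
    rw [neg_zero] at this
    rw [← this]
    congr 1; ext ξ
    simp [kerI]
  rw [e]
  have q1 := h' A B (-x) hB (neg_ne_zero.2 hx) hcond
  have q2 := h' A B x hB hx hcond
  rw [abs_neg] at q1
  linarith

/-- the multiplier -/
noncomputable def emul (a γ t x ξ : ℝ) : ℂ :=
  Complex.exp (Complex.I * ((t * |ξ| ^ a : ℝ) : ℂ) - ((t ^ γ * |ξ| ^ a : ℝ) : ℂ)) *
    Complex.exp (Complex.I * ((x * ξ : ℝ) : ℂ))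

lemma Pop_eq (a γ : ℝ) (fhat : ℝ → ℂ) (t x : ℝ) :
    Pop a γ fhat t x = ∫ ξ : ℝ, fhat ξ * emul a γ t x ξ := by
  unfold Pop emul; simp_rw [mul_assoc]

lemma norm_emul (a γ t x ξ : ℝ) : ‖emul a γ t x ξ‖ = Real.exp (-(t ^ γ * |ξ| ^ a)) := by
  unfold emul
  rw [norm_mul, Complex.norm_exp, Complex.norm_exp]
  simp [-Complex.ofReal_mul]

lemma emul_measurable (a γ : ℝ) :
    Measurable (fun p : ℝ × ℝ × ℝ => emul a γ p.1 p.2.1 p.2.2) := by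
  unfold emul
  fun_prop

lemma emul_mul_conj (a γ s t u x y ξ : ℝ) :
    ((((1 + ξ ^ 2) ^ (-s) : ℝ)) : ℂ) * (emul a γ t x ξ * (starRingEnd ℂ) (emul a γ u y ξ)) =
      kerI a s (t - u) (t ^ γ + u ^ γ) (x - y) ξ := by
  unfold emul kerI
  rw [map_mul, ← Complex.exp_conj, ← Complex.exp_conj, map_sub, map_mul, map_mul,
    Complex.conj_ofReal, Complex.conj_ofReal, Complex.conj_ofReal, Complex.conj_I,
    ← Complex.exp_add, ← Complex.exp_add, ← Complex.exp_add, Complex.ofReal_mul (Real.exp _),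
    Complex.ofReal_exp]
  rw [← mul_assoc, ← Complex.exp_add, mul_comm]
  congr 2
  push_cast
  ring

lemma weighted_integrable {a b s : ℝ} (ha : 0 < a) (hb : 0 < b) (hs : 0 < s) {fhat : ℝ → ℂ}
    (hm : StronglyMeasurable fhat)
    (hf : Integrable (fun ξ : ℝ => (1 + ξ ^ 2) ^ s * ‖fhat ξ‖ ^ 2) volume) :
    Integrable (fun ξ : ℝ => ‖fhat ξ‖ * Real.exp (-(b * |ξ| ^ a))) volume := by
  have he := integrable_exp_abs ha hb
  refine (hf.add he).mono' ?_ ?_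
  · exact (hm.norm.aestronglyMeasurable).mul he.aestronglyMeasurable
  · refine Filter.Eventually.of_forall (fun ξ => ?_)
    have h1 : 1 ≤ (1 + ξ ^ 2) ^ s := Real.one_le_rpow (by nlinarith) hs.le
    have h2 : Real.exp (-(b * |ξ| ^ a)) ≤ 1 := by
      rw [Real.exp_le_one_iff]; have : 0 ≤ b * |ξ| ^ a := by positivity
      linarith
    have h3 := Real.exp_pos (-(b * |ξ| ^ a))
    rw [Real.norm_eq_abs, abs_of_nonneg (by positivity)]
    simp only [Pi.add_apply]
    set e := Real.exp (-(b * |ξ| ^ a))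
    set n := ‖fhat ξ‖
    have hn : 0 ≤ n := norm_nonneg _
    have h4 : n ^ 2 ≤ (1 + ξ ^ 2) ^ s * n ^ 2 := by nlinarith [sq_nonneg n]
    nlinarith [sq_nonneg (n - e), sq_nonneg n]

lemma Pop_measurable (a γ : ℝ) {fhat : ℝ → ℂ} (hm : StronglyMeasurable fhat) :
    Measurable (fun p : ℝ × ℝ => Pop a γ fhat p.1 p.2) := by
  simp_rw [Pop_eq]
  have : StronglyMeasurable (fun q : (ℝ × ℝ) × ℝ => fhat q.2 * emul a γ q.1.1 q.1.2 q.2) := by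
    refine (hm.comp_measurable measurable_snd).mul ?_
    have := (emul_measurable a γ).comp
      (MeasurableEquiv.prodAssoc (α := ℝ) (β := ℝ) (γ := ℝ)).measurable
    exact this.stronglyMeasurable
  exact this.integral_prod_right'.measurable

lemma lin_abs {s C : ℝ} (hs : 0 < s) (hs2 : s < 1 / 2) (hC : 0 < C)
    (μ : Measure ℝ) [IsFiniteMeasure μ] {fhat : ℝ → ℂ} (hm : StronglyMeasurable fhat)
    (hf : Integrable (fun ξ : ℝ => (1 + ξ ^ 2) ^ s * ‖fhat ξ‖ ^ 2) volume)
    {D : ℝ → ℝ} (hDI : Integrable D volume) (hD1 : ∀ ξ, D ξ ≤ 1) (hD0 : ∀ ξ, 0 ≤ D ξ)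
    (hfD : Integrable (fun ξ => ‖fhat ξ‖ * D ξ) volume)
    {E : ℝ → ℝ → ℂ} (hEm : Measurable (fun p : ℝ × ℝ => E p.1 p.2)) (hEn : ∀ x ξ, ‖E x ξ‖ ≤ D ξ)
    {F : ℝ → ℂ} (hFm : Measurable F) (hFe : ∀ x, F x = ∫ ξ, fhat ξ * E x ξ)
    (hker : ∀ x y : ℝ, x - y ≠ 0 →
      ‖∫ ξ : ℝ, (((1 + ξ ^ 2) ^ (-s) : ℝ) : ℂ) * (E x ξ * (starRingEnd ℂ) (E y ξ))‖
        ≤ C * |x - y| ^ (-(1 - 2 * s))) :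
    ∫⁻ x : ℝ, ‖F x‖ₑ ∂μ ≤
      ENNReal.ofReal (C ^ (1 / 2 : ℝ) * (∫ ξ : ℝ, (1 + ξ ^ 2) ^ s * ‖fhat ξ‖ ^ 2) ^ (1 / 2 : ℝ)) *
            (energy (1 - 2 * s) μ) ^ (1 / 2 : ℝ) := by
  obtain ⟨M, hM⟩ : ∃ M, M = ∫ ξ, ‖fhat ξ‖ * D ξ := ⟨_, rfl⟩
  have hFb : ∀ x, ‖F x‖ ≤ M := by
    intro x
    rw [hFe, hM]
    refine norm_integral_le_of_norm_le hfD (Filter.Eventually.of_forall (fun ξ => ?_))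
    rw [norm_mul]
    exact mul_le_mul_of_nonneg_left (hEn x ξ) (norm_nonneg _)
  have hFI : Integrable F μ := Integrable.of_bound hFm.aestronglyMeasurable M
    (Filter.Eventually.of_forall hFb)
  obtain ⟨w, hw⟩ : ∃ w : ℝ → ℂ, ∀ x, w x = (starRingEnd ℂ) (F x) / (‖F x‖ : ℂ) := ⟨_, fun _ => rfl⟩
  have hwm : Measurable w := by
    have h1 : Measurable (fun x => (starRingEnd ℂ) (F x)) :=
      Complex.continuous_conj.measurable.comp hFm
    have h2 : Measurable (fun x => (‖F x‖ : ℂ)) := Complex.measurable_ofReal.comp hFm.norm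
    have h3 : w = fun x => (starRingEnd ℂ) (F x) / (‖F x‖ : ℂ) := funext hw
    rw [h3]
    exact h1.div h2
  have hw1 : ∀ x, ‖w x‖ ≤ 1 := by
    intro x
    rw [hw]
    rw [norm_div, RCLike.norm_conj, Complex.norm_real, norm_norm]
    exact div_self_le_one _
  have hwF : ∀ x, w x * F x = (‖F x‖ : ℂ) := by
    intro x
    rw [hw]
    by_cases h : F x = 0
    · simp [h]
    · have h' : (‖F x‖ : ℂ) ≠ 0 := by exact_mod_cast norm_ne_zero_iff.2 h
      rw [div_mul_eq_mul_div, div_eq_iff h', mul_comm, Complex.mul_conj, Complex.normSq_eq_norm_sq]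
      push_cast; ring
  obtain ⟨k, hk⟩ : ∃ k : ℝ → ℝ → ℂ, ∀ x ξ, k x ξ = w x * E x ξ := ⟨_, fun _ _ => rfl⟩
  have hkm : Measurable (fun p : ℝ × ℝ => k p.1 p.2) := by
    simp_rw [hk]
    exact (hwm.comp measurable_fst).mul hEm
  have hkn : ∀ x ξ, ‖k x ξ‖ ≤ D ξ := by
    intro x ξ
    rw [hk, norm_mul]
    calc ‖w x‖ * ‖E x ξ‖ ≤ 1 * D ξ := mul_le_mul (hw1 x) (hEn x ξ) (norm_nonneg _) zero_le_one
      _ = D ξ := one_mul _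
  obtain ⟨G, hG⟩ : ∃ G : ℝ → ℂ, ∀ ξ, G ξ = ∫ x, k x ξ ∂μ := ⟨_, fun _ => rfl⟩
  have hGm : Measurable G := by
    have : StronglyMeasurable (fun p : ℝ × ℝ => k p.2 p.1) :=
      (hkm.comp measurable_swap).stronglyMeasurable
    have h3 : G = fun ξ => ∫ x, k x ξ ∂μ := funext hG
    rw [h3]
    exact this.integral_prod_right'.measurable
  have hGn : ∀ ξ, ‖G ξ‖ ≤ D ξ * μ.real Set.univ := fun ξ => by
    rw [hG]
    exact norm_integral_le_of_norm_le_const (Filter.Eventually.of_forall (fun x => hkn x ξ))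
  -- duality
  have step1 : ((∫ x, ‖F x‖ ∂μ : ℝ) : ℂ) = ∫ ξ, fhat ξ * G ξ := by
    rw [← integral_complex_ofReal]
    simp_rw [← hwF, hFe, hG, ← integral_const_mul]
    rw [integral_integral_swap]
    · congr 1; ext ξ
      congr 1; ext x
      rw [hk]; ring
    · have hdom : Integrable (fun p : ℝ × ℝ => ‖fhat p.2‖ * D p.2) (μ.prod volume) :=
        Integrable.comp_snd (f := fun ξ => ‖fhat ξ‖ * D ξ) hfD μ
      refine hdom.mono' ?_ (Filter.Eventually.of_forall (fun p => ?_))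
      · exact ((hwm.comp measurable_fst).mul
          ((hm.measurable.comp measurable_snd).mul hEm)).aestronglyMeasurable
      · simp only [Function.uncurry]
        rw [norm_mul, norm_mul]
        calc ‖w p.1‖ * (‖fhat p.2‖ * ‖E p.1 p.2‖) ≤ 1 * (‖fhat p.2‖ * D p.2) := by
              gcongr
              · exact hw1 _
              · exact hEn _ _
          _ = _ := one_mul _
  have step2 : ∫⁻ x, ‖F x‖ₑ ∂μ ≤ ∫⁻ ξ, ‖fhat ξ‖ₑ * ‖G ξ‖ₑ := by
    have e1 : ∫⁻ x, ‖F x‖ₑ ∂μ = ENNReal.ofReal (∫ x, ‖F x‖ ∂μ) :=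
      (ofReal_integral_norm_eq_lintegral_enorm hFI).symm
    have e2 : ENNReal.ofReal (∫ x, ‖F x‖ ∂μ) = ‖∫ ξ, fhat ξ * G ξ‖ₑ := by
      rw [← step1, ← ofReal_norm, Complex.norm_real, Real.norm_eq_abs,
        abs_of_nonneg (integral_nonneg (fun x => norm_nonneg _))]
    rw [e1, e2]
    refine (enorm_integral_le_lintegral_enorm _).trans (le_of_eq ?_)
    simp_rw [enorm_mul]
  -- TT*
  have hV : ∀ ξ : ℝ, 0 < 1 + ξ ^ 2 := fun ξ => by positivity
  have hV1 : ∀ ξ : ℝ, (1 + ξ ^ 2) ^ (-s) ≤ 1 := fun ξ =>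
    Real.rpow_le_one_of_one_le_of_nonpos (by nlinarith) (by linarith)
  have hVm : Measurable (fun ξ : ℝ => (1 + ξ ^ 2) ^ (-s)) := by fun_prop
  have step3 : ∫⁻ ξ, ENNReal.ofReal ((1 + ξ ^ 2) ^ (-s) * ‖G ξ‖ ^ 2) ≤
      ENNReal.ofReal C * energy (1 - 2 * s) μ := by
    have hint : Integrable (fun ξ : ℝ => (1 + ξ ^ 2) ^ (-s) * ‖G ξ‖ ^ 2) volume := by
      refine (hDI.mul_const (μ.real Set.univ ^ 2)).mono'
        (hVm.mul (hGm.norm.pow_const 2)).aestronglyMeasurable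
        (Filter.Eventually.of_forall (fun ξ => ?_))
      rw [Real.norm_eq_abs, abs_of_nonneg (by have := hV ξ; positivity)]
      calc (1 + ξ ^ 2) ^ (-s) * ‖G ξ‖ ^ 2 ≤ 1 * (D ξ * μ.real Set.univ) ^ 2 := by
            have := hV1 ξ; have := hGn ξ; gcongr
        _ = (D ξ * D ξ) * μ.real Set.univ ^ 2 := by ring
        _ ≤ (D ξ * 1) * μ.real Set.univ ^ 2 := by
            have := hD1 ξ; have := hD0 ξ; gcongr
        _ = _ := by ring
    rw [← ofReal_integral_eq_lintegral_ofReal hint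
      (Filter.Eventually.of_forall (fun ξ => by have := hV ξ; positivity))]
    have e1 : ((∫ ξ : ℝ, (1 + ξ ^ 2) ^ (-s) * ‖G ξ‖ ^ 2 : ℝ) : ℂ) =
        ∫ p : ℝ × ℝ, (w p.1 * (starRingEnd ℂ) (w p.2)) *
          (∫ ξ : ℝ, (((1 + ξ ^ 2) ^ (-s) : ℝ) : ℂ) * (E p.1 ξ * (starRingEnd ℂ) (E p.2 ξ))) ∂(μ.prod μ) := by
      rw [← integral_complex_ofReal]
      have e2 : ∀ ξ : ℝ, (((1 + ξ ^ 2) ^ (-s) * ‖G ξ‖ ^ 2 : ℝ) : ℂ) =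
          ∫ p : ℝ × ℝ, (((1 + ξ ^ 2) ^ (-s) : ℝ) : ℂ) *
            (k p.1 ξ * (starRingEnd ℂ) (k p.2 ξ)) ∂(μ.prod μ) := by
        intro ξ
        rw [integral_const_mul, integral_prod_mul (fun x => k x ξ)
          (fun y => (starRingEnd ℂ) (k y ξ)), integral_conj]
        rw [← hG, Complex.mul_conj, Complex.normSq_eq_norm_sq]
        push_cast; ring
      simp_rw [e2]
      rw [integral_integral_swap]
      · congr 1; ext p
        rw [← integral_const_mul]
        congr 1; ext ξ
        simp only [hk, map_mul]
        ring
      · have hdom : Integrable (fun q : ℝ × ℝ × ℝ => D q.1) (volume.prod (μ.prod μ)) :=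
          Integrable.comp_fst (f := D) hDI (μ.prod μ)
        refine hdom.mono' ?_ (Filter.Eventually.of_forall (fun q => ?_))
        · have m1 : Measurable (fun q : ℝ × ℝ × ℝ => k q.2.1 q.1) :=
            hkm.comp ((measurable_fst.comp measurable_snd).prodMk measurable_fst)
          have m2 : Measurable (fun q : ℝ × ℝ × ℝ => k q.2.2 q.1) :=
            hkm.comp ((measurable_snd.comp measurable_snd).prodMk measurable_fst)
          have m3 : Measurable (fun q : ℝ × ℝ × ℝ => (starRingEnd ℂ) (k q.2.2 q.1)) :=
            Complex.continuous_conj.measurable.comp m2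
          have m4 : Measurable (fun q : ℝ × ℝ × ℝ => (((1 + q.1 ^ 2) ^ (-s) : ℝ) : ℂ)) :=
            Complex.measurable_ofReal.comp (hVm.comp measurable_fst)
          exact (m4.mul (m1.mul m3)).aestronglyMeasurable
        · simp only [Function.uncurry]
          rw [norm_mul, norm_mul, RCLike.norm_conj, Complex.norm_real, Real.norm_eq_abs,
            abs_of_nonneg (by have := hV q.1; positivity)]
          calc _ ≤ 1 * (D q.1 * 1) := by
                have := hV1 q.1
                have := hkn q.2.1 q.1
                have := (hkn q.2.2 q.1).trans (hD1 q.1)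
                have := hD0 q.1
                gcongr
            _ = _ := by ring
    have e3 : ENNReal.ofReal (∫ ξ : ℝ, (1 + ξ ^ 2) ^ (-s) * ‖G ξ‖ ^ 2) =
        ‖((∫ ξ : ℝ, (1 + ξ ^ 2) ^ (-s) * ‖G ξ‖ ^ 2 : ℝ) : ℂ)‖ₑ := by
      rw [← ofReal_norm, Complex.norm_real, Real.norm_eq_abs,
        abs_of_nonneg (integral_nonneg (fun ξ => by have := hV ξ; positivity))]
    rw [e3, e1]
    refine (enorm_integral_le_lintegral_enorm _).trans ?_
    have hmeas : Measurable (fun p : ℝ × ℝ => (ENNReal.ofReal |p.1 - p.2|) ^ (-(1 - 2 * s))) := by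
      fun_prop
    have e4 : energy (1 - 2 * s) μ =
        ∫⁻ p : ℝ × ℝ, (ENNReal.ofReal |p.1 - p.2|) ^ (-(1 - 2 * s)) ∂(μ.prod μ) := by
      rw [lintegral_prod _ hmeas.aemeasurable]; rfl
    rw [e4, ← lintegral_const_mul _ hmeas]
    refine lintegral_mono (fun p => ?_)
    by_cases hp : p.1 - p.2 = 0
    · rw [hp, abs_zero, ENNReal.ofReal_zero, ENNReal.zero_rpow_of_neg (by linarith),
        ENNReal.mul_top (by simpa using hC)]
      exact le_top
    · rw [enorm_mul, enorm_mul]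
      have hwe : ∀ x, ‖w x‖ₑ ≤ 1 := fun x => by
        rw [← ofReal_norm]; exact ENNReal.ofReal_le_one.2 (hw1 x)
      have hwe' : ‖(starRingEnd ℂ) (w p.2)‖ₑ ≤ 1 := by
        rw [← ofReal_norm, RCLike.norm_conj]; exact ENNReal.ofReal_le_one.2 (hw1 _)
      have hK : ‖∫ ξ : ℝ, (((1 + ξ ^ 2) ^ (-s) : ℝ) : ℂ) * (E p.1 ξ * (starRingEnd ℂ) (E p.2 ξ))‖ₑ ≤
          ENNReal.ofReal C * (ENNReal.ofReal |p.1 - p.2|) ^ (-(1 - 2 * s)) := by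
        rw [← ofReal_norm, ENNReal.ofReal_rpow_of_pos (abs_pos.2 hp),
          ← ENNReal.ofReal_mul hC.le]
        apply ENNReal.ofReal_le_ofReal
        exact hker _ _ hp
      calc _ ≤ 1 * 1 * (ENNReal.ofReal C * (ENNReal.ofReal |p.1 - p.2|) ^ (-(1 - 2 * s))) := by
            gcongr
            exact hwe _
        _ = _ := by rw [one_mul, one_mul]
  -- Cauchy-Schwarz
  set P : ℝ → ENNReal := fun ξ => ENNReal.ofReal ((1 + ξ ^ 2) ^ (s / 2) * ‖fhat ξ‖) with hP
  set Q : ℝ → ENNReal := fun ξ => ENNReal.ofReal ((1 + ξ ^ 2) ^ (-(s / 2)) * ‖G ξ‖) with hQ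
  have hPm : Measurable P := by
    have : Measurable (fun ξ : ℝ => (1 + ξ ^ 2) ^ (s / 2)) := by fun_prop
    exact (this.mul hm.measurable.norm).ennreal_ofReal
  have hQm : Measurable Q := by
    have : Measurable (fun ξ : ℝ => (1 + ξ ^ 2) ^ (-(s / 2))) := by fun_prop
    exact (this.mul hGm.norm).ennreal_ofReal
  have hPQ : ∀ ξ, ‖fhat ξ‖ₑ * ‖G ξ‖ₑ = (P * Q) ξ := by
    intro ξ
    have := hV ξ
    simp only [hP, hQ, Pi.mul_apply]
    rw [← ENNReal.ofReal_mul (by positivity), ← ofReal_norm, ← ofReal_norm,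
      ← ENNReal.ofReal_mul (norm_nonneg _)]
    congr 1
    have e : (1 + ξ ^ 2) ^ (s / 2) * (1 + ξ ^ 2) ^ (-(s / 2)) = 1 := by
      rw [← Real.rpow_add this]; simp
    linear_combination (-(‖fhat ξ‖ * ‖G ξ‖)) * e
  have hsq : ∀ (r n : ℝ) (ξ : ℝ), 0 ≤ n →
      (ENNReal.ofReal ((1 + ξ ^ 2) ^ (r / 2) * n)) ^ (2:ℝ) = ENNReal.ofReal ((1 + ξ ^ 2) ^ r * n ^ 2) := by
    intro r n ξ hn
    have := hV ξ
    rw [ENNReal.ofReal_rpow_of_nonneg (by positivity) (by norm_num)]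
    congr 1
    rw [Real.mul_rpow (by positivity) hn, ← Real.rpow_mul this.le]
    congr 1
    · congr 1; ring
    · exact Real.rpow_natCast n 2
  have hCS := ENNReal.lintegral_mul_le_Lp_mul_Lq (volume : Measure ℝ) (p := 2) (q := 2)
    Real.HolderConjugate.two_two hPm.aemeasurable hQm.aemeasurable
  have hPi : ∫⁻ ξ, P ξ ^ (2:ℝ) = ENNReal.ofReal (∫ ξ : ℝ, (1 + ξ ^ 2) ^ s * ‖fhat ξ‖ ^ 2) := by
    rw [ofReal_integral_eq_lintegral_ofReal hf
      (Filter.Eventually.of_forall (fun ξ => by have := hV ξ; positivity))]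
    congr 1; ext ξ
    exact hsq s _ ξ (norm_nonneg _)
  have hQi : ∫⁻ ξ, Q ξ ^ (2:ℝ) ≤ ENNReal.ofReal C * energy (1 - 2 * s) μ := by
    refine le_trans (le_of_eq ?_) step3
    congr 1; ext ξ
    simp only [hQ]
    rw [← neg_div]
    exact hsq (-s) _ ξ (norm_nonneg _)
  have hN : 0 ≤ ∫ ξ : ℝ, (1 + ξ ^ 2) ^ s * ‖fhat ξ‖ ^ 2 :=
    integral_nonneg (fun ξ => by have := hV ξ; positivity)
  calc ∫⁻ x, ‖F x‖ₑ ∂μ ≤ ∫⁻ ξ, ‖fhat ξ‖ₑ * ‖G ξ‖ₑ := step2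
    _ = ∫⁻ ξ, (P * Q) ξ := by simp_rw [hPQ]
    _ ≤ (∫⁻ ξ, P ξ ^ (2:ℝ)) ^ (1 / 2 : ℝ) * (∫⁻ ξ, Q ξ ^ (2:ℝ)) ^ (1 / 2 : ℝ) := hCS
    _ ≤ (ENNReal.ofReal (∫ ξ : ℝ, (1 + ξ ^ 2) ^ s * ‖fhat ξ‖ ^ 2)) ^ (1 / 2 : ℝ) *
        (ENNReal.ofReal C * energy (1 - 2 * s) μ) ^ (1 / 2 : ℝ) := by
        rw [hPi]; gcongr
    _ = _ := by
        rw [ENNReal.mul_rpow_of_nonneg _ _ (by norm_num),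
          ENNReal.ofReal_rpow_of_nonneg hN (by norm_num),
          ENNReal.ofReal_rpow_of_nonneg hC.le (by norm_num),
          ENNReal.ofReal_mul (by positivity)]
        ring


lemma lin_est {a γ s C : ℝ} (ha : 0 < a) (hγ : 0 < γ) (hs : 0 < s)
    (hC : 0 < C)
    (hker : ∀ t u x : ℝ, 0 < t → t < 1 → 0 < u → u < 1 → x ≠ 0 →
      ‖∫ ξ : ℝ, kerI a s (t - u) (t ^ γ + u ^ γ) x ξ‖ ≤ C * |x| ^ (-(1 - 2 * s)))
    (hs2 : s < 1 / 2)
    (μ : Measure ℝ) [IsFiniteMeasure μ] {fhat : ℝ → ℂ} (hm : StronglyMeasurable fhat)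
    (hf : Integrable (fun ξ : ℝ => (1 + ξ ^ 2) ^ s * ‖fhat ξ‖ ^ 2) volume)
    {τ : ℝ → ℝ} (hτ : Measurable τ) {δ : ℝ} (hδ : 0 < δ) (hτδ : ∀ x, δ ≤ τ x) (hτ1 : ∀ x, τ x < 1) :
    ∫⁻ x : ℝ, ‖Pop a γ fhat (τ x) x‖ₑ ∂μ ≤
      ENNReal.ofReal (C ^ (1 / 2 : ℝ) * (∫ ξ : ℝ, (1 + ξ ^ 2) ^ s * ‖fhat ξ‖ ^ 2) ^ (1 / 2 : ℝ)) *
            (energy (1 - 2 * s) μ) ^ (1 / 2 : ℝ) := by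
  obtain ⟨b, hb⟩ : ∃ b, b = δ ^ γ := ⟨_, rfl⟩
  have hbpos : 0 < b := by rw [hb]; positivity
  have hEm : Measurable (fun p : ℝ × ℝ => emul a γ (τ p.1) p.1 p.2) := by
    have h1 : Measurable (fun p : ℝ × ℝ => (τ p.1, p.1, p.2)) := by fun_prop
    have h2 := (emul_measurable a γ).comp h1
    simpa only [Function.comp_def] using h2
  have hFm : Measurable (fun x => Pop a γ fhat (τ x) x) := by
    have h2 := (Pop_measurable a γ hm).comp (hτ.prodMk measurable_id)
    simpa only [Function.comp_def, id] using h2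
  refine lin_abs hs hs2 hC μ hm hf (D := fun ξ => Real.exp (-(b * |ξ| ^ a)))
    (E := fun x ξ => emul a γ (τ x) x ξ)
    (integrable_exp_abs ha hbpos) ?_ (fun ξ => (Real.exp_pos _).le)
    (weighted_integrable ha hbpos hs hm hf) hEm ?_ hFm (fun x => Pop_eq _ _ _ _ _) ?_
  · intro ξ
    rw [Real.exp_le_one_iff]; have : 0 ≤ b * |ξ| ^ a := by positivity
    linarith
  · intro x ξ
    rw [norm_emul]
    have : b ≤ τ x ^ γ := by rw [hb]; exact Real.rpow_le_rpow hδ.le (hτδ x) hγ.le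
    gcongr
  · intro x y hxy
    simp_rw [emul_mul_conj]
    exact hker _ _ _ (hδ.trans_le (hτδ _)) (hτ1 _) (hδ.trans_le (hτδ _)) (hτ1 _) hxy

lemma Pop_continuousAt {a γ s : ℝ} (ha : 0 < a) (hγ : 0 < γ) (hs : 0 < s)
    {fhat : ℝ → ℂ} (hm : StronglyMeasurable fhat)
    (hf : Integrable (fun ξ : ℝ => (1 + ξ ^ 2) ^ s * ‖fhat ξ‖ ^ 2) volume)
    {t : ℝ} (ht : 0 < t) (x : ℝ) :
    ContinuousAt (fun t => Pop a γ fhat t x) t := by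
  simp_rw [Pop_eq]
  have hb : 0 < (t / 2) ^ γ := by positivity
  refine continuousAt_of_dominated
    (bound := fun ξ => ‖fhat ξ‖ * Real.exp (-((t / 2) ^ γ * |ξ| ^ a))) ?_ ?_
    (weighted_integrable ha hb hs hm hf) ?_
  · refine Filter.Eventually.of_forall (fun u => ?_)
    have h1 : Measurable (fun ξ : ℝ => (u, x, ξ)) := by fun_prop
    have h2 := (emul_measurable a γ).comp h1
    have h3 : Measurable (fun ξ => emul a γ u x ξ) := by
      simpa only [Function.comp_def] using h2
    exact (hm.measurable.mul h3).aestronglyMeasurable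
  · filter_upwards [lt_mem_nhds (show t / 2 < t by linarith)] with u hu
    refine Filter.Eventually.of_forall (fun ξ => ?_)
    rw [norm_mul, norm_emul]
    have : (t / 2) ^ γ ≤ u ^ γ := Real.rpow_le_rpow (by linarith) hu.le hγ.le
    gcongr
  · refine Filter.Eventually.of_forall (fun ξ => ?_)
    have h1 : ContinuousAt (fun u : ℝ => u ^ γ) t := Real.continuousAt_rpow_const _ _ (Or.inl ht.ne')
    unfold emul
    have h2 : ContinuousAt (fun u : ℝ => Complex.I * ((u * |ξ| ^ a : ℝ) : ℂ) -
        ((u ^ γ * |ξ| ^ a : ℝ) : ℂ)) t := by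
      apply ContinuousAt.sub
      · fun_prop
      · exact Complex.continuous_ofReal.continuousAt.comp (h1.mul continuousAt_const)
    have h3 : ContinuousAt (fun u : ℝ => Complex.exp (Complex.I * ((u * |ξ| ^ a : ℝ) : ℂ) -
        ((u ^ γ * |ξ| ^ a : ℝ) : ℂ))) t := Complex.continuous_exp.continuousAt.comp h2
    exact continuousAt_const.mul (h3.mul continuousAt_const)

lemma exists_selector {a γ : ℝ} {fhat : ℝ → ℂ} (hm : StronglyMeasurable fhat)
    (q : ℕ → Set.Ioo (0:ℝ) 1) (N : ℕ) :
    ∃ τ : ℝ → ℝ, Measurable τ ∧ (∃ δ > 0, ∀ x, δ ≤ τ x) ∧ (∀ x, τ x < 1) ∧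
      ∀ n ≤ N, ∀ x, ‖Pop a γ fhat (q n) x‖ₑ ≤ ‖Pop a γ fhat (τ x) x‖ₑ := by
  have hP := Pop_measurable a γ hm
  induction N with
  | zero =>
    refine ⟨fun _ => q 0, measurable_const, ⟨q 0, (q 0).2.1, fun _ => le_rfl⟩, fun _ => (q 0).2.2, ?_⟩
    intro n hn x
    obtain rfl : n = 0 := by omega
    exact le_rfl
  | succ N ih =>
    obtain ⟨τ, hτ, ⟨δ, hδ, hτδ⟩, hτ1, hle⟩ := ih
    classical
    have m1 : Measurable (fun x => ‖Pop a γ fhat (q (N + 1)) x‖ₑ) := by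
      have h2 := hP.comp ((measurable_const (a := (q (N + 1) : ℝ))).prodMk measurable_id)
      have h3 := h2.enorm
      simpa only [Function.comp_def, id] using h3
    have m2 : Measurable (fun x => ‖Pop a γ fhat (τ x) x‖ₑ) := by
      have h2 := hP.comp (hτ.prodMk measurable_id)
      have h3 := h2.enorm
      simpa only [Function.comp_def, id] using h3
    refine ⟨fun x => if ‖Pop a γ fhat (τ x) x‖ₑ ≤ ‖Pop a γ fhat (q (N + 1)) x‖ₑ then q (N + 1)
      else τ x, Measurable.ite (measurableSet_le m2 m1) measurable_const hτ,
      ⟨min δ (q (N + 1)), lt_min hδ (q (N + 1)).2.1, fun x => ?_⟩, fun x => ?_, ?_⟩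
    · dsimp only
      split_ifs
      · exact min_le_right _ _
      · exact (min_le_left _ _).trans (hτδ x)
    · dsimp only
      split_ifs
      · exact (q (N + 1)).2.2
      · exact hτ1 x
    · intro n hn x
      dsimp only
      rcases Nat.le_succ_iff.1 hn with h | h
      · split_ifs with h1
        · exact (hle n h x).trans h1
        · exact hle n h x
      · subst h
        split_ifs with h1
        · exact le_rfl
        · exact (not_le.1 h1).le

lemma max_est {a γ s C : ℝ} (ha : 0 < a) (hγ : 0 < γ) (hs : 0 < s)
    (hC : 0 < C)
    (hker : ∀ t u x : ℝ, 0 < t → t < 1 → 0 < u → u < 1 → x ≠ 0 →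
      ‖∫ ξ : ℝ, kerI a s (t - u) (t ^ γ + u ^ γ) x ξ‖ ≤ C * |x| ^ (-(1 - 2 * s)))
    (hs2 : s < 1 / 2)
    (μ : Measure ℝ) [IsFiniteMeasure μ] {fhat : ℝ → ℂ} (hm : StronglyMeasurable fhat)
    (hf : Integrable (fun ξ : ℝ => (1 + ξ ^ 2) ^ s * ‖fhat ξ‖ ^ 2) volume) :
    ∫⁻ x : ℝ, ENNReal.ofReal (Pstar a γ fhat x) ∂μ ≤
      ENNReal.ofReal (C ^ (1 / 2 : ℝ) * (∫ ξ : ℝ, (1 + ξ ^ 2) ^ s * ‖fhat ξ‖ ^ 2) ^ (1 / 2 : ℝ)) *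
            (energy (1 - 2 * s) μ) ^ (1 / 2 : ℝ) := by
  have : Nonempty (Set.Ioo (0:ℝ) 1) := ⟨⟨1 / 2, by norm_num, by norm_num⟩⟩
  obtain ⟨q, hq⟩ := TopologicalSpace.exists_dense_seq (Set.Ioo (0:ℝ) 1)
  have hP := Pop_measurable a γ hm
  have mE : ∀ n, Measurable (fun x => ‖Pop a γ fhat (q n) x‖ₑ) := fun n => by
    have h2 := hP.comp ((measurable_const (a := (q n : ℝ))).prodMk measurable_id)
    have h3 := h2.enorm
    simpa only [Function.comp_def, id] using h3
  have hle : ∀ x, ENNReal.ofReal (Pstar a γ fhat x) ≤ ⨆ n, ‖Pop a γ fhat (q n) x‖ₑ := by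
    intro x
    by_cases htop : (⨆ n, ‖Pop a γ fhat (q n) x‖ₑ) = ⊤
    · rw [htop]; exact le_top
    apply ENNReal.ofReal_le_of_le_toReal
    unfold Pstar
    refine Real.iSup_le (fun t => ?_) ENNReal.toReal_nonneg
    have hc : Continuous (fun t : Set.Ioo (0:ℝ) 1 => ‖Pop a γ fhat t x‖) := by
      refine continuous_iff_continuousAt.2 (fun t => ?_)
      have h1 := Pop_continuousAt (γ := γ) ha hγ hs hm hf t.2.1 x
      have h2 : ContinuousAt (fun t : Set.Ioo (0:ℝ) 1 => (t : ℝ)) t :=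
        continuous_subtype_val.continuousAt
      have h3 := ContinuousAt.comp (f := fun t : Set.Ioo (0:ℝ) 1 => (t : ℝ)) h1 h2
      have h4 := h3.norm
      simpa only [Function.comp_def] using h4
    have hcl : IsClosed {t : Set.Ioo (0:ℝ) 1 | ‖Pop a γ fhat t x‖ ≤
        (⨆ n, ‖Pop a γ fhat (q n) x‖ₑ).toReal} := isClosed_le hc continuous_const
    have hsub : Set.range q ⊆ {t : Set.Ioo (0:ℝ) 1 | ‖Pop a γ fhat t x‖ ≤
        (⨆ n, ‖Pop a γ fhat (q n) x‖ₑ).toReal} := by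
      rintro _ ⟨n, rfl⟩
      have := ENNReal.toReal_mono htop (le_iSup (fun n => ‖Pop a γ fhat (q n) x‖ₑ) n)
      simpa using this
    exact hcl.closure_subset_iff.2 hsub (hq t)
  refine (lintegral_mono hle).trans ?_
  have hsup : ∀ x, (⨆ n, ‖Pop a γ fhat (q n) x‖ₑ) =
      ⨆ N, (Finset.range (N + 1)).sup (fun n => ‖Pop a γ fhat (q n) x‖ₑ) := by
    intro x
    apply le_antisymm
    · refine iSup_le (fun n => le_trans ?_ (le_iSup _ n))
      exact Finset.le_sup (f := fun n => ‖Pop a γ fhat (q n) x‖ₑ) (Finset.self_mem_range_succ n)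
    · refine iSup_le (fun N => Finset.sup_le (fun n _ => ?_))
      exact le_iSup (fun n => ‖Pop a γ fhat (q n) x‖ₑ) n
  simp_rw [hsup]
  rw [lintegral_iSup]
  · refine iSup_le (fun N => ?_)
    obtain ⟨τ, hτ, ⟨δ, hδ, hτδ⟩, hτ1, hsel⟩ := exists_selector (a := a) (γ := γ) hm q N
    refine le_trans (lintegral_mono (fun x => ?_))
      (lin_est ha hγ hs hC hker hs2 μ hm hf hτ hδ hτδ hτ1)
    refine Finset.sup_le (fun n hn => hsel n ?_ x)
    have := Finset.mem_range.1 hn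
    omega
  · intro N
    simp_rw [Finset.sup_eq_iSup]
    exact Measurable.iSup (fun n => Measurable.iSup (fun _ => mE n))
  · intro N N' hNN x
    exact Finset.sup_mono (Finset.range_mono (by omega))

theorem maximal_energy_estimate (a γ s : ℝ) (ha : 0 < a) (hane : a ≠ 1)
    (hcase : (0 < γ ∧ γ ≤ 1 ∧ 0 < s ∧ s < 1 / 2) ∨
             (1 < γ ∧ 1 / 4 ≤ s ∧ s < 1 / 2)) :
    ∃ C : ℝ, 0 < C ∧ ∀ μ : Measure ℝ, IsFiniteMeasure μ →
      (∃ K : Set ℝ, IsCompact K ∧ K ⊆ Metric.ball (0 : ℝ) 1 ∧ μ Kᶜ = 0) →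
      energy (1 - 2 * s) μ < ⊤ →
      ∀ fhat : ℝ → ℂ,
        Integrable (fun ξ : ℝ => (1 + ξ ^ 2) ^ s * ‖fhat ξ‖ ^ 2) volume →
        ∫⁻ x : ℝ, ENNReal.ofReal (Pstar a γ fhat x) ∂μ ≤
          ENNReal.ofReal (C * (∫ ξ : ℝ, (1 + ξ ^ 2) ^ s * ‖fhat ξ‖ ^ 2) ^ (1 / 2 : ℝ)) *
            (energy (1 - 2 * s) μ) ^ (1 / 2 : ℝ) := by
  have hγ : 0 < γ := by rcases hcase with h | h <;> linarith [h.1]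
  have hs : 0 < s := by 
    rcases hcase with h | h
    · exact h.2.2.1
    · linarith [h.2.1]
  have hs2 : s < 1 / 2 := by
    rcases hcase with h | h
    · exact h.2.2.2
    · exact h.2.2
  obtain ⟨C, hC, hK⟩ := kernel_bound a s ha hane hs hs2
  have hker : ∀ t u x : ℝ, 0 < t → t < 1 → 0 < u → u < 1 → x ≠ 0 →
      ‖∫ ξ : ℝ, kerI a s (t - u) (t ^ γ + u ^ γ) x ξ‖ ≤ C * |x| ^ (-(1 - 2 * s)) := by
    intro t u x ht ht1 hu hu1 hx
    refine hK _ _ _ (by positivity) hx ?_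
    rcases hcase with h | h
    · right
      have h1 : t ≤ t ^ γ := by
        simpa using Real.rpow_le_rpow_of_exponent_ge ht ht1.le h.2.1
      have h2 : u ≤ u ^ γ := by
        simpa using Real.rpow_le_rpow_of_exponent_ge hu hu1.le h.2.1
      exact abs_le.2 ⟨by linarith, by linarith⟩
    · exact Or.inl h.2.1
  refine ⟨C ^ (1 / 2 : ℝ), by positivity, ?_⟩
  intro μ hμ _ _ fhat hf
  by_cases hm : AEStronglyMeasurable fhat volume
  · obtain ⟨g, hg, hfg⟩ := hm
    have e1 : (fun ξ : ℝ => (1 + ξ ^ 2) ^ s * ‖fhat ξ‖ ^ 2) =ᵐ[volume]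
        (fun ξ : ℝ => (1 + ξ ^ 2) ^ s * ‖g ξ‖ ^ 2) := by
      filter_upwards [hfg] with ξ h
      rw [h]
    have e2 : Pstar a γ fhat = Pstar a γ g := by
      funext x
      unfold Pstar
      congr 1; funext t
      rw [Pop_eq, Pop_eq]
      congr 1
      apply integral_congr_ae
      filter_upwards [hfg] with ξ h
      rw [h]
    rw [e2, integral_congr_ae e1]
    exact max_est ha hγ hs hC hker hs2 μ hg (hf.congr e1)
  · have hz : ∀ t x, Pop a γ fhat t x = 0 := by
      intro t x
      rw [Pop_eq]
      apply integral_undef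
      intro hI
      apply hm
      have h1 : Measurable (fun ξ : ℝ => (t, x, ξ)) := by fun_prop
      have h2 := (emul_measurable a γ).comp h1
      have h3 : Measurable (fun ξ => emul a γ t x ξ) := by
        simpa only [Function.comp_def] using h2
      have h4 := hI.aestronglyMeasurable.mul h3.inv.aestronglyMeasurable
      refine h4.congr (Filter.Eventually.of_forall (fun ξ => ?_))
      have : emul a γ t x ξ ≠ 0 := by
        rw [← norm_ne_zero_iff, norm_emul]; exact (Real.exp_pos _).ne'
      simp [this]
    have : ∀ x, Pstar a γ fhat x = 0 := by
      intro x
      unfold Pstar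
      simp [hz]
    simp [this]
end

section
/- Let a = 1, γ > 0, s ∈ ((1/2)(1-1/γ)_+, 1/2), and ϱ = max{1-2s, γ(1-2s)}. If μ is a finite Borel measure with compact support in B(0,1) ⊂ ℝ and I_ϱ(μ) < ∞, then ∫ sup_{0<t<1} |P^t_{1,γ} f(x)| dμ(x) ≲ I_ϱ(μ)^{1/2} ‖f‖_{H^s(ℝ)} for all f ∈ H^s(ℝ). -/
open MeasureTheory

lemma aux_int (p b : ℝ) (hp : 0 < p) (hb : 0 < b) :
    IntegrableOn (fun x : ℝ => x ^ (p - 1) * Real.exp (-b * x)) (Set.Ioi 0) volume := by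
  simpa using integrableOn_rpow_mul_exp_neg_mul_rpow (p := 1) (s := p - 1) (b := b)
    (by linarith) one_pos hb

lemma aux_norm (p : ℝ) (z : ℂ) (ξ : ℝ) (hξ : 0 < ξ) :
    ‖((ξ ^ (p - 1) : ℝ) : ℂ) * Complex.exp (-(z * ξ))‖ = ξ ^ (p - 1) * Real.exp (-z.re * ξ) := by
  rw [norm_mul, Complex.norm_real, Complex.norm_exp, Real.norm_of_nonneg (by positivity)]
  simp

lemma aux_intC (p : ℝ) (z : ℂ) (hp : 0 < p) (hz : 0 < z.re) :
    IntegrableOn (fun ξ : ℝ => ((ξ ^ (p - 1) : ℝ) : ℂ) * Complex.exp (-(z * ξ)))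
      (Set.Ioi 0) volume := by
  refine Integrable.mono' (aux_int p z.re hp hz) ?_ ?_
  · exact (by fun_prop : Measurable _).aestronglyMeasurable
  · filter_upwards [ae_restrict_mem measurableSet_Ioi] with ξ hξ
    exact (aux_norm p z ξ hξ).le

lemma osc_bound (p : ℝ) (hp : 0 < p) (hp1 : p < 1) (z : ℂ) (hz : 0 < z.re) :
    ‖∫ ξ in Set.Ioi (0:ℝ), ((ξ ^ (p - 1) : ℝ) : ℂ) * Complex.exp (-(z * ξ))‖
      ≤ (1 / p + 2) * ‖z‖ ^ (-p) := by
  have hz0 : z ≠ 0 := by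
    rintro rfl; simp at hz
  have hn : 0 < ‖z‖ := norm_pos_iff.2 hz0
  set R : ℝ := ‖z‖⁻¹ with hR
  have hR0 : 0 < R := inv_pos.2 hn
  have hi := aux_intC p z hp hz
  have hRp : R ^ p = ‖z‖ ^ (-p) := by
    rw [hR, Real.inv_rpow hn.le, Real.rpow_neg hn.le]
  have hle : ∀ ξ : ℝ, 0 < ξ →
      ∀ q : ℝ, ‖((ξ ^ (q - 1) : ℝ) : ℂ) * Complex.exp (-(z * ξ))‖ ≤ ξ ^ (q - 1) := by
    intro ξ hξ q
    rw [aux_norm q z ξ hξ]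
    have : Real.exp (-z.re * ξ) ≤ 1 := by
      rw [Real.exp_le_one_iff]; nlinarith
    have h2 : 0 ≤ ξ ^ (q - 1) := by positivity
    nlinarith
  have hsplit := setIntegral_union (μ := volume) (f := fun ξ : ℝ => ((ξ ^ (p - 1) : ℝ) : ℂ) * Complex.exp (-(z * ξ)))
    (Set.Ioc_disjoint_Ioi (le_refl R) : Disjoint (Set.Ioc 0 R) (Set.Ioi R)) measurableSet_Ioi
    (hi.mono_set Set.Ioc_subset_Ioi_self) (hi.mono_set (Set.Ioi_subset_Ioi hR0.le))
  rw [Set.Ioc_union_Ioi_eq_Ioi hR0.le] at hsplit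
  have h1 : ‖∫ ξ in Set.Ioc 0 R, ((ξ ^ (p - 1) : ℝ) : ℂ) * Complex.exp (-(z * ξ))‖ ≤ 1 / p * ‖z‖ ^ (-p) := by
    have hint : IntegrableOn (fun x : ℝ => x ^ (p - 1)) (Set.Ioc 0 R) volume := by
      rw [← intervalIntegrable_iff_integrableOn_Ioc_of_le hR0.le]
      exact intervalIntegral.intervalIntegrable_rpow' (by linarith)
    refine (norm_integral_le_of_norm_le hint ?_).trans ?_
    · filter_upwards [ae_restrict_mem measurableSet_Ioc] with ξ hξ
      exact hle ξ hξ.1 p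
    · rw [← intervalIntegral.integral_of_le hR0.le, integral_rpow (Or.inl (by linarith))]
      have e1 : p - 1 + 1 = p := by ring
      rw [e1, Real.zero_rpow hp.ne', hRp]
      exact le_of_eq (by ring)
  have h2 : ‖∫ ξ in Set.Ioi R, ((ξ ^ (p - 1) : ℝ) : ℂ) * Complex.exp (-(z * ξ))‖ ≤ 2 * ‖z‖ ^ (-p) := by
    set F : ℝ → ℂ := fun ξ => ((ξ ^ (p - 1) : ℝ) : ℂ) * Complex.exp (-(z * ξ)) / z with hF
    set H : ℝ → ℂ := fun ξ => (((p - 1) * ξ ^ (p - 2) : ℝ) : ℂ) * Complex.exp (-(z * ξ)) / z with hH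
    have hd : ∀ ξ ∈ Set.Ici R, HasDerivAt F
        (H ξ - ((ξ ^ (p - 1) : ℝ) : ℂ) * Complex.exp (-(z * ξ))) ξ := by
      intro ξ hξ
      have hξ0 : 0 < ξ := hR0.trans_le hξ
      have d1 : HasDerivAt (fun ξ : ℝ => ((ξ ^ (p - 1) : ℝ) : ℂ)) (((p - 1) * ξ ^ (p - 2) : ℝ) : ℂ) ξ := by
        have := (Real.hasDerivAt_rpow_const (x := ξ) (p := p - 1) (Or.inl hξ0.ne')).ofReal_comp
        convert this using 3
        ring_nf
      have d2 : HasDerivAt (fun ξ : ℝ => Complex.exp (-(z * ξ))) (Complex.exp (-(z * ξ)) * (-(z * 1))) ξ := by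
        have : HasDerivAt (fun ξ : ℝ => -(z * (ξ : ℂ))) (-(z * 1)) ξ :=
          ((hasDerivAt_id ξ).ofReal_comp.const_mul z).neg
        exact this.cexp
      refine ((d1.mul d2).div_const z).congr_deriv ?_
      simp only [hH]
      field_simp
      ring
    have hint2 : IntegrableOn (fun ξ : ℝ => ξ ^ (p - 2)) (Set.Ioi R) volume :=
      integrableOn_Ioi_rpow_of_lt (by linarith) hR0
    have hHle : ∀ ξ ∈ Set.Ioi R, ‖H ξ‖ ≤ (1 - p) / ‖z‖ * ξ ^ (p - 2) := by
      intro ξ hξ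
      have hξ0 : 0 < ξ := hR0.trans hξ
      have := hle ξ hξ0 (p - 1)
      have e2 : p - 1 - 1 = p - 2 := by ring
      rw [e2] at this
      have e : H ξ = ((p - 1 : ℝ) : ℂ) / z * (((ξ ^ (p - 2) : ℝ) : ℂ) * Complex.exp (-(z * ξ))) := by
        rw [hH]; push_cast; ring
      rw [e, norm_mul, norm_div, Complex.norm_real, Real.norm_eq_abs, abs_of_neg (by linarith), neg_sub]
      exact mul_le_mul_of_nonneg_left this (div_nonneg (by linarith) hn.le)
    have hHi : IntegrableOn H (Set.Ioi R) volume := by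
      refine Integrable.mono' (hint2.const_mul ((1 - p) / ‖z‖)) ?_ ?_
      · exact (by rw [hH]; fun_prop : Measurable H).aestronglyMeasurable
      · filter_upwards [ae_restrict_mem measurableSet_Ioi] with ξ hξ
        exact hHle ξ hξ
    have hi2 := hi.mono_set (Set.Ioi_subset_Ioi hR0.le)
    have hlim : Filter.Tendsto F Filter.atTop (nhds 0) := by
      rw [tendsto_zero_iff_norm_tendsto_zero]
      have t1 : Filter.Tendsto (fun ξ : ℝ => ξ ^ (-(1 - p)) / ‖z‖) Filter.atTop (nhds 0) := by
        simpa using (tendsto_rpow_neg_atTop (by linarith : 0 < 1 - p)).div_const ‖z‖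
      refine squeeze_zero' (Filter.Eventually.of_forall fun _ => norm_nonneg _) ?_ t1
      filter_upwards [Filter.eventually_gt_atTop 0] with ξ hξ
      rw [hF, norm_div]
      have := hle ξ hξ p
      have e3 : -(1 - p) = p - 1 := by ring
      rw [e3]
      gcongr
    have hFT := integral_Ioi_of_hasDerivAt_of_tendsto' hd (hHi.sub hi2) hlim
    rw [integral_sub hHi hi2] at hFT
    have hval : ∫ ξ in Set.Ioi R, ((ξ ^ (p - 1) : ℝ) : ℂ) * Complex.exp (-(z * ξ))
        = (∫ ξ in Set.Ioi R, H ξ) + F R := by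
      linear_combination -hFT
    rw [hval]
    have hRR : R ^ (p - 1) / ‖z‖ = ‖z‖ ^ (-p) := by
      rw [← hRp, Real.rpow_sub_one hR0.ne', hR]; field_simp
    have b1 : ‖F R‖ ≤ ‖z‖ ^ (-p) := by
      rw [hF, norm_div, ← hRR]
      have := hle R hR0 p
      gcongr
    have b2 : ‖∫ ξ in Set.Ioi R, H ξ‖ ≤ ‖z‖ ^ (-p) := by
      refine (norm_integral_le_of_norm_le (hint2.const_mul ((1 - p) / ‖z‖)) ?_).trans ?_
      · filter_upwards [ae_restrict_mem measurableSet_Ioi] with ξ hξ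
        exact hHle ξ hξ
      · rw [integral_const_mul, integral_Ioi_rpow_of_lt (by linarith) hR0, ← hRR]
        have e4 : p - 2 + 1 = p - 1 := by ring
        have : p - 1 ≠ 0 := by linarith
        rw [e4]
        apply le_of_eq
        field_simp
        ring
    calc _ ≤ _ := norm_add_le _ _
      _ ≤ _ := by linarith
  rw [hsplit]
  calc _ ≤ _ := norm_add_le _ _
    _ ≤ _ := by linarith

lemma aux_int_abs (p b : ℝ) (hp : 0 < p) (hb : 0 < b) :
    Integrable (fun ξ : ℝ => |ξ| ^ (p - 1) * Real.exp (-b * |ξ|)) volume := by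
  have h1 : IntegrableOn (fun ξ : ℝ => |ξ| ^ (p - 1) * Real.exp (-b * |ξ|)) (Set.Ioi 0) volume := by
    refine (aux_int p b hp hb).congr_fun ?_ measurableSet_Ioi
    intro ξ hξ
    simp only [abs_of_pos (Set.mem_Ioi.1 hξ)]
  have h2 : IntegrableOn (fun ξ : ℝ => |ξ| ^ (p - 1) * Real.exp (-b * |ξ|)) (Set.Iic 0) volume := by
    have h3 : IntegrableOn (fun ξ : ℝ => |ξ| ^ (p - 1) * Real.exp (-b * |ξ|)) (Set.Ici (-0)) volume := by
      rw [neg_zero, integrableOn_Ici_iff_integrableOn_Ioi]; exact h1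
    simpa only [abs_neg] using h3.comp_neg_Iic
  rw [← integrableOn_univ, ← Set.Iic_union_Ioi (a := (0:ℝ))]
  exact h2.union h1

/-- The multiplier `e^{it|ξ| - t^γ|ξ|} e^{ixξ}`. -/
noncomputable def ek (γ t x ξ : ℝ) : ℂ :=
  Complex.exp (Complex.I * ((t * |ξ| : ℝ) : ℂ) - ((t ^ γ * |ξ| : ℝ) : ℂ)) *
    Complex.exp (Complex.I * ((x * ξ : ℝ) : ℂ))

lemma ek_norm (γ t x ξ : ℝ) : ‖ek γ t x ξ‖ = Real.exp (-(t ^ γ) * |ξ|) := by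
  simp only [ek, norm_mul, Complex.norm_exp]
  simp [-Complex.ofReal_mul]

lemma zbound (γ p B a d : ℝ) (hγ : 0 < γ) (hp : 0 < p) (hd : 0 < |d|) (hd2 : |d| ≤ 2)
    (hB : |a| ^ γ ≤ B) (z : ℂ) (hzr : z.re = B) (hzi : z.im = -(a + d)) :
    ‖z‖ ^ (-p) ≤ 2 ^ (max p (γ * p)) * |d| ^ (-(max p (γ * p))) := by
  set r := |d| / 2 with hr
  have hr0 : 0 < r := by positivity
  have hr1 : r ≤ 1 := by linarith
  have hrhs : (2:ℝ) ^ (max p (γ * p)) * |d| ^ (-(max p (γ * p))) = r ^ (-(max p (γ * p))) := by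
    rw [hr, Real.div_rpow (abs_nonneg _) (by norm_num), Real.rpow_neg (by norm_num : (0:ℝ) ≤ 2)]
    field_simp
  rw [hrhs]
  by_cases h : r ≤ |a|
  · have h1 : r ^ γ ≤ ‖z‖ := by
      calc r ^ γ ≤ |a| ^ γ := Real.rpow_le_rpow hr0.le h hγ.le
        _ ≤ B := hB
        _ = z.re := hzr.symm
        _ ≤ ‖z‖ := Complex.re_le_norm z
    calc ‖z‖ ^ (-p) ≤ (r ^ γ) ^ (-p) :=
          Real.rpow_le_rpow_of_nonpos (by positivity) h1 (by linarith)
      _ = r ^ (-(γ * p)) := by rw [← Real.rpow_mul hr0.le]; ring_nf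
      _ ≤ _ := Real.rpow_le_rpow_of_exponent_ge hr0 hr1 (neg_le_neg (le_max_right _ _))
  · have h1 : r ≤ ‖z‖ := by
      have h2 := Complex.abs_im_le_norm z
      rw [hzi, abs_neg] at h2
      have h3 : |d| ≤ |a + d| + |a| := by
        calc |d| = |(a + d) - a| := by ring_nf
          _ ≤ _ := abs_sub _ _
      have : |d| = 2 * r := by rw [hr]; ring
      linarith
    calc ‖z‖ ^ (-p) ≤ r ^ (-p) := Real.rpow_le_rpow_of_nonpos hr0 h1 (by linarith)
      _ ≤ _ := Real.rpow_le_rpow_of_exponent_ge hr0 hr1 (neg_le_neg (le_max_left _ _))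

lemma kernel_bound_s16 (γ p : ℝ) (hγ : 0 < γ) (hp : 0 < p) (hp1 : p < 1) (t t' x y : ℝ)
    (ht : 0 < t) (ht' : 0 < t') (hxy : 0 < |x - y|) (hxy2 : |x - y| ≤ 2) :
    ‖∫ ξ : ℝ, ((|ξ| ^ (p - 1) : ℝ) : ℂ) * (ek γ t x ξ * (starRingEnd ℂ) (ek γ t' y ξ))‖ ≤
      2 * (1 / p + 2) * 2 ^ (max p (γ * p)) * |x - y| ^ (-(max p (γ * p))) := by
  set B := t ^ γ + t' ^ γ with hBdef
  have hB0 : 0 < B := by positivity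
  have hB : |t - t'| ^ γ ≤ B := by
    have h1 : 0 ≤ t ^ γ := by positivity
    have h2 : 0 ≤ t' ^ γ := by positivity
    rcases le_total t t' with h | h
    · rw [abs_of_nonpos (by linarith)]
      have := Real.rpow_le_rpow (by linarith) (by linarith : -(t - t') ≤ t') hγ.le
      linarith
    · rw [abs_of_nonneg (by linarith)]
      have := Real.rpow_le_rpow (by linarith) (by linarith : (t - t') ≤ t) hγ.le
      linarith
  set z₁ : ℂ := ⟨B, -((t - t') + (x - y))⟩ with hz1
  set z₂ : ℂ := ⟨B, -((t - t') + -(x - y))⟩ with hz2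
  set f : ℝ → ℂ := fun ξ => ((|ξ| ^ (p - 1) : ℝ) : ℂ) *
    (ek γ t x ξ * (starRingEnd ℂ) (ek γ t' y ξ)) with hf
  have f1 : ∀ ξ ∈ Set.Ioi (0:ℝ), f ξ = ((ξ ^ (p - 1) : ℝ) : ℂ) * Complex.exp (-(z₁ * ξ)) := by
    intro ξ hξ
    simp only [hf, ek, abs_of_pos (Set.mem_Ioi.1 hξ), ← Complex.exp_conj, ← Complex.exp_add]
    congr 2
    apply Complex.ext <;> simp [-Complex.ofReal_mul, hz1, hBdef] <;> ring
  have f2 : ∀ ξ ∈ Set.Ioi (0:ℝ), f (-ξ) = ((ξ ^ (p - 1) : ℝ) : ℂ) * Complex.exp (-(z₂ * ξ)) := by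
    intro ξ hξ
    simp only [hf, ek, abs_neg, abs_of_pos (Set.mem_Ioi.1 hξ), ← Complex.exp_conj, ← Complex.exp_add]
    congr 2
    apply Complex.ext <;> simp [-Complex.ofReal_mul, hz2, hBdef] <;> ring
  have hfi : Integrable f volume := by
    refine (aux_int_abs p B hp hB0).mono' ?_ ?_
    · refine (?_ : Measurable f).aestronglyMeasurable
      simp only [hf, ek, map_mul, ← Complex.exp_conj]
      fun_prop
    · refine Filter.Eventually.of_forall fun ξ => le_of_eq ?_
      simp only [hf, norm_mul, RCLike.norm_conj, ek_norm, ← Real.exp_add]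
      rw [Complex.norm_real, Real.norm_of_nonneg (by positivity), hBdef]
      ring_nf
  rw [← intervalIntegral.integral_Iic_add_Ioi (b := 0) hfi.integrableOn hfi.integrableOn]
  have i1 := setIntegral_congr_fun (μ := volume) measurableSet_Ioi f1
  have i2 : ∫ ξ in Set.Iic 0, f ξ = ∫ ξ in Set.Ioi (0:ℝ), ((ξ ^ (p - 1) : ℝ) : ℂ) * Complex.exp (-(z₂ * ξ)) := by
    rw [← setIntegral_congr_fun (μ := volume) measurableSet_Ioi f2, integral_comp_neg_Ioi, neg_zero]
  rw [i1, i2]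
  have b1 := osc_bound p hp hp1 z₁ hB0
  have b2 := osc_bound p hp hp1 z₂ hB0
  have c1 := zbound γ p B (t - t') (x - y) hγ hp hxy hxy2 hB z₁ rfl rfl
  have c2 := zbound γ p B (t - t') (-(x - y)) hγ hp (by rwa [abs_neg]) (by rwa [abs_neg]) hB z₂ rfl rfl
  rw [abs_neg] at c2
  have hc : 0 ≤ 1 / p + 2 := by positivity
  have d1 := mul_le_mul_of_nonneg_left c1 hc
  have d2 := mul_le_mul_of_nonneg_left c2 hc
  refine (norm_add_le _ _).trans ?_
  linarith

lemma gexp_int (γ s δ : ℝ) (hs : 0 < s) (hδ : 0 < δ) (g : ℝ → ℂ)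
    (hg : AEStronglyMeasurable g volume)
    (hint : Integrable (fun ξ : ℝ => (1 + ξ ^ 2) ^ s * ‖g ξ‖ ^ 2) volume) :
    Integrable (fun ξ : ℝ => ‖g ξ‖ * Real.exp (-(δ ^ γ) * |ξ|)) volume := by
  have h1 := aux_int_abs 1 (2 * δ ^ γ) one_pos (by positivity)
  refine (hint.add h1).mono' ?_ ?_
  · exact hg.norm.mul (by fun_prop : Continuous _).aestronglyMeasurable
  · refine Filter.Eventually.of_forall fun ξ => ?_
    have e1 : |ξ| ^ ((1:ℝ) - 1) * Real.exp (-(2 * δ ^ γ) * |ξ|) = Real.exp (-(δ ^ γ) * |ξ|) ^ 2 := by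
      rw [sub_self, Real.rpow_zero, one_mul, ← Real.exp_nat_mul]
      congr 1; push_cast; ring
    have e2 : 1 ≤ (1 + ξ ^ 2) ^ s := Real.one_le_rpow (by nlinarith [sq_nonneg ξ]) hs.le
    rw [Real.norm_of_nonneg (by positivity), Pi.add_apply, e1]
    nlinarith [sq_nonneg (‖g ξ‖ - Real.exp (-(δ ^ γ) * |ξ|)), sq_nonneg (‖g ξ‖),
      sq_nonneg (Real.exp (-(δ ^ γ) * |ξ|))]

lemma ek_le (γ δ t x ξ : ℝ) (hγ : 0 < γ) (hδ : 0 < δ) (ht : δ ≤ t) :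
    ‖ek γ t x ξ‖ ≤ Real.exp (-(δ ^ γ) * |ξ|) := by
  rw [ek_norm, Real.exp_le_exp]
  have := Real.rpow_le_rpow hδ.le ht hγ.le
  nlinarith [abs_nonneg ξ]

lemma ek_meas (γ : ℝ) (T : ℝ → ℝ) (hT : Measurable T) :
    Measurable fun q : ℝ × ℝ => ek γ (T q.1) q.1 q.2 := by
  unfold ek
  fun_prop

lemma ek_meas_swap (γ : ℝ) (T : ℝ → ℝ) (hT : Measurable T) :
    Measurable fun q : ℝ × ℝ => ek γ (T q.2) q.2 q.1 := by
  unfold ek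
  fun_prop

lemma ek_meas_right (γ t x : ℝ) : Measurable fun ξ : ℝ => ek γ t x ξ := by
  unfold ek
  fun_prop

lemma ek_cont (γ x ξ : ℝ) (hγ : 0 < γ) : Continuous fun t : ℝ => ek γ t x ξ := by
  have h := Real.continuous_rpow_const hγ.le
  unfold ek
  fun_prop

lemma ek_Pop (γ t x : ℝ) (f : ℝ → ℂ) : Pop 1 γ f t x = ∫ ξ, f ξ * ek γ t x ξ := by
  simp only [Pop, ek, Real.rpow_one, mul_assoc]

attribute [irreducible] ek

lemma dual_bound (γ s δ : ℝ) (hγ : 0 < γ) (hs : 0 < s) (hs2 : s < 1 / 2) (hδ : 0 < δ)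
    (μ : Measure ℝ) [IsFiniteMeasure μ] (hμ : ∀ᵐ x ∂μ, |x| < 1)
    (T : ℝ → ℝ) (hT : Measurable T) (hTδ : ∀ x, δ ≤ T x)
    (w : ℝ → ℂ) (hw : Measurable w) (hw1 : ∀ x, ‖w x‖ ≤ 1) :
    ∫⁻ ξ : ℝ, ENNReal.ofReal (|ξ| ^ (-(2 * s)) * ‖∫ x, w x * ek γ (T x) x ξ ∂μ‖ ^ 2) ≤
      ENNReal.ofReal (2 * (1 / (1 - 2 * s) + 2) * 2 ^ (max (1 - 2 * s) (γ * (1 - 2 * s)))) *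
        energy (max (1 - 2 * s) (γ * (1 - 2 * s))) μ := by
  set p := 1 - 2 * s with hp
  have hp0 : 0 < p := by linarith
  have hp1 : p < 1 := by linarith
  have hps : -(2 * s) = p - 1 := by rw [hp]; ring
  rw [hps]
  set ρ := max p (γ * p) with hρ
  have hρ0 : 0 < ρ := lt_max_of_lt_left hp0
  set C₀ := 2 * (1 / p + 2) * (2:ℝ) ^ ρ with hC
  have hC0 : 0 < C₀ := by positivity
  set h : ℝ → ℝ → ℂ := fun x ξ => w x * ek γ (T x) x ξ with hh
  have hhm : Measurable fun q : ℝ × ℝ => h q.1 q.2 := by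
    have : Measurable fun q : ℝ × ℝ => ek γ (T q.1) q.1 q.2 :=
      ek_meas γ T hT
    exact (hw.comp measurable_fst).mul this
  have hhb : ∀ x ξ, ‖h x ξ‖ ≤ Real.exp (-(δ ^ γ) * |ξ|) := by
    intro x ξ
    simp only [hh, norm_mul]
    have := ek_le γ δ (T x) x ξ hγ hδ (hTδ x)
    have h2 := hw1 x
    calc _ ≤ 1 * ‖ek γ (T x) x ξ‖ := by gcongr
      _ ≤ _ := by linarith
  -- the triple integrand
  set Φ : (ℝ × ℝ) → ℝ → ℂ := fun z ξ =>
    ((|ξ| ^ (p - 1) : ℝ) : ℂ) * (h z.1 ξ * (starRingEnd ℂ) (h z.2 ξ)) with hΦ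
  have hΦm : Measurable (Function.uncurry Φ) := by
    have m1 : Measurable fun q : (ℝ × ℝ) × ℝ => h q.1.1 q.2 :=
      hhm.comp (by fun_prop : Measurable fun q : (ℝ × ℝ) × ℝ => (q.1.1, q.2))
    have m2 : Measurable fun q : (ℝ × ℝ) × ℝ => h q.1.2 q.2 :=
      hhm.comp (by fun_prop : Measurable fun q : (ℝ × ℝ) × ℝ => (q.1.2, q.2))
    have m3 : Measurable fun q : (ℝ × ℝ) × ℝ => (starRingEnd ℂ) (h q.1.2 q.2) :=
      Complex.continuous_conj.measurable.comp m2
    have m4 : Measurable fun q : (ℝ × ℝ) × ℝ => ((|q.2| ^ (p - 1) : ℝ) : ℂ) := by fun_prop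
    exact m4.mul (m1.mul m3)
  have hΦi : Integrable (Function.uncurry Φ) ((μ.prod μ).prod volume) := by
    have h0 : Integrable (fun _ : ℝ × ℝ => (1:ℝ)) (μ.prod μ) := integrable_const _
    have h1 := aux_int_abs p (2 * δ ^ γ) hp0 (by positivity)
    refine (h0.mul_prod h1).mono' hΦm.aestronglyMeasurable ?_
    refine Filter.Eventually.of_forall fun q => ?_
    have b1 := hhb q.1.1 q.2
    have b2 := hhb q.1.2 q.2
    have e1 : Real.exp (-(2 * δ ^ γ) * |q.2|)
        = Real.exp (-(δ ^ γ) * |q.2|) * Real.exp (-(δ ^ γ) * |q.2|) := by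
      rw [← Real.exp_add]; ring_nf
    simp only [Function.uncurry, hΦ, norm_mul, RCLike.norm_conj, one_mul]
    rw [Complex.norm_real, Real.norm_of_nonneg (by positivity), e1]
    gcongr
  have hG : ∀ ξ, ∫ z, Φ z ξ ∂(μ.prod μ)
      = ((|ξ| ^ (p - 1) * ‖∫ x, h x ξ ∂μ‖ ^ 2 : ℝ) : ℂ) := by
    intro ξ
    simp only [hΦ]
    rw [integral_const_mul, integral_prod_mul (fun x => h x ξ) (fun x => (starRingEnd ℂ) (h x ξ)),
      integral_conj, Complex.mul_conj, Complex.normSq_eq_norm_sq]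
    push_cast
    rfl
  have hGi : Integrable (fun ξ => |ξ| ^ (p - 1) * ‖∫ x, h x ξ ∂μ‖ ^ 2) volume := by
    have := hΦi.integral_prod_right
    simp only [Function.uncurry] at this
    simp_rw [hG] at this
    exact this.re
  have hswap : ((∫ ξ, |ξ| ^ (p - 1) * ‖∫ x, h x ξ ∂μ‖ ^ 2 : ℝ) : ℂ)
      = ∫ z, (∫ ξ, Φ z ξ) ∂(μ.prod μ) := by
    rw [integral_integral_swap hΦi]
    simp_rw [hG]
    exact integral_ofReal.symm
  rw [← ofReal_integral_eq_lintegral_ofReal hGi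
    (Filter.Eventually.of_forall fun ξ => by positivity)]
  have hnn : 0 ≤ ∫ ξ, |ξ| ^ (p - 1) * ‖∫ x, h x ξ ∂μ‖ ^ 2 :=
    integral_nonneg fun ξ => by positivity
  have e1 : ENNReal.ofReal (∫ ξ, |ξ| ^ (p - 1) * ‖∫ x, h x ξ ∂μ‖ ^ 2)
      = ‖∫ z, (∫ ξ, Φ z ξ) ∂(μ.prod μ)‖ₑ := by
    rw [← hswap, ← ofReal_norm, Complex.norm_real, Real.norm_of_nonneg hnn]
  rw [e1]
  refine (enorm_integral_le_lintegral_enorm _).trans ?_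
  rw [lintegral_prod _ ((hΦm.stronglyMeasurable.integral_prod_right).measurable.enorm.aemeasurable)]
  unfold energy
  rw [← lintegral_const_mul' _ _ ENNReal.ofReal_ne_top]
  refine lintegral_mono_ae ?_
  filter_upwards [hμ] with x hx
  rw [← lintegral_const_mul' _ _ ENNReal.ofReal_ne_top]
  refine lintegral_mono_ae ?_
  filter_upwards [hμ] with y hy
  rcases eq_or_ne x y with rfl | hxy
  · rw [sub_self, abs_zero, ENNReal.ofReal_zero, ENNReal.zero_rpow_of_neg (by linarith),
      ENNReal.mul_top (by simpa using hC0)]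
    exact le_top
  · have hxy0 : 0 < |x - y| := abs_pos.2 (sub_ne_zero.2 hxy)
    have hxy2 : |x - y| ≤ 2 := by
      have := abs_sub x y
      linarith
    have hk := kernel_bound_s16 γ p hγ hp0 hp1 (T x) (T y) x y (hδ.trans_le (hTδ x))
      (hδ.trans_le (hTδ y)) hxy0 hxy2
    have e2 : ∫ ξ, Φ (x, y) ξ = (w x * (starRingEnd ℂ) (w y)) *
        ∫ ξ : ℝ, ((|ξ| ^ (p - 1) : ℝ) : ℂ) * (ek γ (T x) x ξ * (starRingEnd ℂ) (ek γ (T y) y ξ)) := by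
      rw [← integral_const_mul]
      congr 1
      ext ξ
      simp only [hΦ, hh, map_mul]
      ring
    rw [ENNReal.ofReal_rpow_of_pos hxy0, ← ENNReal.ofReal_mul hC0.le, ← ofReal_norm]
    apply ENNReal.ofReal_le_ofReal
    rw [e2, norm_mul, norm_mul, RCLike.norm_conj]
    have hwx := hw1 x
    have hwy := hw1 y
    have : ‖w x‖ * ‖w y‖ ≤ 1 := by
      nlinarith [norm_nonneg (w x), norm_nonneg (w y)]
    calc _ ≤ 1 * _ := mul_le_mul_of_nonneg_right this (norm_nonneg _)
      _ ≤ _ := by rw [one_mul]; exact hk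

lemma lin_bound (γ s δ : ℝ) (hγ : 0 < γ) (hs : 0 < s) (hs2 : s < 1 / 2) (hδ : 0 < δ)
    (μ : Measure ℝ) [IsFiniteMeasure μ] (hμ : ∀ᵐ x ∂μ, |x| < 1)
    (T : ℝ → ℝ) (hT : Measurable T) (hTδ : ∀ x, δ ≤ T x)
    (g : ℝ → ℂ) (hg : StronglyMeasurable g)
    (hint : Integrable (fun ξ : ℝ => (1 + ξ ^ 2) ^ s * ‖g ξ‖ ^ 2) volume) :
    ∫⁻ x, ‖∫ ξ, g ξ * ek γ (T x) x ξ‖ₑ ∂μ ≤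
      ENNReal.ofReal ((2 * (1 / (1 - 2 * s) + 2) * 2 ^ (max (1 - 2 * s) (γ * (1 - 2 * s)))) ^ (1 / 2 : ℝ)
        * (∫ ξ : ℝ, (1 + ξ ^ 2) ^ s * ‖g ξ‖ ^ 2) ^ (1 / 2 : ℝ)) *
        (energy (max (1 - 2 * s) (γ * (1 - 2 * s))) μ) ^ (1 / 2 : ℝ) := by
  have hem : Measurable fun q : ℝ × ℝ => ek γ (T q.1) q.1 q.2 :=
    ek_meas γ T hT
  have hgem : Measurable fun q : ℝ × ℝ => g q.2 * ek γ (T q.1) q.1 q.2 :=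
    (hg.measurable.comp measurable_snd).mul hem
  set F : ℝ → ℂ := fun x => ∫ ξ, g ξ * ek γ (T x) x ξ with hF
  have hFm : Measurable F :=
    (StronglyMeasurable.integral_prod_right (f := fun x ξ => g ξ * ek γ (T x) x ξ)
      hgem.stronglyMeasurable).measurable
  set w : ℝ → ℂ := fun x => (starRingEnd ℂ) (F x) / (‖F x‖ : ℂ) with hw
  have hwm : Measurable w := by
    have m1 : Measurable fun x => (starRingEnd ℂ) (F x) :=
      Complex.continuous_conj.measurable.comp hFm
    exact m1.div (Complex.measurable_ofReal.comp hFm.norm)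
  have hw1 : ∀ x, ‖w x‖ ≤ 1 := by
    intro x
    simp only [hw, norm_div, RCLike.norm_conj, Complex.norm_real, norm_norm]
    exact div_self_le_one _
  have hwF : ∀ x, w x * F x = (‖F x‖ : ℂ) := by
    intro x
    simp only [hw]
    by_cases h0 : F x = 0
    · simp [h0]
    · have : (‖F x‖ : ℂ) ≠ 0 := by simpa using h0
      rw [div_mul_eq_mul_div, mul_comm, Complex.mul_conj, Complex.normSq_eq_norm_sq]
      field_simp
      push_cast
      ring
  set G : ℝ → ℂ := fun ξ => ∫ x, w x * ek γ (T x) x ξ ∂μ with hG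
  set Ψ : ℝ → ℝ → ℂ := fun x ξ => w x * (g ξ * ek γ (T x) x ξ) with hΨ
  have hΨm : Measurable (Function.uncurry Ψ) := (hwm.comp measurable_fst).mul hgem
  have hΨi : Integrable (Function.uncurry Ψ) (μ.prod volume) := by
    have h0 : Integrable (fun _ : ℝ => (1:ℝ)) μ := integrable_const _
    refine (h0.mul_prod (gexp_int γ s δ hs hδ g hg.aestronglyMeasurable hint)).mono'
      hΨm.aestronglyMeasurable ?_
    refine Filter.Eventually.of_forall fun q => ?_
    simp only [Function.uncurry, hΨ, norm_mul]
    have b1 := ek_le γ δ (T q.1) q.1 q.2 hγ hδ (hTδ q.1)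
    have b2 := hw1 q.1
    gcongr
  have hGm : Measurable G := by
    have : Measurable fun q : ℝ × ℝ => w q.2 * ek γ (T q.2) q.2 q.1 :=
      (hwm.comp measurable_snd).mul (ek_meas_swap γ T hT)
    exact (StronglyMeasurable.integral_prod_right (ν := μ)
      (f := fun ξ x => w x * ek γ (T x) x ξ) this.stronglyMeasurable).measurable
  have hinner : ∀ x, ∫ ξ, Ψ x ξ = (‖F x‖ : ℂ) := by
    intro x
    simp only [hΨ]
    rw [integral_const_mul]
    exact hwF x
  have hFi : Integrable (fun x => ‖F x‖) μ := by
    have := hΨi.integral_prod_left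
    simp only [Function.uncurry] at this
    simp_rw [hinner] at this
    exact this.re
  have hswap : ((∫ x, ‖F x‖ ∂μ : ℝ) : ℂ) = ∫ ξ, g ξ * G ξ := by
    have := integral_integral_swap hΨi
    simp_rw [hinner] at this
    refine (integral_ofReal (𝕜 := ℂ)).symm.trans (this.trans ?_)
    congr 1
    ext ξ
    simp only [hΨ, hG]
    rw [← integral_const_mul]
    congr 1
    ext x
    ring
  have e1 : ∫⁻ x, ‖F x‖ₑ ∂μ = ‖∫ ξ, g ξ * G ξ‖ₑ := by
    rw [← hswap, ← ofReal_norm, Complex.norm_real,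
      Real.norm_of_nonneg (integral_nonneg fun _ => norm_nonneg _),
      ofReal_integral_eq_lintegral_ofReal hFi (Filter.Eventually.of_forall fun _ => norm_nonneg _)]
    simp_rw [ofReal_norm]
  rw [e1]
  set a : ℝ → ENNReal := fun ξ => ENNReal.ofReal ((1 + ξ ^ 2) ^ (s / 2) * ‖g ξ‖) with ha
  set b : ℝ → ENNReal := fun ξ => ENNReal.ofReal (|ξ| ^ (-s) * ‖G ξ‖) with hb
  have ham : Measurable a := by
    have := hg.measurable.norm
    exact ((by fun_prop : Measurable fun ξ : ℝ => (1 + ξ ^ 2) ^ (s / 2)).mul this).ennreal_ofReal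
  have hbm : Measurable b :=
    ((by fun_prop : Measurable fun ξ : ℝ => |ξ| ^ (-s)).mul hGm.norm).ennreal_ofReal
  have step1 : ‖∫ ξ, g ξ * G ξ‖ₑ ≤ ∫⁻ ξ, (a * b) ξ := by
    refine (enorm_integral_le_lintegral_enorm _).trans ?_
    refine lintegral_mono_ae ?_
    have hne : ∀ᵐ ξ : ℝ, ξ ≠ 0 := by
      simp [ae_iff]
    filter_upwards [hne] with ξ hξ
    simp only [Pi.mul_apply, ha, hb]
    rw [← ENNReal.ofReal_mul (by positivity), ← ofReal_norm]
    apply ENNReal.ofReal_le_ofReal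
    rw [norm_mul]
    have hξ0 : 0 < |ξ| := abs_pos.2 hξ
    have k1 : |ξ| ^ s ≤ (1 + ξ ^ 2) ^ (s / 2) := by
      have : |ξ| ^ s = (ξ ^ 2) ^ (s / 2) := by
        rw [← sq_abs, ← Real.rpow_natCast, ← Real.rpow_mul hξ0.le]
        congr 1; push_cast; ring
      rw [this]
      exact Real.rpow_le_rpow (sq_nonneg _) (by linarith) (by linarith)
    have k2 : 1 ≤ (1 + ξ ^ 2) ^ (s / 2) * |ξ| ^ (-s) := by
      calc (1:ℝ) = |ξ| ^ s * |ξ| ^ (-s) := by rw [← Real.rpow_add hξ0]; simp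
        _ ≤ _ := by gcongr
    calc ‖g ξ‖ * ‖G ξ‖ = 1 * (‖g ξ‖ * ‖G ξ‖) := by ring
      _ ≤ ((1 + ξ ^ 2) ^ (s / 2) * |ξ| ^ (-s)) * (‖g ξ‖ * ‖G ξ‖) := by gcongr
      _ = _ := by ring
  have step2 := ENNReal.lintegral_mul_le_Lp_mul_Lq volume Real.HolderConjugate.two_two
    ham.aemeasurable hbm.aemeasurable
  have ea : ∫⁻ ξ, a ξ ^ (2:ℝ) = ENNReal.ofReal (∫ ξ : ℝ, (1 + ξ ^ 2) ^ s * ‖g ξ‖ ^ 2) := by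
    rw [ofReal_integral_eq_lintegral_ofReal hint
      (Filter.Eventually.of_forall fun ξ => by positivity)]
    congr 1
    ext ξ
    simp only [ha]
    rw [ENNReal.ofReal_rpow_of_nonneg (by positivity) (by norm_num),
      Real.mul_rpow (by positivity) (norm_nonneg _), ← Real.rpow_mul (by positivity)]
    congr 2
    · congr 1; ring
    · norm_num
  have eb : ∫⁻ ξ, b ξ ^ (2:ℝ) = ∫⁻ ξ : ℝ, ENNReal.ofReal (|ξ| ^ (-(2 * s)) * ‖G ξ‖ ^ 2) := by
    congr 1
    ext ξ
    simp only [hb]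
    rw [ENNReal.ofReal_rpow_of_nonneg (by positivity) (by norm_num),
      Real.mul_rpow (by positivity) (norm_nonneg _), ← Real.rpow_mul (by positivity)]
    congr 2
    · congr 1; ring
    · norm_num
  have step3 := dual_bound γ s δ hγ hs hs2 hδ μ hμ T hT hTδ w hwm hw1
  rw [ea, eb] at step2
  refine (step1.trans step2).trans ?_
  have hp0 : 0 < 1 - 2 * s := by linarith
  set N := ∫ ξ : ℝ, (1 + ξ ^ 2) ^ s * ‖g ξ‖ ^ 2 with hN
  have hN0 : 0 ≤ N := integral_nonneg fun ξ => by positivity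
  set C₀ := 2 * (1 / (1 - 2 * s) + 2) * (2:ℝ) ^ (max (1 - 2 * s) (γ * (1 - 2 * s))) with hC
  have hC0 : 0 < C₀ := by positivity
  calc _ ≤ ENNReal.ofReal N ^ (1 / 2 : ℝ) * (ENNReal.ofReal C₀ *
        energy (max (1 - 2 * s) (γ * (1 - 2 * s))) μ) ^ (1 / 2 : ℝ) := by gcongr
    _ = _ := by
      rw [ENNReal.mul_rpow_of_nonneg _ _ (by norm_num),
        ENNReal.ofReal_rpow_of_nonneg hN0 (by norm_num),
        ENNReal.ofReal_rpow_of_nonneg hC0.le (by norm_num), ← mul_assoc,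
        ← ENNReal.ofReal_mul (by positivity), mul_comm (N ^ (1 / 2 : ℝ))]

lemma Q_meas (γ : ℝ) (T : ℝ → ℝ) (hT : Measurable T) (g : ℝ → ℂ) (hg : StronglyMeasurable g) :
    Measurable fun x => ∫ ξ, g ξ * ek γ (T x) x ξ := by
  have hgem : Measurable fun q : ℝ × ℝ => g q.2 * ek γ (T q.1) q.1 q.2 :=
    (hg.measurable.comp measurable_snd).mul (ek_meas γ T hT)
  exact (StronglyMeasurable.integral_prod_right (f := fun x ξ => g ξ * ek γ (T x) x ξ)
      hgem.stronglyMeasurable).measurable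

lemma Q_cont (γ s : ℝ) (hγ : 0 < γ) (hs : 0 < s) (g : ℝ → ℂ) (hg : StronglyMeasurable g)
    (hint : Integrable (fun ξ : ℝ => (1 + ξ ^ 2) ^ s * ‖g ξ‖ ^ 2) volume) (x t₀ : ℝ) (ht : 0 < t₀) :
    ContinuousAt (fun t => ∫ ξ, g ξ * ek γ t x ξ) t₀ := by
  refine continuousAt_of_dominated (bound := fun ξ => ‖g ξ‖ * Real.exp (-((t₀ / 2) ^ γ) * |ξ|))
    ?_ ?_ (gexp_int γ s (t₀ / 2) hs (by positivity) g hg.aestronglyMeasurable hint) ?_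
  · refine Filter.Eventually.of_forall fun t => ?_
    exact (hg.measurable.mul (ek_meas_right γ t x)).aestronglyMeasurable
  · filter_upwards [lt_mem_nhds (half_lt_self ht)] with t ht2
    refine Filter.Eventually.of_forall fun ξ => ?_
    rw [norm_mul]
    have := ek_le γ (t₀ / 2) t x ξ hγ (by positivity) ht2.le
    gcongr
  · refine Filter.Eventually.of_forall fun ξ => ?_
    exact (continuous_const.mul (ek_cont γ x ξ hγ)).continuousAt

lemma exists_T (γ : ℝ) (g : ℝ → ℂ) (hg : StronglyMeasurable g)
    (τ : ℕ → ℝ) (hτ : ∀ n, 0 < τ n) (n : ℕ) :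
    ∃ (T : ℝ → ℝ) (δ : ℝ), Measurable T ∧ 0 < δ ∧ (∀ x, δ ≤ T x) ∧
      ∀ k ≤ n, ∀ x, ‖∫ ξ, g ξ * ek γ (τ k) x ξ‖ ≤ ‖∫ ξ, g ξ * ek γ (T x) x ξ‖ := by
  induction n with
  | zero =>
    refine ⟨fun _ => τ 0, τ 0, measurable_const, hτ 0, fun _ => le_rfl, ?_⟩
    intro k hk x
    obtain rfl : k = 0 := by omega
    exact le_rfl
  | succ n ih =>
    obtain ⟨T, δ, hT, hδ, hTδ, h⟩ := ih
    have m1 := (Q_meas γ T hT g hg).norm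
    have m2 := (Q_meas γ (fun _ => τ (n + 1)) measurable_const g hg).norm
    classical
    refine ⟨fun x => if ‖∫ ξ, g ξ * ek γ (T x) x ξ‖ < ‖∫ ξ, g ξ * ek γ (τ (n + 1)) x ξ‖
      then τ (n + 1) else T x, min δ (τ (n + 1)),
      Measurable.ite (measurableSet_lt m1 m2) measurable_const hT, lt_min hδ (hτ _), ?_, ?_⟩
    · intro x
      dsimp only
      split_ifs
      · exact min_le_right _ _
      · exact (min_le_left _ _).trans (hTδ x)
    · intro k hk x
      dsimp only
      rcases Nat.lt_or_ge n k with hk2 | hk2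
      · obtain rfl : k = n + 1 := by omega
        split_ifs with hc
        · exact le_rfl
        · exact not_lt.1 hc
      · have := h k hk2 x
        split_ifs with hc
        · exact this.trans hc.le
        · exact this

lemma sup_bound (γ s : ℝ) (hγ : 0 < γ) (hs : 0 < s) (hs2 : s < 1 / 2)
    (μ : Measure ℝ) [IsFiniteMeasure μ] (hμ : ∀ᵐ x ∂μ, |x| < 1)
    (g : ℝ → ℂ) (hg : StronglyMeasurable g)
    (hint : Integrable (fun ξ : ℝ => (1 + ξ ^ 2) ^ s * ‖g ξ‖ ^ 2) volume) :
    ∫⁻ x, ENNReal.ofReal (Pstar 1 γ g x) ∂μ ≤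
      ENNReal.ofReal ((2 * (1 / (1 - 2 * s) + 2) * 2 ^ (max (1 - 2 * s) (γ * (1 - 2 * s)))) ^ (1 / 2 : ℝ)
        * (∫ ξ : ℝ, (1 + ξ ^ 2) ^ s * ‖g ξ‖ ^ 2) ^ (1 / 2 : ℝ)) *
        (energy (max (1 - 2 * s) (γ * (1 - 2 * s))) μ) ^ (1 / 2 : ℝ) := by
  haveI : Nonempty (Set.Ioo (0:ℝ) 1) := ⟨⟨1 / 2, by norm_num, by norm_num⟩⟩
  set τ : ℕ → Set.Ioo (0:ℝ) 1 := TopologicalSpace.denseSeq (Set.Ioo (0:ℝ) 1) with hτ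
  have hdense : DenseRange τ := TopologicalSpace.denseRange_denseSeq _
  set q : ℕ → ℝ → ENNReal := fun k x => ‖∫ ξ, g ξ * ek γ (τ k) x ξ‖ₑ with hq
  have hqm : ∀ k, Measurable (q k) := fun k =>
    (Q_meas γ (fun _ => τ k) measurable_const g hg).enorm
  have h1 : ∀ x, ENNReal.ofReal (Pstar 1 γ g x) ≤ ⨆ n, ⨆ k, ⨆ (_ : k ≤ n), q k x := by
    intro x
    set S := ⨆ n, ⨆ k, ⨆ (_ : k ≤ n), q k x with hS
    have hqS : ∀ k, q k x ≤ S := fun k =>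
      (le_iSup₂ (f := fun j (_ : j ≤ k) => q j x) k le_rfl).trans
        (le_iSup (fun n => ⨆ j, ⨆ (_ : j ≤ n), q j x) k)
    have hall : ∀ t : Set.Ioo (0:ℝ) 1, ‖∫ ξ, g ξ * ek γ t x ξ‖ₑ ≤ S := by
      intro t
      refine hdense.induction_on (p := fun t : Set.Ioo (0:ℝ) 1 =>
        ‖∫ ξ, g ξ * ek γ t x ξ‖ₑ ≤ S) t ?_ hqS
      refine isClosed_le ?_ continuous_const
      refine Continuous.enorm ?_
      rw [continuous_iff_continuousAt]
      intro t
      exact ContinuousAt.comp (f := fun t : Set.Ioo (0:ℝ) 1 => (t : ℝ))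
        (g := fun t : ℝ => ∫ ξ, g ξ * ek γ t x ξ)
        (Q_cont γ s hγ hs g hg hint x t t.2.1) continuous_subtype_val.continuousAt
    by_cases hST : S = ⊤
    · rw [hST]; exact le_top
    · refine ENNReal.ofReal_le_of_le_toReal ?_
      unfold Pstar
      refine ciSup_le fun t => ?_
      rw [ek_Pop, ← ENNReal.ofReal_le_iff_le_toReal hST, ofReal_norm]
      exact hall t
  refine (lintegral_mono h1).trans ?_
  rw [lintegral_iSup (fun n => Measurable.iSup fun k => Measurable.iSup fun _ => hqm k)]
  · refine iSup_le fun n => ?_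
    obtain ⟨T, δ, hT, hδ, hTδ, h⟩ := exists_T γ g hg (fun n => (τ n : ℝ)) (fun n => (τ n).2.1) n
    refine le_trans (lintegral_mono fun x => ?_)
      (lin_bound γ s δ hγ hs hs2 hδ μ hμ T hT hTδ g hg hint)
    refine iSup₂_le fun k hk => ?_
    rw [← ofReal_norm, hq]
    dsimp only
    rw [← ofReal_norm]
    exact ENNReal.ofReal_le_ofReal (h k hk x)
  · intro n m hnm x
    exact biSup_mono fun k hk => le_trans hk hnm

theorem maximal_energy_estimate_wave (γ s : ℝ) (hγ : 0 < γ)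
    (hs1 : max (1 / 2 * (1 - 1 / γ)) 0 < s) (hs2 : s < 1 / 2) :
    ∃ C : ℝ, 0 < C ∧ ∀ μ : Measure ℝ, IsFiniteMeasure μ →
      (∃ K : Set ℝ, IsCompact K ∧ K ⊆ Metric.ball (0 : ℝ) 1 ∧ μ Kᶜ = 0) →
      energy (max (1 - 2 * s) (γ * (1 - 2 * s))) μ < ⊤ →
      ∀ fhat : ℝ → ℂ,
        Integrable (fun ξ : ℝ => (1 + ξ ^ 2) ^ s * ‖fhat ξ‖ ^ 2) volume →
        ∫⁻ x : ℝ, ENNReal.ofReal (Pstar 1 γ fhat x) ∂μ ≤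
          ENNReal.ofReal (C * (∫ ξ : ℝ, (1 + ξ ^ 2) ^ s * ‖fhat ξ‖ ^ 2) ^ (1 / 2 : ℝ)) *
            (energy (max (1 - 2 * s) (γ * (1 - 2 * s))) μ) ^ (1 / 2 : ℝ) := by
  have hs0 : 0 < s := (le_max_right _ _).trans_lt hs1
  have hp0 : 0 < 1 - 2 * s := by linarith
  refine ⟨(2 * (1 / (1 - 2 * s) + 2) * 2 ^ (max (1 - 2 * s) (γ * (1 - 2 * s)))) ^ (1 / 2 : ℝ),
    by positivity, ?_⟩
  intro μ hfin hK _ fhat hint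
  obtain ⟨K, -, hKb, hK0⟩ := hK
  have hμ : ∀ᵐ x ∂μ, |x| < 1 := by
    have : ∀ᵐ x ∂μ, x ∈ K := by
      rw [ae_iff]; exact hK0
    filter_upwards [this] with x hx
    simpa using hKb hx
  by_cases hf : AEStronglyMeasurable fhat volume
  · have hae := hf.ae_eq_mk
    have e1 : Pstar 1 γ fhat = Pstar 1 γ (hf.mk fhat) := by
      ext x
      unfold Pstar
      congr 1
      ext t
      rw [ek_Pop, ek_Pop]
      congr 1
      refine integral_congr_ae ?_
      filter_upwards [hae] with ξ hξ
      rw [hξ]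
    have e2 : (fun ξ : ℝ => (1 + ξ ^ 2) ^ s * ‖fhat ξ‖ ^ 2)
        =ᵐ[volume] fun ξ : ℝ => (1 + ξ ^ 2) ^ s * ‖hf.mk fhat ξ‖ ^ 2 := by
      filter_upwards [hae] with ξ hξ
      rw [hξ]
    rw [e1, integral_congr_ae e2]
    exact sup_bound γ s hγ hs0 hs2 μ hμ _ hf.stronglyMeasurable_mk (hint.congr e2)
  · have hz : ∀ x, Pstar 1 γ fhat x = 0 := by
      intro x
      unfold Pstar
      have : ∀ t : Set.Ioo (0:ℝ) 1, ‖Pop 1 γ fhat t x‖ = 0 := by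
        intro t
        rw [ek_Pop, integral_undef, norm_zero]
        intro hi
        apply hf
        have h2 := hi.aestronglyMeasurable.mul
          (ek_meas_right γ t x).inv.aestronglyMeasurable
        refine h2.congr (Filter.Eventually.of_forall fun ξ => ?_)
        have hne : ek γ t x ξ ≠ 0 := by
          rw [← norm_pos_iff, ek_norm]
          exact Real.exp_pos _
        simp [mul_assoc, hne]
      simp [this]
    simp [hz]
end

section
/- Let a > 0, γ > 0, and let g, h : (0,1) → [0,∞) with h(t) ≤ g(t) for all t ∈ (0,1). Then ‖sup_{0<t<1} |e^{i(t+ig(t))(-Δ)^{a/2}} f|‖_{L²(ℝ)} ≲ ‖sup_{0<t<1} |e^{i(t+ih(t))(-Δ)^{a/2}} f|‖_{L²(ℝ)} for all Schwartz f; in particular ‖sup_{0<t<1} |e^{i(t+it^γ)(-Δ)^{a/2}} f|‖_{L²(ℝ)} ≲ ‖sup_{0<t<1} |e^{it(-Δ)^{a/2}} f|‖_{L²(ℝ)}. -/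
open MeasureTheory

/-- The evolution `e^{i(t + i g(t))(-Δ)^{a/2}}` applied to a function with
Fourier transform `fhat`. -/
noncomputable def Eop (a : ℝ) (g : ℝ → ℝ) (fhat : ℝ → ℂ) (t x : ℝ) : ℂ :=
  ∫ ξ : ℝ, fhat ξ *
    Complex.exp (Complex.I * ((t * |ξ| ^ a : ℝ) : ℂ) - ((g t * |ξ| ^ a : ℝ) : ℂ)) *
    Complex.exp (Complex.I * ((x * ξ : ℝ) : ℂ))

open scoped FourierTransform


/-- uncentered maximal function -/
noncomputable def maxFn (f : ℝ → ENNReal) (x : ℝ) : ENNReal :=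
  ⨆ (p : ℝ × ℝ) (_ : 0 < p.2 ∧ x ∈ Metric.ball p.1 p.2),
    (∫⁻ y in Metric.ball p.1 p.2, f y) / ENNReal.ofReal (2 * p.2)

lemma ball_le_maxFn (f : ℝ → ENNReal) (x r : ℝ) (hr : 0 < r) :
    ∫⁻ y in Metric.ball x r, f y ≤ ENNReal.ofReal (2 * r) * maxFn f x := by
  have h : (∫⁻ y in Metric.ball x r, f y) / ENNReal.ofReal (2 * r) ≤ maxFn f x :=
    le_iSup₂_of_le (f := fun (p : ℝ × ℝ) (_ : 0 < p.2 ∧ x ∈ Metric.ball p.1 p.2) =>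
      (∫⁻ y in Metric.ball p.1 p.2, f y) / ENNReal.ofReal (2 * p.2)) (x, r)
      ⟨hr, Metric.mem_ball_self hr⟩ le_rfl
  rw [mul_comm]
  exact (ENNReal.div_le_iff (by simpa using hr) ENNReal.ofReal_ne_top).1 h

lemma lt_maxFn_set (f : ℝ → ENNReal) (l : ENNReal) :
    {x | l < maxFn f x} = ⋃ p ∈ {p : ℝ × ℝ | 0 < p.2 ∧
      l * ENNReal.ofReal (2 * p.2) < ∫⁻ y in Metric.ball p.1 p.2, f y}, Metric.ball p.1 p.2 := by
  ext x
  simp only [maxFn, Set.mem_ofPred_eq, lt_iSup_iff, Set.mem_iUnion, exists_prop]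
  constructor
  · rintro ⟨p, ⟨h1, h2⟩, h3⟩
    exact ⟨p, ⟨h1, (ENNReal.lt_div_iff_mul_lt (Or.inl (by simpa using h1))
      (Or.inl ENNReal.ofReal_ne_top)).1 h3⟩, h2⟩
  · rintro ⟨p, ⟨h1, h3⟩, h2⟩
    exact ⟨p, ⟨h1, h2⟩, (ENNReal.lt_div_iff_mul_lt (Or.inl (by simpa using h1))
      (Or.inl ENNReal.ofReal_ne_top)).2 h3⟩

lemma measurable_maxFn (f : ℝ → ENNReal) : Measurable (maxFn f) := by
  apply measurable_of_Ioi
  intro l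
  change MeasurableSet {x | l < maxFn f x}
  rw [lt_maxFn_set]
  exact (isOpen_biUnion fun p _ => Metric.isOpen_ball).measurableSet

lemma maxFn_weak (f : ℝ → ENNReal) (hf : ∫⁻ x, f x ≠ ⊤)
    (l : ENNReal) (hl : l ≠ 0) (hl' : l ≠ ⊤) :
    l * volume {x | l < maxFn f x} ≤ 4 * ∫⁻ x, f x := by
  rw [lt_maxFn_set]
  set t := {p : ℝ × ℝ | 0 < p.2 ∧
      l * ENNReal.ofReal (2 * p.2) < ∫⁻ y in Metric.ball p.1 p.2, f y} with ht
  have hb : ∀ p ∈ t, p.2 ≤ ((∫⁻ x, f x) / l).toReal := by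
    rintro p ⟨h1, h2⟩
    have h3 : ENNReal.ofReal (2 * p.2) ≤ (∫⁻ x, f x) / l := by
      rw [ENNReal.le_div_iff_mul_le (Or.inl hl) (Or.inl hl'), mul_comm]
      exact h2.le.trans (setLIntegral_le_lintegral _ _)
    have h4 := ENNReal.toReal_mono (ENNReal.div_ne_top hf hl) h3
    rw [ENNReal.toReal_ofReal (by linarith)] at h4
    linarith
  obtain ⟨u, hut, hdisj, hcov⟩ := Vitali.exists_disjoint_subfamily_covering_enlargement_ball t
    (fun p => p.1) (fun p => p.2) _ hb 4 (by norm_num)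
  have hcount : u.Countable := by
    apply hdisj.countable_of_isOpen (fun p _ => Metric.isOpen_ball)
    intro p hp
    exact ⟨p.1, Metric.mem_ball_self (hut hp).1⟩
  have hsub : (⋃ p ∈ t, Metric.ball p.1 p.2) ⊆ ⋃ p ∈ u, Metric.ball p.1 (4 * p.2) := by
    refine Set.iUnion₂_subset fun p hp => ?_
    obtain ⟨b, hb, h⟩ := hcov p hp
    exact h.trans (Set.subset_biUnion_of_mem (u := fun p : ℝ × ℝ => Metric.ball p.1 (4 * p.2)) hb)
  have := hcount.to_subtype
  calc l * volume (⋃ p ∈ t, Metric.ball p.1 p.2)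
      ≤ l * ∑' p : u, volume (Metric.ball p.1.1 (4 * p.1.2)) := by
        gcongr
        exact (measure_mono hsub).trans (measure_biUnion_le _ hcount _)
    _ = ∑' p : u, l * volume (Metric.ball p.1.1 (4 * p.1.2)) := ENNReal.tsum_mul_left.symm
    _ ≤ ∑' p : u, 4 * ∫⁻ y in Metric.ball p.1.1 p.1.2, f y := by
        refine ENNReal.tsum_le_tsum fun p => ?_
        have h := (hut p.2).2.le
        rw [Real.volume_ball]
        have : ENNReal.ofReal (2 * (4 * p.1.2)) = 4 * ENNReal.ofReal (2 * p.1.2) := by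
          rw [show (2 * (4 * p.1.2)) = 4 * (2 * p.1.2) by ring, ENNReal.ofReal_mul (by norm_num)]
          norm_num
        rw [this, mul_left_comm]
        gcongr
    _ = 4 * ∑' p : u, ∫⁻ y in Metric.ball p.1.1 p.1.2, f y := ENNReal.tsum_mul_left
    _ = 4 * ∫⁻ y in ⋃ p ∈ u, Metric.ball p.1 p.2, f y := by
        rw [lintegral_biUnion hcount (fun p _ => Metric.isOpen_ball.measurableSet) hdisj]
    _ ≤ 4 * ∫⁻ x, f x := by
        gcongr
        exact Measure.restrict_le_self

lemma maxFn_le (f : ℝ → ENNReal) (B : ENNReal) (hB : ∀ x, f x ≤ B) (x : ℝ) : maxFn f x ≤ B := by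
  refine iSup₂_le fun p hp => ?_
  rw [ENNReal.div_le_iff (by simpa using hp.1) ENNReal.ofReal_ne_top, ← Real.volume_ball p.1 p.2,
    ← setLIntegral_const]
  exact lintegral_mono fun y => hB y

lemma maxFn_L2 (f : ℝ → ENNReal) (hf : Measurable f) (B : ENNReal) (hB' : B ≠ ⊤)
    (hB : ∀ x, f x ≤ B) :
    ∫⁻ x, (maxFn f x) ^ 2 ≤ 32 * ∫⁻ x, (f x) ^ 2 := by
  by_cases htop : ∫⁻ x, (f x) ^ 2 = ⊤
  · rw [htop]; simp
  have hfin : ∀ x, maxFn f x ≠ ⊤ := fun x => ne_top_of_le_ne_top hB' (maxFn_le f B hB x)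
  have hffin : ∀ x, f x ≠ ⊤ := fun x => ne_top_of_le_ne_top hB' (hB x)
  have key : ∀ t : ℝ, 0 < t → volume {x | t < (maxFn f x).toReal} * ENNReal.ofReal t ≤
      8 * ∫⁻ x, {x | ENNReal.ofReal t < 2 * f x}.indicator f x := by
    intro t ht
    set f1 := {x | ENNReal.ofReal t < 2 * f x}.indicator f with hf1
    have ht2 : ENNReal.ofReal t = 2 * ENNReal.ofReal (t / 2) := by
      rw [show t = 2 * (t / 2) by ring, ENNReal.ofReal_mul (by norm_num)]
      norm_num
    have hms : MeasurableSet {x | ENNReal.ofReal t < 2 * f x} :=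
      measurableSet_lt measurable_const (by fun_prop)
    have hf1m : Measurable f1 := hf.indicator hms
    have hle : ∀ x, f x ≤ f1 x + ENNReal.ofReal (t / 2) := by
      intro x
      by_cases hx : ENNReal.ofReal t < 2 * f x
      · simp [hf1, Set.indicator, hx]
      · have hx' := not_lt.1 hx
        rw [ht2] at hx'
        refine le_add_left ?_
        exact (ENNReal.mul_le_mul_iff_right (by norm_num) (by norm_num)).1 hx'
    have hsub : {x | t < (maxFn f x).toReal} ⊆ {x | ENNReal.ofReal (t / 2) < maxFn f1 x} := by
      intro x hx
      have hx : t < (maxFn f x).toReal := hx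
      by_contra hcon
      have hcon : maxFn f1 x ≤ ENNReal.ofReal (t / 2) := not_lt.1 hcon
      have : maxFn f x ≤ ENNReal.ofReal t := by
        refine iSup₂_le fun p hp => ?_
        rw [ENNReal.div_le_iff (by simpa using hp.1) ENNReal.ofReal_ne_top]
        have h1 : (∫⁻ y in Metric.ball p.1 p.2, f1 y) ≤
            ENNReal.ofReal (t / 2) * ENNReal.ofReal (2 * p.2) := by
          refine (ENNReal.div_le_iff (by simpa using hp.1) ENNReal.ofReal_ne_top).1
            (le_trans ?_ hcon)
          exact le_iSup₂_of_le (f := fun (p : ℝ × ℝ) (_ : 0 < p.2 ∧ x ∈ Metric.ball p.1 p.2) =>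
            (∫⁻ y in Metric.ball p.1 p.2, f1 y) / ENNReal.ofReal (2 * p.2)) p hp le_rfl
        calc ∫⁻ y in Metric.ball p.1 p.2, f y
            ≤ ∫⁻ y in Metric.ball p.1 p.2, (f1 y + ENNReal.ofReal (t / 2)) :=
              lintegral_mono fun y => hle y
          _ = (∫⁻ y in Metric.ball p.1 p.2, f1 y) +
              ENNReal.ofReal (t / 2) * ENNReal.ofReal (2 * p.2) := by
              rw [lintegral_add_left hf1m, setLIntegral_const, Real.volume_ball]
          _ ≤ _ := by
              rw [ht2, two_mul (ENNReal.ofReal (t / 2)), add_mul]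
              gcongr
      have h2 := ENNReal.toReal_mono ENNReal.ofReal_ne_top this
      rw [ENNReal.toReal_ofReal ht.le] at h2
      linarith
    have hf1fin : ∫⁻ x, f1 x ≠ ⊤ := by
      have : ∀ x, f1 x ≤ (2 / ENNReal.ofReal t) * f x ^ 2 := by
        intro x
        by_cases hx : ENNReal.ofReal t < 2 * f x
        · have : f1 x = f x := by simp [hf1, Set.indicator, hx]
          rw [this]
          have h0 : ENNReal.ofReal t ≠ 0 := by simpa using ht
          have : 1 ≤ (2 / ENNReal.ofReal t) * f x := by
            rw [div_eq_mul_inv, mul_right_comm, ← div_eq_mul_inv,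
              ENNReal.le_div_iff_mul_le (Or.inl h0) (Or.inl ENNReal.ofReal_ne_top), one_mul]
            exact hx.le
          calc f x = 1 * f x := (one_mul _).symm
            _ ≤ (2 / ENNReal.ofReal t) * f x * f x := by gcongr
            _ = _ := by ring
        · simp [hf1, Set.indicator, hx]
      refine ne_top_of_le_ne_top ?_ (lintegral_mono this)
      rw [lintegral_const_mul _ (by fun_prop)]
      exact ENNReal.mul_ne_top (ENNReal.div_ne_top (by norm_num) (by simpa using ht)) htop
    calc volume {x | t < (maxFn f x).toReal} * ENNReal.ofReal t
        ≤ volume {x | ENNReal.ofReal (t / 2) < maxFn f1 x} * (2 * ENNReal.ofReal (t / 2)) := by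
          rw [ht2]
          gcongr
      _ = 2 * (ENNReal.ofReal (t / 2) * volume {x | ENNReal.ofReal (t / 2) < maxFn f1 x}) := by
          ring
      _ ≤ 2 * (4 * ∫⁻ x, f1 x) := by
          refine mul_le_mul_right ?_ _
          exact maxFn_weak f1 hf1fin _ (by simpa using ht) ENNReal.ofReal_ne_top
      _ = 8 * ∫⁻ x, f1 x := by ring
  have hlc := lintegral_rpow_eq_lintegral_meas_lt_mul volume (f := fun x => (maxFn f x).toReal)
    (Filter.Eventually.of_forall fun x => ENNReal.toReal_nonneg)
    (measurable_maxFn f).ennreal_toReal.aemeasurable (p := 2) (by norm_num)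
  have e1 : ∀ x, ENNReal.ofReal ((maxFn f x).toReal ^ (2 : ℝ)) = maxFn f x ^ 2 := by
    intro x
    rw [Real.rpow_two, ENNReal.ofReal_pow ENNReal.toReal_nonneg, ENNReal.ofReal_toReal (hfin x)]
  simp only [e1] at hlc
  rw [hlc]
  have e2 : ∫⁻ t in Set.Ioi (0:ℝ), volume {x | t < (maxFn f x).toReal} *
      ENNReal.ofReal (t ^ ((2:ℝ) - 1)) ≤ 16 * ∫⁻ x, f x ^ 2 := by
    calc _ ≤ ∫⁻ t in Set.Ioi (0:ℝ), 8 * ∫⁻ x, {x | ENNReal.ofReal t < 2 * f x}.indicator f x := by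
          refine setLIntegral_mono' measurableSet_Ioi fun t ht => ?_
          rw [show ((2:ℝ) - 1) = 1 by norm_num, Real.rpow_one]
          exact key t ht
      _ = 8 * ∫⁻ t in Set.Ioi (0:ℝ), ∫⁻ x, {x | ENNReal.ofReal t < 2 * f x}.indicator f x :=
          lintegral_const_mul' _ _ (by norm_num)
      _ = 8 * ∫⁻ x, ∫⁻ t in Set.Ioi (0:ℝ), {x | ENNReal.ofReal t < 2 * f x}.indicator f x := by
          rw [lintegral_lintegral_swap]
          have hm : Measurable ({z : ℝ × ℝ | ENNReal.ofReal z.1 < 2 * f z.2}.indicator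
              (fun z => f z.2)) := by
            refine Measurable.indicator (by fun_prop) ?_
            exact measurableSet_lt (by fun_prop) (by fun_prop)
          refine hm.aemeasurable.congr (Filter.Eventually.of_forall fun z => ?_)
          simp [Set.indicator, Function.uncurry]
      _ ≤ 8 * ∫⁻ x, 2 * f x ^ 2 := by
          gcongr with x
          calc ∫⁻ t in Set.Ioi (0:ℝ), {x | ENNReal.ofReal t < 2 * f x}.indicator f x
              ≤ ∫⁻ t in Set.Ioi (0:ℝ), (Set.Ioo 0 (2 * (f x).toReal)).indicator
                (fun _ => f x) t := by
                refine setLIntegral_mono' measurableSet_Ioi fun t ht => ?_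
                by_cases hx : ENNReal.ofReal t < 2 * f x
                · have : t < 2 * (f x).toReal := by
                    rw [← ENNReal.ofReal_toReal (hffin x), ← ENNReal.ofReal_ofNat 2,
                      ← ENNReal.ofReal_mul (by norm_num)] at hx
                    exact (ENNReal.ofReal_lt_ofReal_iff_of_nonneg (le_of_lt ht)).1 hx
                  have ht : 0 < t := ht
                  simp [Set.indicator, this, ht, hx]
                · simp [Set.indicator, hx]
            _ ≤ ∫⁻ t, (Set.Ioo 0 (2 * (f x).toReal)).indicator
                (fun _ => f x) t := setLIntegral_le_lintegral _ _
            _ = 2 * f x ^ 2 := by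
                rw [lintegral_indicator measurableSet_Ioo, setLIntegral_const, Real.volume_Ioo,
                  sub_zero, ENNReal.ofReal_mul (by norm_num), ENNReal.ofReal_toReal (hffin x),
                  ENNReal.ofReal_ofNat]
                ring
      _ = 16 * ∫⁻ x, f x ^ 2 := by
          rw [lintegral_const_mul' _ _ (by norm_num), ← mul_assoc]
          norm_num
  calc _ ≤ ENNReal.ofReal 2 * (16 * ∫⁻ x, f x ^ 2) := by gcongr
    _ = 32 * ∫⁻ x, f x ^ 2 := by
      rw [← mul_assoc]; norm_num

/-- triangle function -/
noncomputable def tri (ξ : ℝ) : ℝ := max 0 (1 - |ξ|)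

lemma tri_cont : Continuous tri := by unfold tri; fun_prop
lemma tri_nonneg (ξ : ℝ) : 0 ≤ tri ξ := le_max_left _ _
lemma tri_le_one (ξ : ℝ) : tri ξ ≤ 1 := by
  unfold tri; exact max_le (by norm_num) (by linarith [abs_nonneg ξ])
lemma tri_zero (ξ : ℝ) (h : 1 ≤ |ξ|) : tri ξ = 0 := by
  unfold tri; exact max_eq_left (by linarith)

lemma tri_integrable : Integrable (fun ξ => (tri ξ : ℂ)) := by
  have hc : Continuous (fun ξ => (tri ξ : ℂ)) := Complex.continuous_ofReal.comp tri_cont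
  apply hc.integrable_of_hasCompactSupport
  refine HasCompactSupport.intro (isCompact_Icc (a := (-1:ℝ)) (b := 1)) fun x hx => ?_
  have : 1 ≤ |x| := by
    by_contra hcon
    push Not at hcon
    exact hx ⟨(abs_lt.1 hcon).1.le, (abs_lt.1 hcon).2.le⟩
  simp [tri_zero x this]

lemma half_tri (α : ℂ) (hα : α ≠ 0) :
    ∫ ξ in (0:ℝ)..1, ((1 - ξ : ℝ) : ℂ) * Complex.exp (α * ξ) =
      Complex.exp α / α ^ 2 - 1 / α - 1 / α ^ 2 := by
  have hd : ∀ x ∈ Set.uIcc (0:ℝ) 1, HasDerivAt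
      (fun ξ : ℝ => (1 - (ξ:ℂ)) * Complex.exp (α * ξ) / α + Complex.exp (α * ξ) / α ^ 2)
      (((1 - x : ℝ) : ℂ) * Complex.exp (α * x)) x := by
    intro x _
    have h0 : HasDerivAt (fun ξ : ℝ => (ξ : ℂ)) 1 x := Complex.ofRealCLM.hasDerivAt
    have h1 : HasDerivAt (fun ξ : ℝ => Complex.exp (α * ξ)) (Complex.exp (α * x) * (α * 1)) x :=
      (h0.const_mul α).cexp
    have h2 := (((h0.const_sub 1).mul h1).div_const α).add (h1.div_const (α ^ 2))
    refine h2.congr_deriv ?_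
    push_cast
    field_simp
    ring
  rw [intervalIntegral.integral_eq_sub_of_hasDerivAt hd]
  · simp
    ring
  · apply Continuous.intervalIntegrable
    fun_prop

lemma full_tri (α : ℂ) (hα : α ≠ 0) :
    ∫ ξ : ℝ, (tri ξ : ℂ) * Complex.exp (α * ξ) =
      (Complex.exp α + Complex.exp (-α) - 2) / α ^ 2 := by
  have hsupp : ∫ ξ : ℝ, (tri ξ : ℂ) * Complex.exp (α * ξ) =
      ∫ ξ in (-1:ℝ)..1, (tri ξ : ℂ) * Complex.exp (α * ξ) := by
    rw [intervalIntegral.integral_of_le (by norm_num), ← integral_Icc_eq_integral_Ioc]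
    rw [setIntegral_eq_integral_of_forall_compl_eq_zero]
    intro x hx
    have : 1 ≤ |x| := by
      by_contra hcon
      push Not at hcon
      exact hx ⟨(abs_lt.1 hcon).1.le, (abs_lt.1 hcon).2.le⟩
    simp [tri_zero x this]
  have hc : Continuous fun ξ : ℝ => (tri ξ : ℂ) * Complex.exp (α * ξ) := by
    have := tri_cont
    fun_prop
  rw [hsupp, ← intervalIntegral.integral_add_adjacent_intervals (b := 0)
    (hc.intervalIntegrable _ _) (hc.intervalIntegrable _ _)]
  have e1 : ∫ ξ in (0:ℝ)..1, (tri ξ : ℂ) * Complex.exp (α * ξ) =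
      ∫ ξ in (0:ℝ)..1, ((1 - ξ : ℝ) : ℂ) * Complex.exp (α * ξ) := by
    apply intervalIntegral.integral_congr
    intro x hx
    rw [Set.uIcc_of_le (by norm_num)] at hx
    have : tri x = 1 - x := by
      unfold tri; rw [abs_of_nonneg hx.1]; exact max_eq_right (by linarith [hx.2])
    simp only [this]
  have e2 : ∫ ξ in (-1:ℝ)..0, (tri ξ : ℂ) * Complex.exp (α * ξ) =
      ∫ ξ in (0:ℝ)..1, ((1 - ξ : ℝ) : ℂ) * Complex.exp (-α * ξ) := by
    have := intervalIntegral.integral_comp_neg (a := (0:ℝ)) (b := 1)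
      (fun ξ : ℝ => (tri ξ : ℂ) * Complex.exp (α * ξ))
    rw [neg_zero] at this
    rw [← this]
    apply intervalIntegral.integral_congr
    intro x hx
    rw [Set.uIcc_of_le (by norm_num)] at hx
    have : tri (-x) = 1 - x := by
      unfold tri; rw [abs_neg, abs_of_nonneg hx.1]; exact max_eq_right (by linarith [hx.2])
    simp only [this]
    push_cast
    ring_nf
  rw [e1, e2, half_tri α hα, half_tri (-α) (neg_ne_zero.2 hα)]
  field_simp
  ring

/-- Fejer kernel -/
noncomputable def fej : ℝ → ℂ := 𝓕 (fun ξ : ℝ => (tri ξ : ℂ))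

lemma fej_cont : Continuous fej :=
  VectorFourier.fourierIntegral_continuous Real.continuous_fourierChar (by fun_prop)
    tri_integrable

lemma fej_bound : ∃ C : ℝ, 0 < C ∧ ∀ y, ‖fej y‖ ≤ C * (1 + y ^ 2)⁻¹ := by
  set I := ∫ ξ : ℝ, ‖(tri ξ : ℂ)‖ with hI
  have hI0 : 0 ≤ I := integral_nonneg fun _ => norm_nonneg _
  refine ⟨I + 4, by linarith, fun y => ?_⟩
  have h1 : ‖fej y‖ ≤ I := by
    unfold fej
    exact VectorFourier.norm_fourierIntegral_le_integral_norm _ _ _ _ _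
  have h2 : ‖fej y‖ * y ^ 2 ≤ 4 := by
    by_cases hy : y = 0
    · simp [hy]
    have hα : (-2 * Real.pi * y : ℝ) * Complex.I ≠ 0 := by
      simp [hy, Real.pi_ne_zero]
    have : fej y = ∫ ξ : ℝ, (tri ξ : ℂ) * Complex.exp (((-2 * Real.pi * y : ℝ) * Complex.I) * ξ) := by
      unfold fej
      rw [Real.fourier_real_eq_integral_exp_smul]
      congr 1
      ext ξ
      rw [smul_eq_mul, mul_comm]
      congr 2
      push_cast
      ring
    rw [this, full_tri _ hα, norm_div, norm_pow, norm_mul, Complex.norm_I, mul_one,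
      Complex.norm_real, Real.norm_eq_abs, sq_abs]
    have hn : ‖Complex.exp ((-2 * Real.pi * y : ℝ) * Complex.I) +
        Complex.exp (-((-2 * Real.pi * y : ℝ) * Complex.I)) - 2‖ ≤ 4 := by
      refine (norm_sub_le _ _).trans ?_
      have a1 := Complex.norm_exp_ofReal_mul_I (-2 * Real.pi * y)
      have a2 := Complex.norm_exp_ofReal_mul_I (-(-2 * Real.pi * y))
      rw [Complex.ofReal_neg, neg_mul] at a2
      have := norm_add_le (Complex.exp ((-2 * Real.pi * y : ℝ) * Complex.I))
        (Complex.exp (-((-2 * Real.pi * y : ℝ) * Complex.I)))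
      rw [a1, a2] at this
      have : ‖(2:ℂ)‖ = 2 := by simp
      linarith
    have hy2 : 0 < y ^ 2 := by positivity
    have hpi : 1 ≤ Real.pi ^ 2 := by nlinarith [Real.pi_gt_three]
    rw [div_mul_eq_mul_div, div_le_iff₀ (by positivity)]
    nlinarith
  rw [← div_eq_mul_inv, le_div_iff₀ (by positivity)]
  linarith

lemma fej_integrable : Integrable fej := by
  obtain ⟨C, _, hC⟩ := fej_bound
  exact (integrable_inv_one_add_sq.const_mul C).mono' fej_cont.aestronglyMeasurable
    (Filter.Eventually.of_forall hC)

lemma tri_eq (ξ : ℝ) : (tri ξ : ℂ) =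
    ∫ y : ℝ, fej y * Complex.exp (Complex.I * ((2 * Real.pi * y * ξ : ℝ) : ℂ)) := by
  have hc : Continuous (fun ξ => (tri ξ : ℂ)) := Complex.continuous_ofReal.comp tri_cont
  have := congrFun (hc.fourierInv_fourier_eq tri_integrable fej_integrable) ξ
  rw [← this, Real.fourierInv_eq' ]
  congr 1
  ext y
  rw [smul_eq_mul, mul_comm]
  congr 2
  simp
  ring

/-- averaging bound -/
lemma avg_bound (V : ℝ → ENNReal) (hV : Measurable V) (M : ENNReal) (x c : ℝ) (hc : 0 < c)
    (hM : ∀ r, 0 < r → ∫⁻ y in Metric.ball x r, V y ≤ ENNReal.ofReal (2 * r) * M) :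
    ∫⁻ y : ℝ, ENNReal.ofReal ((1 + y ^ 2)⁻¹) * V (x + c * y) ≤ 16 * M := by
  have hpt : ∀ y : ℝ, ENNReal.ofReal ((1 + y ^ 2)⁻¹) ≤
      ∑' k : ℕ, ENNReal.ofReal (4 * (4⁻¹) ^ k) * (Metric.ball (0:ℝ) (2 ^ k)).indicator 1 y := by
    intro y
    have hex : ∃ k : ℕ, |y| < 2 ^ k := pow_unbounded_of_one_lt _ (by norm_num)
    classical
    set k := Nat.find hex with hk
    have h1 : |y| < 2 ^ k := Nat.find_spec hex
    refine le_trans ?_ (ENNReal.le_tsum k)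
    have : (Metric.ball (0:ℝ) (2 ^ k)).indicator (1 : ℝ → ENNReal) y = 1 := by
      simp [Set.indicator, h1]
    rw [this, mul_one]
    apply ENNReal.ofReal_le_ofReal
    rcases Nat.eq_zero_or_pos k with h0 | h0
    · rw [h0]
      have : (1 + y ^ 2)⁻¹ ≤ 1 := inv_le_one_of_one_le₀ (by nlinarith [sq_nonneg y])
      simp; linarith
    · obtain ⟨j, hj⟩ := Nat.exists_eq_succ_of_ne_zero h0.ne'
      have h2 : ¬ |y| < 2 ^ j := Nat.find_min hex (by omega)
      push Not at h2
      rw [hj, Nat.succ_eq_add_one, pow_succ (4⁻¹ : ℝ)]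
      have h3 : (4:ℝ) ^ j ≤ y ^ 2 := by
        rw [← sq_abs y, show (4:ℝ) = 2 ^ 2 by norm_num, ← pow_mul, mul_comm, pow_mul]
        gcongr
      have h4 : (1 + y ^ 2)⁻¹ ≤ (4 ^ j)⁻¹ := by
        apply inv_anti₀ (by positivity); linarith
      rw [inv_pow]
      linarith
  calc ∫⁻ y : ℝ, ENNReal.ofReal ((1 + y ^ 2)⁻¹) * V (x + c * y)
      ≤ ∫⁻ y : ℝ, ∑' k : ℕ, ENNReal.ofReal (4 * (4⁻¹) ^ k) *
          ((Metric.ball (0:ℝ) (2 ^ k)).indicator 1 y * V (x + c * y)) := by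
        refine lintegral_mono fun y => ?_
        simp_rw [← mul_assoc]
        rw [ENNReal.tsum_mul_right]
        gcongr
        exact hpt y
    _ = ∑' k : ℕ, ∫⁻ y : ℝ, ENNReal.ofReal (4 * (4⁻¹) ^ k) *
          ((Metric.ball (0:ℝ) (2 ^ k)).indicator 1 y * V (x + c * y)) := by
        rw [lintegral_tsum]
        intro k
        have : Measurable ((Metric.ball (0:ℝ) (2 ^ k)).indicator (1 : ℝ → ENNReal)) :=
          measurable_one.indicator measurableSet_ball
        fun_prop
    _ ≤ ∑' k : ℕ, ENNReal.ofReal (8 * (2⁻¹) ^ k) * M := by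
        refine ENNReal.tsum_le_tsum fun k => ?_
        rw [lintegral_const_mul' _ _ ENNReal.ofReal_ne_top]
        have e : ∫⁻ y : ℝ, (Metric.ball (0:ℝ) (2 ^ k)).indicator 1 y * V (x + c * y) =
            ENNReal.ofReal c⁻¹ * ∫⁻ y in Metric.ball x (c * 2 ^ k), V y := by
          have hm := lintegral_map_equiv (μ := volume)
            ((Metric.ball x (c * 2 ^ k)).indicator V)
            ((Homeomorph.mulLeft₀ c hc.ne').trans (Homeomorph.addLeft x)).toMeasurableEquiv
          rw [← lintegral_indicator measurableSet_ball]
          have hmap : Measure.map (((Homeomorph.mulLeft₀ c hc.ne').trans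
              (Homeomorph.addLeft x)).toMeasurableEquiv) volume
              = ENNReal.ofReal c⁻¹ • (volume : Measure ℝ) := by
            have h1 := Real.map_volume_mul_left hc.ne'
            rw [abs_of_pos (inv_pos.2 hc)] at h1
            have h2 : Measure.map (fun y => x + y) (volume : Measure ℝ) = volume :=
              map_add_left_eq_self _ _
            have h3 : Measure.map ((fun y => x + y) ∘ (fun y => c * y)) (volume : Measure ℝ)
                = ENNReal.ofReal c⁻¹ • (volume : Measure ℝ) := by
              rw [← Measure.map_map (by fun_prop) (by fun_prop), h1, Measure.map_smul, h2]
            exact h3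
          rw [hmap, lintegral_smul_measure] at hm
          rw [smul_eq_mul] at hm
          rw [hm]
          refine lintegral_congr fun y => ?_
          change _ = (Metric.ball x (c * 2 ^ k)).indicator V (x + c * y)
          have : x + c * y ∈ Metric.ball x (c * 2 ^ k) ↔ y ∈ Metric.ball (0:ℝ) (2 ^ k) := by
            simp [Real.dist_eq, abs_mul, abs_of_pos hc, hc]
          by_cases hy : y ∈ Metric.ball (0:ℝ) (2 ^ k)
          · rw [Set.indicator_of_mem hy, Set.indicator_of_mem (this.2 hy)]; simp
          · rw [Set.indicator_of_notMem hy, Set.indicator_of_notMem (fun h => hy (this.1 h))]; simp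
        rw [e]
        calc _ ≤ ENNReal.ofReal (4 * 4⁻¹ ^ k) * (ENNReal.ofReal c⁻¹ *
              (ENNReal.ofReal (2 * (c * 2 ^ k)) * M)) := by
              gcongr
              exact hM _ (by positivity)
          _ = _ := by
              rw [← mul_assoc, ← mul_assoc, ← ENNReal.ofReal_mul (by positivity),
                ← ENNReal.ofReal_mul (by positivity)]
              congr 2
              have : (4:ℝ)⁻¹ ^ k = 2⁻¹ ^ k * 2⁻¹ ^ k := by
                rw [← mul_pow]; norm_num
              rw [this]
              have h2 : (2:ℝ)⁻¹ ^ k * 2 ^ k = 1 := by rw [← mul_pow]; norm_num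
              have h3 : c⁻¹ * c = 1 := inv_mul_cancel₀ hc.ne'
              linear_combination (8 * 2⁻¹ ^ k * (c⁻¹ * c)) * h2 + (8 * 2⁻¹ ^ k) * h3
    _ = 16 * M := by
        rw [ENNReal.tsum_mul_right, ← ENNReal.ofReal_tsum_of_nonneg (fun k => by positivity)
          ((summable_geometric_of_lt_one (by norm_num) (by norm_num)).mul_left _), tsum_mul_left,
          tsum_geometric_of_lt_one (by norm_num) (by norm_num)]
        norm_num

/-- weight of the superposition of triangle functions giving exp(-r^a) -/
noncomputable def wt (a r : ℝ) : ℝ :=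
  a ^ 2 * (r ^ (2 * a - 1) * Real.exp (-r ^ a)) - a * (a - 1) * (r ^ (a - 1) * Real.exp (-r ^ a))

lemma wt_integrable (a : ℝ) (ha : 0 < a) : IntegrableOn (wt a) (Set.Ioi 0) := by
  unfold wt
  exact ((integrableOn_rpow_mul_exp_neg_rpow (by linarith) ha).const_mul _).sub
    ((integrableOn_rpow_mul_exp_neg_rpow (by linarith) ha).const_mul _)

lemma tendsto_aux (a s : ℝ) (ha : 0 < a) :
    Filter.Tendsto (fun r : ℝ => r ^ s * Real.exp (-r ^ a)) Filter.atTop (nhds 0) := by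
  have h := (tendsto_rpow_mul_exp_neg_mul_atTop_nhds_zero (s / a) 1 one_pos).comp
    (tendsto_rpow_atTop ha)
  refine h.congr' ?_
  filter_upwards [Filter.eventually_gt_atTop 0] with r hr
  simp only [Function.comp]
  rw [← Real.rpow_mul hr.le, mul_div_cancel₀ _ ha.ne']
  ring_nf

lemma psi_eq (a ρ : ℝ) (ha : 0 < a) (hρ : 0 < ρ) :
    ∫ r in Set.Ioi (0:ℝ), wt a r * tri (ρ / r) = Real.exp (-ρ ^ a) := by
  have hint : IntegrableOn (fun r => wt a r * tri (ρ / r)) (Set.Ioi 0) := by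
    refine Integrable.mul_bdd (c := 1) (wt_integrable a ha) ?_ ?_
    · have := tri_cont.measurable
      exact Measurable.aestronglyMeasurable (by fun_prop)
    · refine Filter.Eventually.of_forall fun r => ?_
      rw [Real.norm_of_nonneg (tri_nonneg _)]
      exact tri_le_one _
  have h1 : ∫ r in Set.Ioi (0:ℝ), wt a r * tri (ρ / r) =
      ∫ r in Set.Ioi ρ, wt a r * tri (ρ / r) := by
    refine setIntegral_eq_of_subset_of_forall_sdiff_eq_zero measurableSet_Ioi
      (Set.Ioi_subset_Ioi hρ.le) fun r hr => ?_
    have hr0 : 0 < r := hr.1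
    have hr1 : r ≤ ρ := not_lt.1 hr.2
    rw [tri_zero, mul_zero]
    rw [abs_of_pos (div_pos hρ hr0), le_div_iff₀ hr0]
    linarith
  rw [h1]
  have hd : ∀ r ∈ Set.Ici ρ, HasDerivAt (fun r : ℝ =>
      -((r - ρ) * (a * r ^ (a - 1) * Real.exp (-r ^ a))) - Real.exp (-r ^ a))
      (wt a r * tri (ρ / r)) r := by
    intro r hr
    have hr : ρ ≤ r := hr
    have hr0 : 0 < r := hρ.trans_le hr
    have d1 : HasDerivAt (fun r : ℝ => Real.exp (-r ^ a))
        (Real.exp (-r ^ a) * -(a * r ^ (a - 1))) r :=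
      (Real.hasDerivAt_rpow_const (Or.inl hr0.ne')).neg.exp
    have d2 : HasDerivAt (fun r : ℝ => a * r ^ (a - 1)) (a * ((a - 1) * r ^ (a - 1 - 1))) r :=
      (Real.hasDerivAt_rpow_const (Or.inl hr0.ne')).const_mul a
    have d3 := ((((hasDerivAt_id r).sub_const ρ).mul (d2.mul d1)).neg).sub d1
    refine d3.congr_deriv ?_
    have ht : tri (ρ / r) = 1 - ρ / r := by
      unfold tri
      rw [abs_of_pos (div_pos hρ hr0)]
      apply max_eq_right
      rw [sub_nonneg, div_le_one hr0]
      exact hr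
    rw [ht, wt]
    have p1 : r ^ (a - 1) = r ^ (a - 1 - 1) * r := by
      rw [← Real.rpow_add_one hr0.ne']; ring_nf
    have p2 : r ^ (2 * a - 1) = r ^ (a - 1) * r ^ (a - 1) * r := by
      rw [← Real.rpow_add hr0, ← Real.rpow_add_one hr0.ne']; ring_nf
    simp only [id, Pi.mul_apply]
    rw [p2, p1]
    field_simp
    ring
  have ht : Filter.Tendsto (fun r : ℝ =>
      -((r - ρ) * (a * r ^ (a - 1) * Real.exp (-r ^ a))) - Real.exp (-r ^ a))
      Filter.atTop (nhds 0) := by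
    have t1 := (tendsto_aux a a ha).const_mul a
    have t2 := (tendsto_aux a (a - 1) ha).const_mul (ρ * a)
    have t3 := tendsto_aux a 0 ha
    have t4 := ((t1.neg).add t2).sub t3
    simp only [mul_zero, neg_zero, add_zero, sub_zero] at t4
    refine t4.congr' ?_
    filter_upwards [Filter.eventually_gt_atTop 0] with r hr
    have p1 : r ^ a = r ^ (a - 1) * r := by
      rw [← Real.rpow_add_one hr.ne']; ring_nf
    rw [Real.rpow_zero]
    generalize Real.exp (-r ^ a) = e
    rw [p1]
    ring
  rw [integral_Ioi_of_hasDerivAt_of_tendsto' hd (hint.mono_set (Set.Ioi_subset_Ioi hρ.le)) ht]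
  simp

lemma fub_aux {μ : Measure ℝ} [SFinite μ] (Φ m : ℝ → ℂ) (hΦ : Integrable Φ) (hm : Integrable m μ)
    (E : ℝ → ℝ → ℂ) (hE : Measurable (Function.uncurry E)) (hE1 : ∀ z ξ, ‖E z ξ‖ ≤ 1) :
    ∫ ξ, Φ ξ * ∫ z, m z * E z ξ ∂μ = ∫ z, m z * (∫ ξ, Φ ξ * E z ξ) ∂μ := by
  simp_rw [← integral_const_mul]
  rw [integral_integral_swap]
  · congr 1; ext z; congr 1; ext ξ; ring
  · have h1 := (hΦ.mul_prod hm).mul_bdd (g := fun z : ℝ × ℝ => E z.2 z.1) (c := 1)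
      (hE.comp measurable_swap).aestronglyMeasurable (Filter.Eventually.of_forall fun z => hE1 _ _)
    refine h1.congr (Filter.Eventually.of_forall fun z => ?_)
    simp [Function.uncurry, mul_assoc]

lemma tri_conv (Φ : ℝ → ℂ) (hΦ : Integrable Φ) (x c : ℝ) :
    ∫ ξ, (Φ ξ * Complex.exp (Complex.I * ((x * ξ : ℝ) : ℂ))) * (tri (c * ξ) : ℂ) =
      ∫ y, fej y * ∫ ξ, Φ ξ *
        Complex.exp (Complex.I * (((x + 2 * Real.pi * c * y) * ξ : ℝ) : ℂ)) := by
  have hΦ' : Integrable (fun ξ => Φ ξ * Complex.exp (Complex.I * ((x * ξ : ℝ) : ℂ))) := by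
    refine hΦ.mul_bdd (c := 1) (Continuous.aestronglyMeasurable (by fun_prop)) ?_
    refine Filter.Eventually.of_forall fun ξ => ?_
    rw [mul_comm, Complex.norm_exp_ofReal_mul_I]
  simp_rw [tri_eq]
  rw [fub_aux _ fej hΦ' fej_integrable
    (fun y ξ => Complex.exp (Complex.I * ((2 * Real.pi * y * (c * ξ) : ℝ) : ℂ)))]
  · congr 1
    ext y
    congr 2
    ext ξ
    rw [mul_assoc, ← Complex.exp_add]
    congr 2
    push_cast
    ring
  · unfold Function.uncurry
    fun_prop
  · intro y ξ
    rw [mul_comm, Complex.norm_exp_ofReal_mul_I]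

lemma psi_conv (a : ℝ) (ha : 0 < a) (s : ℝ) (hs : 0 < s) (Φ : ℝ → ℂ) (hΦ : Integrable Φ) (x : ℝ) :
    ∫ ξ, (Φ ξ * Complex.exp (Complex.I * ((x * ξ : ℝ) : ℂ))) *
        ((Real.exp (-(s * |ξ| ^ a)) : ℝ) : ℂ) =
      ∫ r in Set.Ioi (0:ℝ), (wt a r : ℂ) *
        ∫ ξ, (Φ ξ * Complex.exp (Complex.I * ((x * ξ : ℝ) : ℂ))) *
          (tri (s ^ (1 / a) / r * ξ) : ℂ) := by
  have hΦ' : Integrable (fun ξ => Φ ξ * Complex.exp (Complex.I * ((x * ξ : ℝ) : ℂ))) := by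
    refine hΦ.mul_bdd (c := 1) (Continuous.aestronglyMeasurable (by fun_prop)) ?_
    refine Filter.Eventually.of_forall fun ξ => ?_
    rw [mul_comm, Complex.norm_exp_ofReal_mul_I]
  have hw : Integrable (fun r => (wt a r : ℂ)) (volume.restrict (Set.Ioi 0)) :=
    (wt_integrable a ha).ofReal
  rw [← fub_aux _ _ hΦ' hw (fun r ξ => (tri (s ^ (1 / a) / r * ξ) : ℂ))]
  · refine integral_congr_ae ?_
    have h0 : ∀ᵐ ξ : ℝ, ξ ≠ 0 := by
      simp [ae_iff]
    filter_upwards [h0] with ξ hξ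
    congr 1
    have hσ : 0 < s ^ (1 / a) := Real.rpow_pos_of_pos hs _
    have hξ' : 0 < |ξ| := abs_pos.2 hξ
    have := psi_eq a (s ^ (1 / a) * |ξ|) ha (by positivity)
    rw [Real.mul_rpow hσ.le hξ'.le, ← Real.rpow_mul hs.le, one_div_mul_cancel ha.ne',
      Real.rpow_one] at this
    rw [← this, ← integral_complex_ofReal]
    refine setIntegral_congr_fun measurableSet_Ioi fun r hr => ?_
    push_cast
    congr 2
    unfold tri
    rw [abs_mul, abs_div, abs_div, abs_mul, abs_abs]
    ring_nf
  · have := tri_cont.measurable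
    unfold Function.uncurry
    fun_prop
  · intro r ξ
    rw [Complex.norm_real, Real.norm_of_nonneg (tri_nonneg _)]
    exact tri_le_one _

lemma pointwise (a : ℝ) (ha : 0 < a) : ∃ K : ENNReal, K ≠ ⊤ ∧ ∀ (s : ℝ), 0 < s →
    ∀ (Φ : ℝ → ℂ), Integrable Φ → ∀ V : ℝ → ENNReal, Measurable V →
    (∀ x, ‖∫ ξ, Φ ξ * Complex.exp (Complex.I * ((x * ξ : ℝ) : ℂ))‖ₑ ≤ V x) → ∀ x,
    ‖∫ ξ, (Φ ξ * Complex.exp (Complex.I * ((x * ξ : ℝ) : ℂ))) *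
        ((Real.exp (-(s * |ξ| ^ a)) : ℝ) : ℂ)‖ₑ ≤ K * maxFn V x := by
  obtain ⟨C, hC, hfej⟩ := fej_bound
  refine ⟨(∫⁻ r in Set.Ioi (0:ℝ), ‖(wt a r : ℂ)‖ₑ) * (ENNReal.ofReal C * 16), ?_, ?_⟩
  · refine ENNReal.mul_ne_top ?_ (by finiteness)
    have hw : Integrable (fun r => (wt a r : ℂ)) (volume.restrict (Set.Ioi 0)) :=
      (wt_integrable a ha).ofReal
    exact hw.2.ne
  intro s hs Φ hΦ V hV hu x
  have hσ : 0 < s ^ (1 / a) := Real.rpow_pos_of_pos hs _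
  rw [psi_conv a ha s hs Φ hΦ x]
  have inner : ∀ r ∈ Set.Ioi (0:ℝ), ‖(wt a r : ℂ) *
        ∫ ξ, (Φ ξ * Complex.exp (Complex.I * ((x * ξ : ℝ) : ℂ))) *
          (tri (s ^ (1 / a) / r * ξ) : ℂ)‖ₑ ≤
      ‖(wt a r : ℂ)‖ₑ * (ENNReal.ofReal C * 16 * maxFn V x) := by
    intro r hr
    have hr : 0 < r := hr
    rw [enorm_mul]
    gcongr
    rw [tri_conv Φ hΦ]
    have hc : 0 < 2 * Real.pi * (s ^ (1 / a) / r) := by positivity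
    calc _ ≤ ∫⁻ y, ‖fej y * ∫ ξ, Φ ξ * Complex.exp (Complex.I *
            (((x + 2 * Real.pi * (s ^ (1 / a) / r) * y) * ξ : ℝ) : ℂ))‖ₑ :=
          enorm_integral_le_lintegral_enorm _
      _ ≤ ∫⁻ y, ENNReal.ofReal C * (ENNReal.ofReal ((1 + y ^ 2)⁻¹) *
            V (x + 2 * Real.pi * (s ^ (1 / a) / r) * y)) := by
          refine lintegral_mono fun y => ?_
          rw [enorm_mul, ← mul_assoc, ← ENNReal.ofReal_mul hC.le]
          gcongr
          · rw [← ofReal_norm]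
            exact ENNReal.ofReal_le_ofReal (hfej y)
          · exact hu _
      _ = ENNReal.ofReal C * ∫⁻ y, (ENNReal.ofReal ((1 + y ^ 2)⁻¹) *
            V (x + 2 * Real.pi * (s ^ (1 / a) / r) * y)) :=
          lintegral_const_mul' _ _ ENNReal.ofReal_ne_top
      _ ≤ ENNReal.ofReal C * (16 * maxFn V x) := by
          gcongr
          exact avg_bound V hV _ x _ hc fun ρ hρ => ball_le_maxFn V x ρ hρ
      _ = _ := by rw [mul_assoc]
  calc _ ≤ ∫⁻ r in Set.Ioi (0:ℝ), ‖(wt a r : ℂ) *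
        ∫ ξ, (Φ ξ * Complex.exp (Complex.I * ((x * ξ : ℝ) : ℂ))) *
          (tri (s ^ (1 / a) / r * ξ) : ℂ)‖ₑ := enorm_integral_le_lintegral_enorm _
    _ ≤ ∫⁻ r in Set.Ioi (0:ℝ), ‖(wt a r : ℂ)‖ₑ * (ENNReal.ofReal C * 16 * maxFn V x) :=
        setLIntegral_mono' measurableSet_Ioi inner
    _ = _ := by
        rw [lintegral_mul_const _ (by unfold wt; fun_prop)]
        simp only [mul_assoc]

lemma ftransform_integrable (f : SchwartzMap ℝ ℂ) : Integrable (ftransform f) := by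
  have h := ((𝓕 f : SchwartzMap ℝ ℂ).integrable (μ := volume)).comp_div
    (R := 2 * Real.pi) (by positivity)
  refine (h.const_mul (1 / (2 * Real.pi) : ℂ)).congr (Filter.Eventually.of_forall fun ξ => ?_)
  simp only [ftransform]
  congr 1
  rw [SchwartzMap.fourier_coe, Real.fourier_real_eq_integral_exp_smul]
  congr 1
  ext y
  rw [smul_eq_mul, mul_comm]
  congr 2
  push_cast
  field_simp

lemma main_aux (a : ℝ) (ha : 0 < a) : ∃ C : ℝ, 0 < C ∧ ∀ (g h : ℝ → ℝ)
    (_ : ∀ t ∈ Set.Ioo (0 : ℝ) 1, 0 ≤ h t ∧ h t ≤ g t) (f : SchwartzMap ℝ ℂ),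
      eLpNorm (fun x => ⨆ t : Set.Ioo (0 : ℝ) 1,
          ‖Eop a g (ftransform f) t x‖) 2 volume ≤
        ENNReal.ofReal C * eLpNorm (fun x => ⨆ t : Set.Ioo (0 : ℝ) 1,
          ‖Eop a h (ftransform f) t x‖) 2 volume := by
  obtain ⟨K, hK, hpt⟩ := pointwise a ha
  set D : ENNReal := 4 * 1 + 4 * K ^ 2 * 32 with hD
  have hDtop : D ≠ ⊤ := by rw [hD]; finiteness
  have hD1 : D ≠ 0 := by simp [hD]
  refine ⟨(D ^ (1 / 2 : ℝ)).toReal, ?_, ?_⟩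
  · apply ENNReal.toReal_pos
    · simp [hD1, hDtop]
    · exact ENNReal.rpow_ne_top_of_nonneg (by norm_num) hDtop
  intro g h hgh f
  rw [ENNReal.ofReal_toReal (ENNReal.rpow_ne_top_of_nonneg (by norm_num) hDtop)]
  have hF := ftransform_integrable f
  set F := ftransform f with hFdef
  -- the frequency-side functions
  set Φ : ℝ → ℝ → ℂ := fun t ξ => F ξ *
    Complex.exp (Complex.I * ((t * |ξ| ^ a : ℝ) : ℂ) - ((h t * |ξ| ^ a : ℝ) : ℂ)) with hΦdef
  have hexp : ∀ t ∈ Set.Ioo (0:ℝ) 1, ∀ ξ : ℝ,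
      ‖Complex.exp (Complex.I * ((t * |ξ| ^ a : ℝ) : ℂ) - ((h t * |ξ| ^ a : ℝ) : ℂ))‖ ≤ 1 := by
    intro t ht ξ
    rw [Complex.norm_exp]
    simp only [Complex.sub_re, Complex.mul_re, Complex.I_re, Complex.I_im, Complex.ofReal_re,
      Complex.ofReal_im]
    rw [Real.exp_le_one_iff]
    have := mul_nonneg (hgh t ht).1 (Real.rpow_nonneg (abs_nonneg ξ) a)
    linarith
  have hΦ : ∀ t ∈ Set.Ioo (0:ℝ) 1, Integrable (Φ t) := by
    intro t ht
    refine hF.mul_bdd (c := 1) (Measurable.aestronglyMeasurable (by fun_prop)) ?_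
    exact Filter.Eventually.of_forall fun ξ => hexp t ht ξ
  have hEh : ∀ t x, Eop a h F t x =
    ∫ ξ, Φ t ξ * Complex.exp (Complex.I * ((x * ξ : ℝ) : ℂ)) := fun t x => rfl
  have hunit : ∀ x ξ : ℝ, ‖Complex.exp (Complex.I * ((x * ξ : ℝ) : ℂ))‖ = 1 := by
    intro x ξ
    rw [mul_comm, Complex.norm_exp_ofReal_mul_I]
  set B := ∫ ξ, ‖F ξ‖ with hB
  have hEB : ∀ t ∈ Set.Ioo (0:ℝ) 1, ∀ x, ‖Eop a h F t x‖ ≤ B := by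
    intro t ht x
    rw [hEh]
    refine norm_integral_le_of_norm_le hF.norm (Filter.Eventually.of_forall fun ξ => ?_)
    rw [norm_mul, hunit, mul_one, hΦdef, norm_mul]
    exact mul_le_of_le_one_right (norm_nonneg _) (hexp t ht ξ)
  have hcont : ∀ t ∈ Set.Ioo (0:ℝ) 1, Continuous fun x => Eop a h F t x := by
    intro t ht
    simp only [hEh]
    refine continuous_of_dominated (bound := fun ξ => ‖Φ t ξ‖) ?_ ?_ (hΦ t ht).norm ?_
    · intro x
      exact (hΦ t ht).aestronglyMeasurable.mul (Continuous.aestronglyMeasurable (by fun_prop))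
    · intro x
      refine Filter.Eventually.of_forall fun ξ => ?_
      rw [norm_mul, hunit, mul_one]
    · refine Filter.Eventually.of_forall fun ξ => ?_
      fun_prop
  set U : ℝ → ℝ := fun x => ⨆ t : Set.Ioo (0 : ℝ) 1, ‖Eop a h F t x‖ with hU
  have hbdd : ∀ x, BddAbove (Set.range fun t : Set.Ioo (0 : ℝ) 1 => ‖Eop a h F t x‖) := by
    intro x
    refine ⟨B, ?_⟩
    rintro _ ⟨t, rfl⟩
    exact hEB t t.2 x
  have hUm : Measurable U :=
    (lowerSemicontinuous_ciSup hbdd fun t => (hcont t t.2).norm.lowerSemicontinuous).measurable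
  have hU0 : ∀ x, 0 ≤ U x := fun x => Real.iSup_nonneg fun t => norm_nonneg _
  have hB0 : 0 ≤ B := integral_nonneg fun _ => norm_nonneg _
  have hUB : ∀ x, U x ≤ B := fun x => Real.iSup_le (fun t => hEB t t.2 x) hB0
  set V : ℝ → ENNReal := fun x => ‖U x‖ₑ with hV
  have hVm : Measurable V := hUm.enorm
  have hVB : ∀ x, V x ≤ ENNReal.ofReal B := by
    intro x
    rw [hV]
    simp only []
    rw [Real.enorm_of_nonneg (hU0 x)]
    exact ENNReal.ofReal_le_ofReal (hUB x)
  have hEV : ∀ t ∈ Set.Ioo (0:ℝ) 1, ∀ x, ‖Eop a h F t x‖ₑ ≤ V x := by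
    intro t ht x
    rw [hV]
    simp only []
    rw [Real.enorm_of_nonneg (hU0 x), ← ofReal_norm]
    exact ENNReal.ofReal_le_ofReal (le_ciSup (hbdd x) ⟨t, ht⟩)
  have hEg : ∀ t ∈ Set.Ioo (0:ℝ) 1, ∀ x, ‖Eop a g F t x‖ₑ ≤ V x + K * maxFn V x := by
    intro t ht x
    have e : Eop a g F t x = ∫ ξ, (Φ t ξ * Complex.exp (Complex.I * ((x * ξ : ℝ) : ℂ))) *
        ((Real.exp (-((g t - h t) * |ξ| ^ a)) : ℝ) : ℂ) := by
      unfold Eop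
      congr 1
      ext ξ
      rw [hΦdef, mul_right_comm (F ξ * _)]
      congr 1
      rw [mul_assoc, Complex.ofReal_exp, ← Complex.exp_add]
      congr 2
      push_cast
      ring
    rcases eq_or_lt_of_le (hgh t ht).2 with heq | hlt
    · refine le_add_right ?_
      refine le_trans (le_of_eq ?_) (hEV t ht x)
      rw [e, hEh, heq]
      simp
    · refine le_add_left ?_
      rw [e]
      exact hpt _ (sub_pos.2 hlt) (Φ t) (hΦ t ht) V hVm (fun x => hEV t ht x) x
  have hfin : ∀ x, V x + K * maxFn V x ≠ ⊤ := by
    intro x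
    have h1 := ne_top_of_le_ne_top ENNReal.ofReal_ne_top (hVB x)
    have h2 := ne_top_of_le_ne_top ENNReal.ofReal_ne_top (maxFn_le V _ hVB x)
    finiteness
  have hG : ∀ x, ‖⨆ t : Set.Ioo (0 : ℝ) 1, ‖Eop a g F t x‖‖ₑ ≤ V x + K * maxFn V x := by
    intro x
    rw [Real.enorm_of_nonneg (Real.iSup_nonneg fun t => norm_nonneg _)]
    apply ENNReal.ofReal_le_of_le_toReal
    refine Real.iSup_le (fun t => ?_) ENNReal.toReal_nonneg
    have := ENNReal.toReal_mono (hfin x) (hEg t t.2 x)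
    rwa [toReal_enorm] at this
  have hsq : ∫⁻ x, ‖⨆ t : Set.Ioo (0 : ℝ) 1, ‖Eop a g F t x‖‖ₑ ^ 2 ≤ D * ∫⁻ x, V x ^ 2 := by
    calc _ ≤ ∫⁻ x, (4 * V x ^ 2 + 4 * K ^ 2 * maxFn V x ^ 2) := by
          refine lintegral_mono fun x => ?_
          refine (pow_le_pow_left' (hG x) 2).trans ?_
          rcases le_total (V x) (K * maxFn V x) with hle | hle
          · refine le_add_left ?_
            calc (V x + K * maxFn V x) ^ 2 ≤ (K * maxFn V x + K * maxFn V x) ^ 2 := by gcongr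
              _ = _ := by ring
          · refine le_add_right ?_
            calc (V x + K * maxFn V x) ^ 2 ≤ (V x + V x) ^ 2 := by gcongr
              _ = _ := by ring
      _ = 4 * (∫⁻ x, V x ^ 2) + 4 * K ^ 2 * ∫⁻ x, maxFn V x ^ 2 := by
          rw [lintegral_add_left (by fun_prop), lintegral_const_mul' _ _ (by finiteness),
            lintegral_const_mul' _ _ (by finiteness)]
      _ ≤ 4 * (∫⁻ x, V x ^ 2) + 4 * K ^ 2 * (32 * ∫⁻ x, V x ^ 2) := by
          gcongr
          exact maxFn_L2 V hVm _ ENNReal.ofReal_ne_top hVB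
      _ = _ := by rw [hD]; ring
  have heq : ∀ w : ℝ → ℝ, eLpNorm w 2 volume = (∫⁻ x, ‖w x‖ₑ ^ 2) ^ (1 / 2 : ℝ) := by
    intro w
    rw [eLpNorm_eq_lintegral_rpow_enorm_toReal (by norm_num) (by norm_num)]
    simp
  rw [heq, heq, ← ENNReal.mul_rpow_of_nonneg _ _ (by norm_num)]
  exact ENNReal.rpow_le_rpow hsq (by norm_num)

theorem dissipation_comparison (a γ : ℝ) (ha : 0 < a) (hγ : 0 < γ)
    (g h : ℝ → ℝ) (hgh : ∀ t ∈ Set.Ioo (0 : ℝ) 1, 0 ≤ h t ∧ h t ≤ g t) :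
    ∃ C : ℝ, 0 < C ∧ ∀ f : SchwartzMap ℝ ℂ,
      (eLpNorm (fun x => ⨆ t : Set.Ioo (0 : ℝ) 1,
          ‖Eop a g (ftransform f) t x‖) 2 volume ≤
        ENNReal.ofReal C * eLpNorm (fun x => ⨆ t : Set.Ioo (0 : ℝ) 1,
          ‖Eop a h (ftransform f) t x‖) 2 volume) ∧
      (eLpNorm (fun x => ⨆ t : Set.Ioo (0 : ℝ) 1,
          ‖Eop a (fun t => t ^ γ) (ftransform f) t x‖) 2 volume ≤
        ENNReal.ofReal C * eLpNorm (fun x => ⨆ t : Set.Ioo (0 : ℝ) 1,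
          ‖Eop a (fun _ => 0) (ftransform f) t x‖) 2 volume) := by
  obtain ⟨C, hC, hmain⟩ := main_aux a ha
  refine ⟨C, hC, fun f => ⟨hmain g h hgh f, hmain _ _ (fun t ht => ⟨le_rfl, ?_⟩) f⟩⟩
  exact Real.rpow_nonneg ht.1.le γ
end
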